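/- Let k ⊂ ℂ be an imaginary quadratic field, let n ≥ 1, let L₁, …, Lₙ ⊂ ℂ be quadratic extensions of k, and let L₁′, …, Lₙ′ be their images under complex conjugation. Assume the compositum L of L₁, …, Lₙ, L₁′, …, Lₙ′ satisfies [L : k] = 2^{2n}. Let 𝒬 be the set of nonzero prime ideals 𝔭 of the ring of integers O_k that do not split in any of the extensions L_i/k or L_i′/k (1 ≤ i ≤ n). Then #{𝔭 ∈ 𝒬 : N_{k/ℚ}(𝔭) ≤ X} = (1/2^{2n})·X/log X + O(X/(log X)²) as X → ∞, where the implied constant may depend on k and the L_i. -/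

import Mathlib

open NumberField Filter

/-- The image of an intermediate field of `ℂ/ℚ` under complex conjugation. -/
noncomputable def conjField (L : IntermediateField ℚ ℂ) : IntermediateField ℚ ℂ :=
  L.map (RingHom.toRatAlgHom (starRingEnd ℂ))

/-- A nonzero prime ideal `𝔭` of `O_k` *splits* in an extension `L/k`
(given by `h : k ≤ L`) if `𝔭 O_L` is a product of two distinct prime ideals of `O_L`. -/
def SplitsIn (k L : IntermediateField ℚ ℂ) (h : k ≤ L) (𝔭 : Ideal (𝓞 ↥k)) : Prop :=
  ∃ P Q : Ideal (𝓞 ↥L), P ≠ Q ∧ P.IsPrime ∧ Q.IsPrime ∧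
    Ideal.map (RingOfIntegers.mapRingHom (IntermediateField.inclusion h)) 𝔭 = P * Q

namespace PrimeIdealCount

section LatticePoints

open MeasureTheory Bornology Metric Pointwise

/-- A segment joining a point of a set to a point outside of it meets the frontier. -/
theorem exists_mem_frontier_of_mem_of_notMem {E : Type*} [NormedAddCommGroup E] [NormedSpace ℝ E]
    {D : Set E} {x y : E} (hx : x ∈ D) (hy : y ∉ D) : ∃ z ∈ frontier D, z ∈ segment ℝ x y := by
  by_contra! h
  have hpre : IsPreconnected (segment ℝ x y) := (convex_segment x y).isPreconnected
  have hsub : segment ℝ x y ⊆ interior D ∪ interior Dᶜ := by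
    intro z hz
    have hz' : z ∉ frontier D := fun hf => h z hf hz
    rw [frontier, Set.mem_sdiff, not_and_not_right] at hz'
    by_cases hc : z ∈ closure D
    · exact Or.inl (hz' hc)
    · right
      rwa [interior_compl, Set.mem_compl_iff]
  suffices H : (segment ℝ x y ∩ (interior D ∩ interior Dᶜ)).Nonempty by
    obtain ⟨w, -, hw1, hw2⟩ := H
    exact (interior_subset hw2) (interior_subset hw1)
  refine hpre _ _ isOpen_interior isOpen_interior hsub
    (⟨x, left_mem_segment _ _ _, ?_⟩) (⟨y, right_mem_segment _ _ _, ?_⟩)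
  · rcases hsub (left_mem_segment ℝ x y) with h1 | h1
    · exact h1
    · exact absurd hx (interior_subset h1)
  · rcases hsub (right_mem_segment ℝ x y) with h1 | h1
    · exact absurd (interior_subset h1) hy
    · exact h1

variable {E : Type*} [NormedAddCommGroup E] [NormedSpace ℝ E] [FiniteDimensional ℝ E]
  [MeasurableSpace E] [BorelSpace E]

/-- The number of lattice points in `t • D`, with a power saving error term, when the frontier of
`D` can be covered efficiently by small balls. -/
theorem abs_card_lattice_inter_smul_sub_le (μ : Measure E) [μ.IsAddHaarMeasure]
    (L : Submodule ℤ E) [DiscreteTopology L] [IsZLattice ℝ L] {D : Set E} (hD : IsBounded D)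
    (hDm : MeasurableSet D) {C : ℝ} (hC : 0 ≤ C) (m : ℕ)
    (hcov : ∀ N : ℕ, 1 ≤ N → ∃ T : Finset E, (T.card : ℝ) ≤ C * N ^ m ∧
      frontier D ⊆ ⋃ x ∈ T, closedBall x (C / N)) :
    ∃ C' : ℝ, ∀ t : ℝ, 1 ≤ t →
      |(Nat.card ((L : Set E) ∩ t • D : Set E) : ℝ) -
        μ.real D / ZLattice.covolume L μ * t ^ Module.finrank ℝ E| ≤ C' * t ^ m := by
  classical
  let b := Module.Free.chooseBasis ℤ L
  set F := ZSpan.fundamentalDomain (b.ofZLatticeBasis ℝ L) with hF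
  have hspan : Submodule.span ℤ (Set.range (b.ofZLatticeBasis ℝ L)) = L := b.ofZLatticeBasis_span ℝ
  have hFb : IsBounded F := ZSpan.fundamentalDomain_isBounded _
  have hFm : MeasurableSet F := ZSpan.fundamentalDomain_measurableSet _
  have hcovol : ZLattice.covolume L μ = μ.real F :=
    ZLattice.covolume_eq_measure_fundamentalDomain L μ (ZLattice.isAddFundamentalDomain b μ)
  obtain ⟨R, hR0, hR⟩ := hFb.exists_pos_norm_le
  have hcpos : 0 < μ.real F := hcovol ▸ ZLattice.covolume_pos L μ
  have huniq : ∀ y : E, ∃! v : L, (v : E) + y ∈ F := by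
    intro y
    have := ZSpan.exist_unique_vadd_mem_fundamentalDomain (b.ofZLatticeBasis ℝ L) y
    obtain ⟨v, hv, hv'⟩ := this
    refine ⟨⟨v, hspan.le v.2⟩, hv, fun w hw => ?_⟩
    have := hv' ⟨w, hspan.ge w.2⟩ hw
    ext
    simpa using congrArg Subtype.val this
  set B := μ.real (closedBall (0 : E) (C + R)) with hB
  refine ⟨C * 2 ^ m * B / μ.real F, fun t ht => ?_⟩
  have ht0 : 0 < t := by linarith
  have htD : IsBounded (t • D) := hD.smul₀ t
  have htDm : MeasurableSet (t • D) := hDm.const_smul₀ t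
  have hfin : ((L : Set E) ∩ t • D).Finite := by
    rw [Set.inter_comm]
    refine Metric.finite_isBounded_inter_isClosed DiscreteTopology.isDiscrete htD ?_
    rw [← Submodule.coe_toAddSubgroup]
    exact AddSubgroup.isClosed_of_discrete
  set S := hfin.toFinset with hS
  have hSmem : ∀ x, x ∈ S ↔ x ∈ L ∧ x ∈ t • D := fun x => by simp [hS]
  have hcard : Nat.card ((L : Set E) ∩ t • D : Set E) = S.card := by
    rw [Nat.card_coe_set_eq, Set.ncard_eq_toFinset_card _ hfin]
  set U : Set E := ⋃ x ∈ S, (fun y => -x + y) ⁻¹' F with hU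
  have hUm : ∀ x : E, MeasurableSet ((fun y => -x + y) ⁻¹' F) := fun x =>
    (measurable_const_add (-x)) hFm
  have hμx : ∀ x : E, μ.real ((fun y => -x + y) ⁻¹' F) = μ.real F := fun x => by
    rw [measureReal_def, measure_preimage_add, measureReal_def]
  have hμF : μ F ≠ ⊤ := hFb.measure_lt_top.ne
  have hμU : μ.real U = S.card * μ.real F := by
    rw [hU, measureReal_biUnion_finset ?_ ?_
      (fun x _ => by rw [measure_preimage_add]; exact hμF)]
    · simp [hμx]
    · intro x hx y hy hxy
      rw [Function.onFun, Set.disjoint_left]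
      intro z hz1 hz2
      apply hxy
      obtain ⟨v, hv, hv'⟩ := huniq z
      have h1 := hv' (-⟨x, ((hSmem x).1 hx).1⟩) (by simpa using hz1)
      have h2 := hv' (-⟨y, ((hSmem y).1 hy).1⟩) (by simpa using hz2)
      simpa using congrArg Subtype.val (h1.trans h2.symm)
    · exact fun x _ => hUm x
  have hUmeas : MeasurableSet U := S.measurableSet_biUnion fun x _ => hUm x
  have hUtop : μ U ≠ ⊤ := by
    refine ((measure_biUnion_finset_le S _).trans_lt ?_).ne
    refine ENNReal.sum_lt_top.2 fun x _ => ?_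
    rw [measure_preimage_add]
    exact hμF.lt_top
  have hDtop : μ (t • D) ≠ ⊤ := htD.measure_lt_top.ne
  -- the covering of the difference
  set N := ⌈t⌉₊ with hN
  have hN1 : 1 ≤ N := Nat.one_le_iff_ne_zero.2 (Nat.ceil_pos.2 ht0).ne'
  have htN : t ≤ N := Nat.le_ceil t
  have hN2 : (N : ℝ) ≤ 2 * t := by
    have := Nat.ceil_lt_add_one ht0.le
    linarith
  obtain ⟨T, hT, hTc⟩ := hcov N hN1
  set V : Set E := ⋃ x ∈ T, closedBall (t • x) (C + R) with hV
  have hVr : μ.real V ≤ C * 2 ^ m * B * t ^ m := by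
    calc μ.real V ≤ ∑ x ∈ T, μ.real (closedBall (t • x) (C + R)) :=
          measureReal_biUnion_finset_le _ _
      _ = T.card * B := by
          have : ∀ x : E, μ.real (closedBall (t • x) (C + R)) = B := fun x => by
            rw [hB, measureReal_def, measureReal_def, Measure.addHaar_closedBall_center]
          simp [this]
      _ ≤ (C * N ^ m) * B := by gcongr
      _ ≤ (C * (2 * t) ^ m) * B := by gcongr
      _ = _ := by ring
  have hVtop : μ V ≠ ⊤ := by
    refine ((measure_biUnion_finset_le T _).trans_lt ?_).ne
    exact ENNReal.sum_lt_top.2 fun x _ => measure_closedBall_lt_top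
  have hnear : ∀ x y : E, -x + y ∈ F → (x ∈ t • D ∧ y ∉ t • D ∨ x ∉ t • D ∧ y ∈ t • D) → y ∈ V := by
    intro x y hxy h
    obtain ⟨z, hz, hzs⟩ : ∃ z ∈ frontier (t • D), z ∈ segment ℝ x y := by
      rcases h with ⟨h1, h2⟩ | ⟨h1, h2⟩
      · exact exists_mem_frontier_of_mem_of_notMem h1 h2
      · rw [segment_symm]
        exact exists_mem_frontier_of_mem_of_notMem h2 h1
    have hfr : frontier (t • D) = t • frontier D := by
      have := (Homeomorph.smulOfNeZero t ht0.ne' : E ≃ₜ E).image_frontier D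
      simpa [Set.image_smul] using this.symm
    rw [hfr] at hz
    obtain ⟨z', hz', rfl⟩ := hz
    have := hTc hz'
    simp only [Set.mem_iUnion, exists_prop] at this
    obtain ⟨w, hw, hzw⟩ := this
    simp only [hV, Set.mem_iUnion, exists_prop]
    refine ⟨w, hw, ?_⟩
    have h1 : dist y (t • z') ≤ R := by
      have h2 : dist y (t • z') ≤ dist y x := by
        obtain ⟨p, q, hp, hq, hpq, h⟩ := hzs
        simp only at h
        rw [← h, dist_eq_norm, dist_eq_norm]
        have : y - (p • x + q • y) = p • (y - x) := by
          have : q = 1 - p := by linarith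
          subst this
          module
        rw [this, norm_smul, Real.norm_of_nonneg hp]
        exact mul_le_of_le_one_left (norm_nonneg _) (by linarith)
      refine h2.trans ?_
      rw [dist_eq_norm, sub_eq_neg_add]
      exact hR _ hxy
    have h2 : dist (t • z') (t • w) ≤ C := by
      rw [dist_smul₀, Real.norm_of_nonneg ht0.le]
      rw [mem_closedBall] at hzw
      calc t * dist z' w ≤ t * (C / N) := by gcongr
        _ = C * (t / N) := by ring
        _ ≤ C * 1 := by
            gcongr
            exact div_le_one_of_le₀ htN (by positivity)
        _ = C := mul_one C
    rw [mem_closedBall]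
    linarith [dist_triangle y (t • z') (t • w)]
  have h1 : U ⊆ t • D ∪ V := by
    intro y hy
    simp only [hU, Set.mem_iUnion, exists_prop] at hy
    obtain ⟨x, hx, hxy⟩ := hy
    by_cases hyD : y ∈ t • D
    · exact Or.inl hyD
    · exact Or.inr (hnear x y hxy (Or.inl ⟨((hSmem x).1 hx).2, hyD⟩))
  have h2 : t • D ⊆ U ∪ V := by
    intro y hy
    obtain ⟨v, hv, -⟩ := huniq y
    by_cases hvD : (-v : E) ∈ t • D
    · left
      simp only [hU, Set.mem_iUnion, exists_prop]
      exact ⟨-v, (hSmem _).2 ⟨neg_mem v.2, hvD⟩, by simpa using hv⟩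
    · exact Or.inr (hnear (-v) y (by simpa using hv) (Or.inr ⟨hvD, hy⟩))
  have h3 : μ.real U ≤ μ.real (t • D) + μ.real V :=
    (measureReal_mono h1 (measure_union_ne_top hDtop hVtop)).trans (measureReal_union_le _ _)
  have h4 : μ.real (t • D) ≤ μ.real U + μ.real V :=
    (measureReal_mono h2 (measure_union_ne_top hUtop hVtop)).trans (measureReal_union_le _ _)
  have h5 : μ.real (t • D) = t ^ Module.finrank ℝ E * μ.real D := by
    rw [measureReal_def, Measure.addHaar_smul, ENNReal.toReal_mul, measureReal_def,
      ENNReal.toReal_ofReal (abs_nonneg _), abs_of_nonneg (by positivity)]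
  rw [hcard, hcovol]
  have h6 : |(S.card : ℝ) * μ.real F - t ^ Module.finrank ℝ E * μ.real D| ≤
      C * 2 ^ m * B * t ^ m := by
    rw [abs_le]
    constructor <;> linarith
  calc |(S.card : ℝ) - μ.real D / μ.real F * t ^ Module.finrank ℝ E|
      = |(S.card : ℝ) * μ.real F - t ^ Module.finrank ℝ E * μ.real D| / μ.real F := by
        rw [← abs_of_pos hcpos, ← abs_div, abs_of_pos hcpos]
        congr 1
        field_simp
    _ ≤ C * 2 ^ m * B * t ^ m / μ.real F := by gcongr
    _ = _ := by ring

end LatticePoints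
end PrimeIdealCount

namespace PrimeIdealCount

section BoxCovering

open Metric

/-- A set is box covered in dimension `m` if, for every `N ≥ 1`, it can be covered by `O(N ^ m)`
balls of radius `O(1 / N)`. -/
def BoxCovered {E : Type*} [PseudoMetricSpace E] (m : ℕ) (S : Set E) : Prop :=
  ∃ C : ℝ, 0 ≤ C ∧ ∀ N : ℕ, 1 ≤ N → ∃ T : Finset E, (T.card : ℝ) ≤ C * N ^ m ∧
    S ⊆ ⋃ x ∈ T, closedBall x (C / N)

theorem BoxCovered.mono {E : Type*} [PseudoMetricSpace E] {m : ℕ} {S S' : Set E}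
    (h : BoxCovered m S) (hS : S' ⊆ S) : BoxCovered m S' := by
  obtain ⟨C, hC, h⟩ := h
  refine ⟨C, hC, fun N hN => ?_⟩
  obtain ⟨T, hT, hT'⟩ := h N hN
  exact ⟨T, hT, hS.trans hT'⟩

theorem BoxCovered.iUnion {E : Type*} [PseudoMetricSpace E] {m : ℕ} {κ : Type*} [Finite κ]
    {S : κ → Set E} (h : ∀ k, BoxCovered m (S k)) : BoxCovered m (⋃ k, S k) := by
  classical
  cases nonempty_fintype κ
  choose C hC h using h
  refine ⟨∑ k, C k, Finset.sum_nonneg fun k _ => hC k, fun N hN => ?_⟩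
  choose T hT hT' using fun k => h k N hN
  refine ⟨Finset.univ.biUnion T, ?_, ?_⟩
  · calc ((Finset.univ.biUnion T).card : ℝ) ≤ ∑ k, ((T k).card : ℝ) := by
          exact_mod_cast Finset.card_biUnion_le
      _ ≤ ∑ k, C k * N ^ m := Finset.sum_le_sum fun k _ => hT k
      _ = _ := by rw [Finset.sum_mul]
  · refine Set.iUnion_subset fun k => (hT' k).trans ?_
    refine Set.iUnion₂_subset fun x hx => ?_
    refine (closedBall_subset_closedBall ?_).trans
      (Set.subset_biUnion_of_mem (u := fun x => closedBall x ((∑ k, C k) / N))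
        (Finset.mem_biUnion.2 ⟨k, Finset.mem_univ k, hx⟩))
    gcongr
    exact Finset.single_le_sum (fun k _ => hC k) (Finset.mem_univ k)

/-- The Lipschitz image of a face of the unit cube is box covered. -/
theorem boxCovered_image_face {E : Type*} [PseudoMetricSpace E] {ι : Type*} [Fintype ι]
    {f : (ι → ℝ) → E} {k : NNReal} (hf : LipschitzOnWith k f (Set.Icc 0 1)) (i₀ : ι) {v : ℝ}
    (hv : v ∈ Set.Icc (0 : ℝ) 1) :
    BoxCovered (Fintype.card ι - 1) (f '' {x | x ∈ Set.Icc 0 1 ∧ x i₀ = v}) := by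
  classical
  refine ⟨max k 1, by positivity, fun N hN => ?_⟩
  have hN0 : (0 : ℝ) < N := by exact_mod_cast hN
  let pt : ({i // i ≠ i₀} → Fin N) → ι → ℝ := fun g i =>
    if h : i = i₀ then v else (g ⟨i, h⟩ : ℝ) / N
  have hpt : ∀ g, pt g ∈ Set.Icc (0 : ι → ℝ) 1 := by
    intro g
    refine ⟨fun i => ?_, fun i => ?_⟩
    · simp only [pt, Pi.zero_apply]
      split_ifs
      · exact hv.1
      · positivity
    · simp only [pt, Pi.one_apply]
      split_ifs with h
      · exact hv.2
      · rw [div_le_one hN0]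
        exact_mod_cast (g ⟨i, h⟩).2.le
  refine ⟨Finset.univ.image (f ∘ pt), ?_, ?_⟩
  · calc ((Finset.univ.image (f ∘ pt)).card : ℝ)
        ≤ (Finset.univ : Finset ({i // i ≠ i₀} → Fin N)).card := by
          exact_mod_cast Finset.card_image_le
      _ = (N : ℝ) ^ (Fintype.card ι - 1) := by
          simp [Fintype.card_subtype_compl]
      _ ≤ max (k : ℝ) 1 * N ^ (Fintype.card ι - 1) :=
          le_mul_of_one_le_left (by positivity) (le_max_right _ _)
  · rintro _ ⟨x, ⟨hx, hxv⟩, rfl⟩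
    let g : {i // i ≠ i₀} → Fin N := fun i => ⟨min ⌊N * x i⌋₊ (N - 1), by omega⟩
    simp only [Set.mem_iUnion, exists_prop, Finset.mem_image, Finset.mem_univ, true_and,
      exists_exists_eq_and]
    refine ⟨g, ?_⟩
    rw [mem_closedBall]
    refine (hf.dist_le_mul _ hx _ (hpt g)).trans ?_
    have : dist x (pt g) ≤ 1 / N := by
      refine (dist_pi_le_iff (by positivity)).2 fun i => ?_
      simp only [pt]
      split_ifs with h
      · rw [h, hxv, dist_self]
        positivity
      · have h0 : 0 ≤ x i := hx.1 i
        have h1 : x i ≤ 1 := hx.2 i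
        have h2 : |N * x i - (min ⌊N * x i⌋₊ (N - 1) : ℕ)| ≤ 1 := by
          have h3 : (⌊N * x i⌋₊ : ℝ) ≤ N * x i := Nat.floor_le (by positivity)
          have h4 : N * x i < ⌊N * x i⌋₊ + 1 := Nat.lt_floor_add_one _
          have h5 : N * x i ≤ N := mul_le_of_le_one_right hN0.le h1
          rcases le_total ⌊N * x i⌋₊ (N - 1) with h6 | h6
          · rw [min_eq_left h6, abs_le]
            constructor <;> linarith
          · rw [min_eq_right h6, abs_le, Nat.cast_sub hN, Nat.cast_one]
            have h7 : ((N - 1 : ℕ) : ℝ) ≤ ⌊N * x i⌋₊ := by exact_mod_cast h6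
            rw [Nat.cast_sub hN, Nat.cast_one] at h7
            constructor <;> linarith
        rw [Real.dist_eq]
        have h3 : x i - ((g ⟨i, h⟩ : ℕ) : ℝ) / N
            = (N * x i - (min ⌊N * x i⌋₊ (N - 1) : ℕ)) / N := by
          simp only [g]
          field_simp
        rw [h3, abs_div, abs_of_pos hN0]
        gcongr
    calc (k : ℝ) * dist x (pt g) ≤ max (k : ℝ) 1 * (1 / N) := by
          gcongr
          exact le_max_left _ _
      _ = _ := by ring

end BoxCovering

section NormLeOneFrontier

open NumberField.mixedEmbedding NumberField.InfinitePlace NumberField.Units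
  NumberField.mixedEmbedding.fundamentalCone NumberField.Units.dirichletUnitTheorem

variable (K : Type*) [Field K] [NumberField K]

open scoped Classical in
/-- Polar-type parametrization of the closure of `normLeOne K`, for a given choice of signs at the
real places. -/
noncomputable def polarParam (ε : {w : InfinitePlace K // IsReal w} → SignType)
    (x : InfinitePlace K ⊕ {w : InfinitePlace K // IsComplex w} → ℝ) : mixedSpace K :=
  (fun w => ε w * (x (.inl w₀) * expMapBasis (fun i => if i = w₀ then 0 else x (.inl i)) w.1),
   fun w => (x (.inl w₀) * expMapBasis (fun i => if i = w₀ then 0 else x (.inl i)) w.1 : ℝ) *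
      Complex.exp (2 * Real.pi * x (.inr w) * Complex.I))

open scoped Classical in
theorem contDiff_polarParam (ε : {w : InfinitePlace K // IsReal w} → SignType) :
    ContDiff ℝ 1 (polarParam K ε) := by
  have h0 : ContDiff ℝ 1 fun x : InfinitePlace K ⊕ {w : InfinitePlace K // IsComplex w} → ℝ =>
      (fun i : InfinitePlace K => if i = w₀ then (0 : ℝ) else x (.inl i)) := by
    refine contDiff_pi.2 fun i => ?_
    split_ifs <;> fun_prop
  have h1 : ∀ w, ContDiff ℝ 1 fun x : InfinitePlace K ⊕ {w : InfinitePlace K // IsComplex w} → ℝ =>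
      expMapBasis (fun i => if i = w₀ then 0 else x (.inl i)) w := by
    intro w
    simp_rw [expMapBasis_apply, expMap_apply]
    refine Real.contDiff_exp.comp (contDiff_const.mul ?_)
    have := ((completeBasis K).equivFunL.symm : realSpace K →L[ℝ] realSpace K).contDiff.comp h0
      (n := 1)
    exact contDiff_pi.1 this w
  refine ContDiff.prodMk ?_ ?_
  · refine contDiff_pi.2 fun w => ?_
    have h2 : ContDiff ℝ 1 fun x : InfinitePlace K ⊕ {w : InfinitePlace K // IsComplex w} → ℝ =>
      x (.inl w₀) := by fun_prop
    exact contDiff_const.mul (h2.mul (h1 w.1))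
  · refine contDiff_pi.2 fun w => ?_
    have h2 : ContDiff ℝ 1 fun x : InfinitePlace K ⊕ {w : InfinitePlace K // IsComplex w} → ℝ =>
      x (.inl w₀) := by fun_prop
    refine ContDiff.mul (Complex.ofRealCLM.contDiff.comp (h2.mul (h1 w.1))) ?_
    refine Complex.contDiff_exp.comp ?_
    refine ContDiff.mul (contDiff_const.mul (Complex.ofRealCLM.contDiff.comp (by fun_prop)))
      contDiff_const

open scoped Classical in
theorem boxCovered_frontier_normLeOne :
    BoxCovered (Module.finrank ℚ K - 1) (frontier (normLeOne K)) := by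
  have hcard : Fintype.card (InfinitePlace K ⊕ {w : InfinitePlace K // IsComplex w}) =
      Module.finrank ℚ K := by
    rw [Fintype.card_sum, ← card_add_two_mul_card_eq_rank, card_eq_nrRealPlaces_add_nrComplexPlaces,
      nrComplexPlaces]
    ring
  have key : ∀ (p : ({w : InfinitePlace K // IsReal w} → SignType) × InfinitePlace K × Bool),
      BoxCovered (Module.finrank ℚ K - 1) (polarParam K p.1 ''
        {x | x ∈ Set.Icc 0 1 ∧ x (.inl p.2.1) = if p.2.2 then 1 else 0}) := by
    intro p
    obtain ⟨k, hk⟩ := (contDiff_polarParam K p.1).locallyLipschitz.locallyLipschitzOn (s := Set.Icc 0 1)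
      |>.exists_lipschitzOnWith_of_compact isCompact_Icc
    rw [← hcard]
    exact boxCovered_image_face hk _ (by split_ifs <;> simp)
  refine (BoxCovered.iUnion key).mono fun z hz => ?_
  have hz1 := closure_normLeOne_subset K hz.1
  obtain ⟨c, hc, ⟨_, ⟨y, hy, rfl⟩, hcy⟩⟩ := hz1
  simp only at hcy
  have hy0 : y w₀ = 0 := by simpa using hy w₀ (Set.mem_univ _)
  have hyi : ∀ w, w ≠ w₀ → y w ∈ Set.Icc (0 : ℝ) 1 := fun w hw => by
    simpa [hw] using hy w (Set.mem_univ _)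
  have hyeq : (fun i => if i = w₀ then 0 else y i) = y := by
    ext i
    split_ifs with h
    · rw [h, hy0]
    · rfl
  -- the parameter
  let x : InfinitePlace K ⊕ {w : InfinitePlace K // IsComplex w} → ℝ :=
    Sum.elim (fun i => if i = w₀ then c else y i)
      (fun w => toIcoMod one_pos 0 (Complex.arg (z.2 w) / (2 * Real.pi)))
  have hx : x ∈ Set.Icc (0 : InfinitePlace K ⊕ {w : InfinitePlace K // IsComplex w} → ℝ) 1 := by
    have : ∀ i, x i ∈ Set.Icc (0 : ℝ) 1 := by
      rintro (i | w)
      · simp only [x, Sum.elim_inl]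
        split_ifs with h
        · exact hc
        · exact hyi i h
      · have := toIcoMod_mem_Ico' (one_pos (α := ℝ)) (Complex.arg (z.2 w) / (2 * Real.pi))
        exact ⟨this.1, this.2.le⟩
    exact ⟨fun i => (this i).1, fun i => (this i).2⟩
  have hparam : polarParam K (fun w => SignType.sign (z.1 w)) x = z := by
    have hρ : ∀ w, x (.inl w₀) * expMapBasis (fun i => if i = w₀ then 0 else x (.inl i)) w =
        normAtPlace w z := by
      intro w
      have h1 : (fun i => if i = w₀ then 0 else x (.inl i)) = y := by
        rw [← hyeq]
        ext i
        by_cases h : i = w₀ <;> simp [x, h]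
      rw [h1]
      have := congrFun hcy w
      simpa [x] using this
    ext w
    · simp only [polarParam, hρ, normAtPlace_apply_of_isReal w.2]
      exact sign_mul_abs _
    · simp only [polarParam, hρ, normAtPlace_apply_of_isComplex w.2]
      have h1 : Complex.exp (2 * Real.pi * x (.inr w) * Complex.I) =
          Complex.exp (Complex.arg (z.2 w) * Complex.I) := by
        rw [Complex.exp_eq_exp_iff_exists_int]
        refine ⟨-toIcoDiv one_pos 0 (Complex.arg (z.2 w) / (2 * Real.pi)), ?_⟩
        simp only [x, Sum.elim_inr, toIcoMod]
        push_cast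
        have : (Real.pi : ℂ) ≠ 0 := by exact_mod_cast Real.pi_ne_zero
        field_simp
        simp
        ring
      rw [h1]
      exact Complex.norm_mul_exp_arg_mul_I _
  have hface : ∃ i, x (.inl i) = 1 ∨ x (.inl i) = 0 := by
    by_contra! hcon
    apply hz.2
    apply subset_interior_normLeOne
    have hpos : 0 < c := lt_of_le_of_ne hc.1 (by simpa [x] using (hcon w₀).2.symm)
    have hlt : c < 1 := lt_of_le_of_ne hc.2 (by simpa [x] using (hcon w₀).1)
    refine ⟨fun i => if i = w₀ then Real.log c else y i, ?_, ?_⟩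
    · rw [interior_paramSet]
      intro i _
      by_cases h : i = w₀
      · simp only [h, if_true]
        exact Real.log_neg hpos hlt
      · simp only [h, if_false]
        have h1 := hcon i
        simp only [x, Sum.elim_inl, h, if_false] at h1
        exact ⟨lt_of_le_of_ne (hyi i h).1 (Ne.symm h1.2), lt_of_le_of_ne (hyi i h).2 h1.1⟩
    · rw [expMapBasis_apply'', ← hcy]
      simp only [if_true, Real.exp_log hpos]
      congr 2
      rw [← hyeq]
      ext i
      by_cases h : i = w₀ <;> simp [h]
  obtain ⟨i, hi⟩ := hface
  simp only [Set.mem_iUnion]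
  rcases hi with hi | hi
  · exact ⟨(fun w => SignType.sign (z.1 w), i, true), x, ⟨hx, by simpa using hi⟩, hparam⟩
  · exact ⟨(fun w => SignType.sign (z.1 w), i, false), x, ⟨hx, by simpa using hi⟩, hparam⟩

end NormLeOneFrontier
end PrimeIdealCount

namespace PrimeIdealCount

section IdealCount

open NumberField.InfinitePlace NumberField.mixedEmbedding
  NumberField.mixedEmbedding.fundamentalCone NumberField.Units
open scoped nonZeroDivisors Pointwise

variable (K : Type*) [Field K] [NumberField K]

theorem card_absNorm_le_and_mk_eq {C : ClassGroup (𝓞 K)} {J : (Ideal (𝓞 K))⁰} {s : ℝ}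
    (hJ : ClassGroup.mk0 J = C⁻¹) :
    Nat.card {I : (Ideal (𝓞 K))⁰ // Ideal.absNorm (I : Ideal (𝓞 K)) ≤ s ∧ ClassGroup.mk0 I = C}
      = Nat.card {I : (Ideal (𝓞 K))⁰ // (J : Ideal (𝓞 K)) ∣ I ∧
        Submodule.IsPrincipal (I : Ideal (𝓞 K)) ∧
        Ideal.absNorm (I : Ideal (𝓞 K)) ≤ s * Ideal.absNorm (J : Ideal (𝓞 K))} := by
  simp_rw [← nonZeroDivisors_dvd_iff_dvd_coe]
  refine Nat.card_congr ?_
  refine ((Equiv.dvd J).subtypeEquiv fun I ↦ ?_).trans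
    (Equiv.subtypeSubtypeEquivSubtypeInter (fun I : (Ideal (𝓞 K))⁰ ↦ J ∣ I) _)
  rw [← ClassGroup.mk0_eq_one_iff (SetLike.coe_mem _)]
  simp_rw [Equiv.dvd_apply, Submonoid.coe_mul, ← Submonoid.mul_def, _root_.map_mul, hJ,
    inv_mul_eq_one, Nat.cast_mul, mul_comm s, eq_comm, and_comm, and_congr_left_iff]
  exact fun _ ↦ (mul_le_mul_iff_of_pos_left
    (Nat.cast_pos.mpr (Ideal.absNorm_pos_of_nonZeroDivisors J))).symm

open scoped Classical in
theorem card_idealSet_norm_le (J : (Ideal (𝓞 K))⁰) {t : ℝ} (ht : 0 < t) :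
    Nat.card {a : idealSet K J // mixedEmbedding.norm (a : mixedSpace K) ≤
        t ^ Module.finrank ℚ K} =
      Nat.card ((idealLattice K (FractionalIdeal.mk0 K J) : Set (mixedSpace K)) ∩
        t • normLeOne K : Set (mixedSpace K)) := by
  refine Nat.card_congr ?_
  refine (Equiv.subtypeSubtypeEquivSubtypeInter _
    (fun x : mixedSpace K => mixedEmbedding.norm x ≤ t ^ Module.finrank ℚ K)).trans
    (Equiv.subtypeEquivProp ?_)
  ext x
  have h1 : x ∈ t • normLeOne K ↔
      x ∈ fundamentalCone K ∧ mixedEmbedding.norm x ≤ t ^ Module.finrank ℚ K := by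
    rw [Set.mem_smul_set_iff_inv_smul_mem₀ ht.ne', mem_normLeOne,
      smul_mem_iff_mem (inv_ne_zero ht.ne'), mixedEmbedding.norm_smul, abs_of_pos (inv_pos.2 ht),
      inv_pow, inv_mul_le_one₀ (pow_pos ht _)]
  have h2 : x ∈ (idealLattice K (FractionalIdeal.mk0 K J) : Set (mixedSpace K)) ↔
      ∃ y ∈ (J : Set (𝓞 K)), mixedEmbedding K y = x := by
    rw [SetLike.mem_coe, mem_idealLattice]
    simp [FractionalIdeal.coe_mk0, FractionalIdeal.mem_coeIdeal]
  rw [Set.mem_inter_iff, h1, h2]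
  simp only [mem_idealSet]
  tauto

theorem exists_abs_card_class_sub_le (C : ClassGroup (𝓞 K)) :
    ∃ ρ C' : ℝ, ∀ t : ℝ, 1 ≤ t →
      |(Nat.card {I : (Ideal (𝓞 K))⁰ // (Ideal.absNorm (I : Ideal (𝓞 K)) : ℝ) ≤
        t ^ Module.finrank ℚ K ∧ ClassGroup.mk0 I = C} : ℝ) - ρ * t ^ Module.finrank ℚ K| ≤
        C' * t ^ (Module.finrank ℚ K - 1) := by
  classical
  obtain ⟨J, hJ⟩ := ClassGroup.mk0_surjective C⁻¹
  obtain ⟨C₀, hC₀, hcov⟩ := boxCovered_frontier_normLeOne K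
  obtain ⟨C', h⟩ := abs_card_lattice_inter_smul_sub_le (μ := MeasureTheory.volume)
    (L := idealLattice K (FractionalIdeal.mk0 K J)) (isBounded_normLeOne K)
    (measurableSet_normLeOne K) hC₀ _ hcov
  set d := Module.finrank ℚ K with hd
  have hd0 : d ≠ 0 := Module.finrank_pos.ne'
  set q : ℝ := (Ideal.absNorm (J : Ideal (𝓞 K)) : ℝ) with hq
  have hq1 : 1 ≤ q := by
    rw [hq]
    exact_mod_cast Ideal.absNorm_pos_of_nonZeroDivisors J
  set r : ℝ := q ^ (1 / d : ℝ) with hr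
  have hr1 : 1 ≤ r := Real.one_le_rpow hq1 (by positivity)
  have hrd : r ^ d = q := by
    rw [hr, one_div, Real.rpow_inv_natCast_pow (by positivity) hd0]
  set w : ℝ := (torsionOrder K : ℝ) with hw
  have hw0 : 0 < w := by
    rw [hw]
    exact_mod_cast torsionOrder_pos K
  set κ := MeasureTheory.volume.real (normLeOne K) /
    ZLattice.covolume (idealLattice K (FractionalIdeal.mk0 K J)) MeasureTheory.volume with hκ
  refine ⟨κ * q / w, C' * r ^ (d - 1) / w, fun t ht => ?_⟩
  have h1 := h (t * r) (one_le_mul_of_one_le_of_one_le ht hr1)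
  rw [mixedEmbedding.finrank, ← hd, mul_pow, hrd] at h1
  have h2 := card_idealSet_norm_le K J (t := t * r) (by positivity)
  have h3 := card_isPrincipal_dvd_norm_le K J (s := (t * r) ^ d)
  rw [card_absNorm_le_and_mk_eq K hJ, ← hq]
  rw [mul_pow, hrd] at h3
  rw [mul_pow, ← hd, hrd] at h2
  rw [← h2, ← h3] at h1
  push_cast at h1
  rw [← hw] at h1
  set A : ℝ := (Nat.card {I : (Ideal (𝓞 K))⁰ // (J : Ideal (𝓞 K)) ∣ I ∧
        Submodule.IsPrincipal (I : Ideal (𝓞 K)) ∧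
        (Ideal.absNorm (I : Ideal (𝓞 K)) : ℝ) ≤ t ^ d * q} : ℝ)
  have h4 : A - κ * q / w * t ^ d = (A * w - κ * (t ^ d * q)) / w := by
    field_simp
  rw [h4, abs_div, abs_of_pos hw0, div_le_iff₀ hw0]
  refine h1.trans (le_of_eq ?_)
  rw [mul_pow]
  field_simp

theorem exists_abs_card_ideal_sub_le :
    ∃ ρ C' : ℝ, 0 < ρ ∧ ∀ x : ℝ, 1 ≤ x →
      |(Nat.card {I : (Ideal (𝓞 K))⁰ // (Ideal.absNorm (I : Ideal (𝓞 K)) : ℝ) ≤ x} : ℝ) - ρ * x| ≤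
        C' * x ^ (1 - 1 / (Module.finrank ℚ K : ℝ)) := by
  classical
  choose ρ C' h using exists_abs_card_class_sub_le K
  set d := Module.finrank ℚ K with hd
  have hd0 : d ≠ 0 := Module.finrank_pos.ne'
  have key : ∀ x : ℝ, 1 ≤ x →
      |(Nat.card {I : (Ideal (𝓞 K))⁰ // (Ideal.absNorm (I : Ideal (𝓞 K)) : ℝ) ≤ x} : ℝ) -
        (∑ c, ρ c) * x| ≤ (∑ c, C' c) * x ^ (1 - 1 / (d : ℝ)) := by
    intro x hx
    have hx0 : 0 ≤ x := by linarith
    set t : ℝ := x ^ (1 / d : ℝ) with ht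
    have ht1 : 1 ≤ t := Real.one_le_rpow hx (by positivity)
    have htd : t ^ d = x := by
      rw [ht, one_div, Real.rpow_inv_natCast_pow (by positivity) hd0]
    have htd1 : t ^ (d - 1) = x ^ (1 - 1 / (d : ℝ)) := by
      rw [ht, ← Real.rpow_natCast, ← Real.rpow_mul hx0, Nat.cast_sub (by omega)]
      congr 1
      have : (d : ℝ) ≠ 0 := by exact_mod_cast hd0
      field_simp
      push_cast
      ring
    have hsum : (Nat.card {I : (Ideal (𝓞 K))⁰ // (Ideal.absNorm (I : Ideal (𝓞 K)) : ℝ) ≤ x} : ℝ) =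
        ∑ c, (Nat.card {I : (Ideal (𝓞 K))⁰ // (Ideal.absNorm (I : Ideal (𝓞 K)) : ℝ) ≤ x ∧
          ClassGroup.mk0 I = c} : ℝ) := by
      have : Fintype {I : (Ideal (𝓞 K))⁰ // (Ideal.absNorm (I : Ideal (𝓞 K)) : ℝ) ≤ x} := by
        simp_rw [← Nat.le_floor_iff hx0]
        refine @Fintype.ofFinite _ (Ideal.finite_setOfPred_absNorm_le₀ ⌊x⌋₊)
      let e := fun C : ClassGroup (𝓞 K) ↦ Equiv.subtypeSubtypeEquivSubtypeInter
        (fun I : (Ideal (𝓞 K))⁰ ↦ (Ideal.absNorm I.1 : ℝ) ≤ x) (fun I ↦ ClassGroup.mk0 I = C)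
      simp_rw [← Nat.card_congr (e _), Nat.card_eq_fintype_card, Fintype.subtype_card]
      rw [Fintype.card, Finset.card_eq_sum_card_fiberwise (f := fun I ↦ ClassGroup.mk0 I.1)
        (t := Finset.univ) (fun _ _ ↦ Finset.mem_univ _), Nat.cast_sum]
    rw [hsum, Finset.sum_mul, ← Finset.sum_sub_distrib, Finset.sum_mul]
    refine (Finset.abs_sum_le_sum_abs _ _).trans (Finset.sum_le_sum fun c _ => ?_)
    have := h c t ht1
    rwa [htd, htd1] at this
  refine ⟨∑ c, ρ c, ∑ c, C' c, ?_, key⟩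
  have hlim : Tendsto (fun x : ℝ =>
      (Nat.card {I : (Ideal (𝓞 K))⁰ // (Ideal.absNorm (I : Ideal (𝓞 K)) : ℝ) ≤ x} : ℝ) / x) atTop
      (nhds (∑ c, ρ c)) := by
    rw [tendsto_iff_norm_sub_tendsto_zero]
    have h0 : Tendsto (fun x : ℝ => (∑ c, C' c) * x ^ (-(1 / (d : ℝ)))) atTop (nhds 0) := by
      rw [← mul_zero (∑ c, C' c)]
      exact (tendsto_rpow_neg_atTop (by positivity)).const_mul _
    refine squeeze_zero' (Eventually.of_forall fun _ => norm_nonneg _) ?_ h0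
    filter_upwards [eventually_ge_atTop 1] with x hx
    have hx0 : 0 < x := by linarith
    rw [Real.norm_eq_abs, div_sub' hx0.ne', abs_div, abs_of_pos hx0, div_le_iff₀ hx0, mul_assoc,
      mul_comm x]
    refine (key x hx).trans (le_of_eq ?_)
    rw [sub_eq_neg_add, Real.rpow_add hx0, Real.rpow_one]
  have := tendsto_nhds_unique hlim (NumberField.Ideal.tendsto_norm_le_div_atTop₀ K)
  rw [this]
  have h1 := Units.regulator_pos K
  have h2 : 0 < (classNumber K : ℝ) := by exact_mod_cast Fintype.card_pos
  have h3 : 0 < (torsionOrder K : ℝ) := by exact_mod_cast torsionOrder_pos K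
  have h4 : 0 < |(discr K : ℝ)| := by
    rw [abs_pos]
    exact_mod_cast discr_ne_zero K
  have := Real.pi_pos
  positivity

end IdealCount
end PrimeIdealCount

namespace PrimeIdealCount

section Continuation

open MeasureTheory Set Complex

/-- Analytic data of a system of generalized primes: `a` counts the generalized integers, `c` the
generalized primes; the counting function of `a` is linear with a power saving error term and the
Dirichlet series of `a` has an Euler product. -/
structure PrimeSystem where
  /-- the number of generalized integers of given norm -/
  a : ℕ → ℝ
  /-- the number of generalized primes of given norm -/
  c : ℕ → ℝ
  /-- the density of generalized integers -/
  ρ : ℝ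
  /-- the exponent saved in the error term -/
  δ : ℝ
  /-- the constant of the error term -/
  C : ℝ
  ρ_pos : 0 < ρ
  δ_pos : 0 < δ
  δ_le : δ ≤ 1 / 2
  a_zero : a 0 = 0
  c_zero : c 0 = 0
  c_one : c 1 = 0
  c_nonneg : ∀ n, 0 ≤ c n
  c_le : ∀ n, c n ≤ a n
  abs_sum_sub_le : ∀ x : ℝ, 1 ≤ x →
    |∑ n ∈ Finset.Icc 0 ⌊x⌋₊, a n - ρ * x| ≤ C * x ^ (1 - δ)
  euler : ∀ s : ℂ, 1 < s.re →
    LSeries (fun n => (a n : ℂ)) s = exp (∑' n : ℕ, (c n : ℂ) * -log (1 - (n : ℂ) ^ (-s)))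

namespace PrimeSystem

variable (D : PrimeSystem)

theorem a_nonneg (n : ℕ) : 0 ≤ D.a n := (D.c_nonneg n).trans (D.c_le n)

/-- The counting function of generalized integers. -/
noncomputable def A (x : ℝ) : ℝ := ∑ n ∈ Finset.Icc 0 ⌊x⌋₊, D.a n

/-- The error term of the counting function of generalized integers. -/
noncomputable def E (x : ℝ) : ℝ := D.A x - D.ρ * x

theorem A_eq (x : ℝ) : D.A x = ∑ n ∈ Finset.Icc 1 ⌊x⌋₊, D.a n := by
  rw [A, ← Finset.insert_Icc_add_one_left_eq_Icc (Nat.zero_le _), Finset.sum_insert (by simp),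
    D.a_zero, zero_add, zero_add]

theorem measurable_A : Measurable D.A :=
  (measurable_from_top (f := fun m : ℕ => ∑ n ∈ Finset.Icc 0 m, D.a n)).comp Nat.measurable_floor

theorem measurable_E : Measurable D.E :=
  D.measurable_A.sub (measurable_const.mul measurable_id)

theorem abs_E_le {x : ℝ} (hx : 1 ≤ x) : |D.E x| ≤ D.C * x ^ (1 - D.δ) := D.abs_sum_sub_le x hx

theorem C_nonneg : 0 ≤ D.C := by
  simpa using (abs_nonneg _).trans (D.abs_E_le le_rfl)

theorem A_nonneg (x : ℝ) : 0 ≤ D.A x := Finset.sum_nonneg fun n _ => D.a_nonneg n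

theorem A_le {x : ℝ} (hx : 1 ≤ x) : D.A x ≤ (D.ρ + D.C) * x := by
  have h1 := (abs_le.1 (D.abs_E_le hx)).2
  have h2 : x ^ (1 - D.δ) ≤ x := by
    conv_rhs => rw [← Real.rpow_one x]
    exact Real.rpow_le_rpow_of_exponent_le hx (by linarith [D.δ_pos])
  have h3 := mul_le_mul_of_nonneg_left h2 D.C_nonneg
  rw [E] at h1
  linarith

/-- The Mellin-type integrand of the error term. -/
noncomputable def kernel (s : ℂ) (u : ℝ) : ℂ := (D.E u : ℂ) * (u : ℂ) ^ (-(s + 1))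

theorem norm_kernel_le (s : ℂ) {u : ℝ} (hu : 1 ≤ u) :
    ‖D.kernel s u‖ ≤ D.C * u ^ (-(D.δ + s.re)) := by
  have hu0 : 0 < u := by linarith
  rw [kernel, norm_mul, norm_real, Real.norm_eq_abs, norm_cpow_eq_rpow_re_of_pos hu0]
  calc |D.E u| * u ^ (-(s + 1)).re ≤ D.C * u ^ (1 - D.δ) * u ^ (-(s + 1)).re := by
        gcongr
        exact D.abs_E_le hu
    _ = _ := by
        rw [mul_assoc, ← Real.rpow_add hu0]
        congr 2
        simp
        ring

theorem measurable_kernel (s : ℂ) : Measurable (D.kernel s) :=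
  (measurable_ofReal.comp D.measurable_E).mul (measurable_ofReal.pow_const _)

theorem integrableOn_kernel {s : ℂ} (hs : 1 - D.δ < s.re) {T : ℝ} (hT : 1 ≤ T) :
    IntegrableOn (D.kernel s) (Ioi T) := by
  have h1 : IntegrableOn (fun u : ℝ => D.C * u ^ (-(D.δ + s.re))) (Ioi T) :=
    (integrableOn_Ioi_rpow_of_lt (by linarith) (by linarith)).const_mul _
  refine Integrable.mono' h1 (D.measurable_kernel s).aestronglyMeasurable ?_
  refine (ae_restrict_iff' measurableSet_Ioi).2 (Eventually.of_forall fun u hu => ?_)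
  exact D.norm_kernel_le s (hT.trans (le_of_lt hu))

theorem norm_integral_kernel_le {s : ℂ} (hs : 1 - D.δ < s.re) {T : ℝ} (hT : 1 ≤ T) :
    ‖∫ u in Ioi T, D.kernel s u‖ ≤ D.C * (T ^ (1 - D.δ - s.re) / (D.δ + s.re - 1)) := by
  have h1 : IntegrableOn (fun u : ℝ => D.C * u ^ (-(D.δ + s.re))) (Ioi T) :=
    (integrableOn_Ioi_rpow_of_lt (by linarith) (by linarith)).const_mul _
  have h2 : ‖∫ u in Ioi T, D.kernel s u‖ ≤ ∫ u in Ioi T, D.C * u ^ (-(D.δ + s.re)) := by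
    refine norm_integral_le_of_norm_le h1 ?_
    refine (ae_restrict_iff' measurableSet_Ioi).2 (Eventually.of_forall fun u hu => ?_)
    exact D.norm_kernel_le s (hT.trans (le_of_lt hu))
  refine h2.trans (le_of_eq ?_)
  rw [integral_const_mul, integral_Ioi_rpow_of_lt (by linarith) (by linarith)]
  congr 1
  have : D.δ + s.re - 1 ≠ 0 := by linarith
  have : -(D.δ + s.re) + 1 ≠ 0 := by linarith
  rw [show (1 - D.δ - s.re) = -(D.δ + s.re) + 1 by ring]
  field_simp
  ring

/-- The integral of the error term against the Mellin kernel. -/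
noncomputable def J (s : ℂ) : ℂ := ∫ u in Ioi (1 : ℝ), D.kernel s u

theorem differentiableAt_J {s : ℂ} (hs : 1 - D.δ < s.re) : DifferentiableAt ℂ D.J s := by
  set f : ℝ → ℂ := (Ioi (1 : ℝ)).indicator (fun u => (D.E u : ℂ)) with hf
  have hJ : D.J = fun s => mellin f (-s) := by
    ext s
    have h : ∀ u : ℝ, (u : ℂ) ^ (-s - 1) • f u = (Ioi (1 : ℝ)).indicator (D.kernel s) u := by
      intro u
      by_cases hu : u ∈ Ioi (1 : ℝ)
      · rw [hf, indicator_of_mem hu, indicator_of_mem hu, kernel, smul_eq_mul, neg_add', mul_comm]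
      · rw [hf, indicator_of_notMem hu, indicator_of_notMem hu, smul_zero]
    simp only [J, mellin, h]
    rw [setIntegral_indicator measurableSet_Ioi,
      inter_eq_self_of_subset_right (Ioi_subset_Ioi (zero_le_one (α := ℝ)))]
  have hfm : Measurable f := (measurable_ofReal.comp D.measurable_E).indicator measurableSet_Ioi
  have hbd : ∀ u, ‖f u‖ ≤ D.C * max 1 u := by
    intro u
    by_cases hu : 1 < u
    · rw [hf, indicator_of_mem (show u ∈ Ioi (1 : ℝ) from hu), norm_real, Real.norm_eq_abs]
      refine (D.abs_E_le hu.le).trans ?_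
      have := D.C_nonneg
      gcongr
      rw [max_eq_right hu.le]
      conv_rhs => rw [← Real.rpow_one u]
      exact Real.rpow_le_rpow_of_exponent_le hu.le (by linarith [D.δ_pos])
    · rw [hf, indicator_of_notMem (show u ∉ Ioi (1 : ℝ) from hu), norm_zero]
      have := D.C_nonneg
      positivity
  have hloc : LocallyIntegrable f := by
    have h1 : LocallyIntegrable (fun u : ℝ => D.C * max 1 u) :=
      Continuous.locallyIntegrable (by fun_prop)
    refine h1.mono hfm.aestronglyMeasurable (Eventually.of_forall fun u => ?_)
    exact (hbd u).trans (Real.le_norm_self _)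
  rw [hJ]
  refine DifferentiableAt.comp s (g := mellin f) ?_ differentiableAt_id.neg
  refine mellin_differentiableAt_of_isBigO_rpow (a := -(1 - D.δ)) (b := -s.re - 1)
    (hloc.locallyIntegrableOn _) ?_ (by simp; linarith) ?_ (by simp)
  · refine Asymptotics.IsBigO.of_bound D.C ?_
    filter_upwards [eventually_gt_atTop 1] with u hu
    rw [hf, indicator_of_mem (show u ∈ Ioi (1 : ℝ) from hu), norm_real, Real.norm_eq_abs, neg_neg,
      Real.norm_of_nonneg (by positivity)]
    exact D.abs_E_le hu.le
  · refine (Asymptotics.isBigO_zero _ _).congr' ?_ EventuallyEq.rfl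
    filter_upwards [nhdsWithin_le_nhds (Iio_mem_nhds zero_lt_one)] with u hu
    rw [hf, indicator_of_notMem]
    exact not_lt.2 (le_of_lt (show u < 1 from hu))

/-- The analytic continuation of the Dirichlet series of `a`. -/
noncomputable def F (s : ℂ) : ℂ := D.ρ * s / (s - 1) + s * D.J s

/-- The analytic continuation with its pole at `1` removed. -/
noncomputable def H (s : ℂ) : ℂ := D.ρ * s + (s - 1) * (s * D.J s)

theorem H_eq {s : ℂ} (hs : s ≠ 1) : D.H s = (s - 1) * D.F s := by
  have : s - 1 ≠ 0 := sub_ne_zero.2 hs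
  rw [H, F]
  field_simp

theorem H_one : D.H 1 = D.ρ := by simp [H]

theorem differentiableAt_H {s : ℂ} (hs : 1 - D.δ < s.re) : DifferentiableAt ℂ D.H s := by
  have := D.differentiableAt_J hs
  unfold H
  fun_prop

theorem differentiableAt_F {s : ℂ} (hs : 1 - D.δ < s.re) (h1 : s ≠ 1) :
    DifferentiableAt ℂ D.F s := by
  have := D.differentiableAt_J hs
  have : s - 1 ≠ 0 := sub_ne_zero.2 h1
  unfold F
  fun_prop (disch := assumption)

theorem isBigO_sum_a :
    (fun n : ℕ => ∑ k ∈ Finset.Icc 1 n, D.a k) =O[atTop] fun n => (n : ℝ) ^ (1 : ℝ) := by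
  refine Asymptotics.IsBigO.of_bound (D.ρ + D.C) ?_
  filter_upwards [eventually_ge_atTop 1] with n hn
  have hn' : (1 : ℝ) ≤ n := by exact_mod_cast hn
  have := D.A_le hn'
  rw [A_eq, Nat.floor_natCast] at this
  rw [Real.norm_of_nonneg (Finset.sum_nonneg fun n _ => D.a_nonneg n), Real.rpow_one,
    Real.norm_of_nonneg (by positivity)]
  exact this

theorem LSeriesSummable_a {s : ℂ} (hs : 1 < s.re) : LSeriesSummable (fun n => (D.a n : ℂ)) s := by
  exact LSeriesSummable_of_sum_norm_bigO_and_nonneg (r := 1) D.isBigO_sum_a D.a_nonneg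
    zero_le_one hs

theorem integral_A {s : ℂ} (hs : s ≠ 0) {T : ℝ} (hT : 1 ≤ T) :
    s * ∫ u in Ioc 1 T, (D.A u : ℂ) * (u : ℂ) ^ (-(s + 1)) =
      ∑ n ∈ Finset.Icc 0 ⌊T⌋₊, (D.a n : ℂ) * (n : ℂ) ^ (-s) - D.A T * (T : ℂ) ^ (-s) := by
  have hder : ∀ t ∈ Icc 1 T, HasDerivAt (fun x : ℝ => (x : ℂ) ^ (-s))
      (-s * (t : ℂ) ^ (-s - 1)) t := fun t ht =>
    by
      have ht0 : t ≠ 0 := by linarith [ht.1]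
      rw [← deriv_ofReal_cpow_const ht0 (neg_ne_zero.2 hs)]
      exact (differentiableAt_id.ofReal_cpow_const ht0 (neg_ne_zero.2 hs)).hasDerivAt
  have hcont : ContinuousOn (fun t : ℝ => -s * (t : ℂ) ^ (-s - 1)) (Icc 1 T) := by
    intro t ht
    refine ContinuousAt.continuousWithinAt ?_
    exact continuousAt_const.mul
      (continuousAt_ofReal_cpow_const _ _ (Or.inr (by linarith [ht.1])))
  have hintg : IntegrableOn (deriv fun x : ℝ => (x : ℂ) ^ (-s)) (Icc 1 T) :=
    (hcont.integrableOn_Icc).congr_fun (fun t ht => (hder t ht).deriv.symm) measurableSet_Icc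
  have h := sum_mul_eq_sub_integral_mul₀ (c := fun n => (D.a n : ℂ)) (by simp [D.a_zero]) T
    (fun t ht => (hder t ht).differentiableAt) hintg
  have h2 : ∫ t in Ioc 1 T, deriv (fun x : ℝ => (x : ℂ) ^ (-s)) t *
      ∑ k ∈ Finset.Icc 0 ⌊t⌋₊, (D.a k : ℂ) =
      -(s * ∫ u in Ioc 1 T, (D.A u : ℂ) * (u : ℂ) ^ (-(s + 1))) := by
    rw [← integral_const_mul, ← integral_neg]
    refine setIntegral_congr_fun measurableSet_Ioc fun t ht => ?_
    simp only [(hder t (Ioc_subset_Icc_self ht)).deriv, A, ofReal_sum, neg_add']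
    ring
  rw [h2] at h
  have h3 : ∀ n : ℕ, (D.a n : ℂ) * (n : ℂ) ^ (-s) = ((n : ℝ) : ℂ) ^ (-s) * (D.a n : ℂ) := by
    intro n
    rw [mul_comm, ofReal_natCast]
  simp only [h3]
  rw [h]
  simp only [A, ofReal_sum]
  ring

theorem F_eq_truncated {s : ℂ} (hs : 1 - D.δ < s.re) (h1 : s ≠ 1) {T : ℝ} (hT : 1 ≤ T) :
    D.F s = ∑ n ∈ Finset.Icc 0 ⌊T⌋₊, (D.a n : ℂ) * (n : ℂ) ^ (-s) - D.A T * (T : ℂ) ^ (-s) +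
      D.ρ * s * (T : ℂ) ^ (1 - s) / (s - 1) + s * ∫ u in Ioi T, D.kernel s u := by
  have hs0 : s ≠ 0 := by
    rintro rfl
    simp at hs
    linarith [D.δ_le]
  have hs1 : s - 1 ≠ 0 := sub_ne_zero.2 h1
  have hsplit : D.J s = (∫ u in Ioc 1 T, D.kernel s u) + ∫ u in Ioi T, D.kernel s u := by
    rw [J, ← Ioc_union_Ioi_eq_Ioi hT]
    exact setIntegral_union (Ioc_disjoint_Ioi le_rfl) measurableSet_Ioi
      ((D.integrableOn_kernel hs le_rfl).mono_set (Ioc_subset_Ioi_self : Ioc 1 T ⊆ Ioi 1))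
      (D.integrableOn_kernel hs hT)
  have hcpow : ContinuousOn (fun t : ℝ => (t : ℂ) ^ (-s)) (Icc 1 T) := by
    intro t ht
    refine ContinuousAt.continuousWithinAt ?_
    exact continuousAt_ofReal_cpow_const _ _ (Or.inr (by linarith [ht.1]))
  have hpi : IntegrableOn (fun u : ℝ => (D.ρ : ℂ) * (u : ℂ) ^ (-s)) (Ioc 1 T) :=
    (hcpow.integrableOn_Icc.mono_set Ioc_subset_Icc_self).const_mul _
  have hk : ∀ u ∈ Ioc 1 T, D.kernel s u =
      (D.A u : ℂ) * (u : ℂ) ^ (-(s + 1)) - D.ρ * (u : ℂ) ^ (-s) := by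
    intro u hu
    have hu0 : (u : ℂ) ≠ 0 := by exact_mod_cast (by linarith [hu.1] : u ≠ 0)
    rw [kernel, E, neg_add, cpow_add _ _ hu0, cpow_neg_one]
    push_cast
    field_simp
  have hAi : IntegrableOn (fun u : ℝ => (D.A u : ℂ) * (u : ℂ) ^ (-(s + 1))) (Ioc 1 T) := by
    have := ((D.integrableOn_kernel hs le_rfl).mono_set
      (Ioc_subset_Ioi_self : Ioc 1 T ⊆ Ioi 1)).add hpi
    refine this.congr_fun (fun u hu => ?_) measurableSet_Ioc
    simp only [Pi.add_apply, hk u hu]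
    ring
  have h2 : ∫ u in Ioc 1 T, D.kernel s u =
      (∫ u in Ioc 1 T, (D.A u : ℂ) * (u : ℂ) ^ (-(s + 1))) -
        D.ρ * ((T : ℂ) ^ (1 - s) - 1) / (1 - s) := by
    rw [setIntegral_congr_fun measurableSet_Ioc hk, integral_sub hAi hpi, integral_const_mul,
      ← intervalIntegral.integral_of_le (f := fun u : ℝ => (u : ℂ) ^ (-s)) hT, integral_cpow]
    · rw [show -s + 1 = 1 - s by ring]
      simp
      ring
    · right
      refine ⟨fun h => h1 (by linear_combination -h), ?_⟩
      rw [uIcc_of_le hT]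
      exact fun h => by linarith [h.1]
  have h3 := D.integral_A hs0 hT
  rw [F, hsplit, h2, mul_add, mul_sub, h3]
  have hs2 : 1 - s ≠ 0 := sub_ne_zero.2 (Ne.symm h1)
  rw [show (1 - s) = -(s - 1) by ring]
  field_simp
  ring

theorem LSeries_a_eq_F {s : ℂ} (hs : 1 < s.re) : LSeries (fun n => (D.a n : ℂ)) s = D.F s := by
  rw [LSeries_eq_mul_integral_of_nonneg D.a zero_le_one hs D.isBigO_sum_a D.a_nonneg]
  have hs' : 1 - D.δ < s.re := by linarith [D.δ_pos]
  have hs1 : s - 1 ≠ 0 := by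
    intro h
    rw [sub_eq_zero.1 h] at hs
    simp at hs
  have hpi : IntegrableOn (fun u : ℝ => (D.ρ : ℂ) * (u : ℂ) ^ (-s)) (Ioi 1) :=
    (integrableOn_Ioi_cpow_of_lt (by simpa using hs) zero_lt_one).const_mul _
  have hk : ∀ u ∈ Ioi (1 : ℝ), (∑ k ∈ Finset.Icc 1 ⌊u⌋₊, (D.a k : ℂ)) * (u : ℂ) ^ (-(s + 1)) =
      D.kernel s u + D.ρ * (u : ℂ) ^ (-s) := by
    intro u hu
    have hu0 : (u : ℂ) ≠ 0 := by exact_mod_cast (by linarith [show 1 < u from hu] : u ≠ 0)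
    rw [kernel, E, A_eq, neg_add, cpow_add _ _ hu0, cpow_neg_one]
    push_cast
    field_simp
    ring
  rw [setIntegral_congr_fun measurableSet_Ioi hk,
    integral_add (D.integrableOn_kernel hs' le_rfl) hpi, integral_const_mul,
    integral_Ioi_cpow_of_lt (by simpa using hs) zero_lt_one, F, J]
  rw [show (-s + 1) = -(s - 1) by ring, ofReal_one, one_cpow, neg_div_neg_eq]
  field_simp
  ring

end PrimeSystem

end Continuation
end PrimeIdealCount

namespace PrimeIdealCount

section GrowthBounds

open MeasureTheory Set Complex

namespace PrimeSystem

variable (D : PrimeSystem)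

theorem summable_a_rpow {σ : ℝ} (hσ : 1 < σ) : Summable fun n : ℕ => D.a n * (n : ℝ) ^ (-σ) := by
  have h := D.LSeriesSummable_a (s := (σ : ℂ)) (by simpa using hσ)
  have h2 := h.norm
  refine h2.congr fun n => ?_
  rw [LSeries.norm_term_eq]
  split_ifs with h0
  · simp [h0, D.a_zero]
  · rw [norm_real, Real.norm_of_nonneg (D.a_nonneg n), ofReal_re, Real.rpow_neg (by positivity)]
    rfl

theorem norm_sum_truncated_le {s : ℂ} {η : ℝ} (hη : 0 < η) (hs : 1 - η ≤ s.re) {T : ℝ}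
    (hT : 1 ≤ T) :
    ‖∑ n ∈ Finset.Icc 0 ⌊T⌋₊, (D.a n : ℂ) * (n : ℂ) ^ (-s)‖ ≤
      (∑' n : ℕ, D.a n * (n : ℝ) ^ (-(1 + η))) * T ^ (2 * η) := by
  have h1 : ∀ n ∈ Finset.Icc 0 ⌊T⌋₊, ‖(D.a n : ℂ) * (n : ℂ) ^ (-s)‖ ≤
      D.a n * (n : ℝ) ^ (-(1 + η)) * T ^ (2 * η) := by
    intro n hn
    rcases Nat.eq_zero_or_pos n with rfl | hn0
    · simp [D.a_zero]
    have hn1 : (1 : ℝ) ≤ n := by exact_mod_cast hn0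
    have hnT : (n : ℝ) ≤ T :=
      (Nat.cast_le.2 (Finset.mem_Icc.1 hn).2).trans (Nat.floor_le (by linarith))
    rw [norm_mul, norm_real, Real.norm_of_nonneg (D.a_nonneg n), mul_assoc]
    refine mul_le_mul_of_nonneg_left ?_ (D.a_nonneg n)
    rw [← ofReal_natCast, norm_cpow_eq_rpow_re_of_pos (by linarith)]
    calc (n : ℝ) ^ (-s).re ≤ (n : ℝ) ^ (-(1 + η) + 2 * η) :=
          Real.rpow_le_rpow_of_exponent_le hn1 (by simp; linarith)
      _ = (n : ℝ) ^ (-(1 + η)) * (n : ℝ) ^ (2 * η) := Real.rpow_add (by linarith) _ _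
      _ ≤ _ := by gcongr
  refine (norm_sum_le_of_le _ h1).trans ?_
  rw [← Finset.sum_mul]
  refine mul_le_mul_of_nonneg_right ?_ (by positivity)
  exact (D.summable_a_rpow (by linarith)).sum_le_tsum _
    fun n _ => mul_nonneg (D.a_nonneg n) (by positivity)

theorem exists_norm_F_le {ε : ℝ} (hε : 0 < ε) (hε1 : ε ≤ 1) :
    ∃ C η : ℝ, 1 ≤ C ∧ 0 < η ∧ η ≤ D.δ / 2 ∧ ∀ s : ℂ, 1 - η ≤ s.re → s.re ≤ 3 → 1 ≤ |s.im| →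
      ‖D.F s‖ ≤ C * |s.im| ^ ε := by
  have hδ := D.δ_pos
  have hδ2 := D.δ_le
  have hC := D.C_nonneg
  have hρ := D.ρ_pos
  set η := ε * D.δ / 4 with hη
  have hη0 : 0 < η := by positivity
  have hηδ : η ≤ D.δ / 2 := by nlinarith
  set S := ∑' n : ℕ, D.a n * (n : ℝ) ^ (-(1 + η)) with hS
  have hS0 : 0 ≤ S := tsum_nonneg fun n => mul_nonneg (D.a_nonneg n) (by positivity)
  refine ⟨max 1 (S + (D.ρ + D.C) + 4 * D.ρ + 8 * D.C / D.δ), η, le_max_left _ _, hη0, hηδ,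
    fun s hs1 hs3 ht => ?_⟩
  set t := |s.im| with htdef
  have ht0 : 0 < t := by linarith
  set T := t ^ (2 / D.δ) with hTdef
  have hT : 1 ≤ T := Real.one_le_rpow ht (by positivity)
  have hT0 : 0 < T := by linarith
  have hTε : T ^ (2 * η) = t ^ ε := by
    rw [hTdef, ← Real.rpow_mul ht0.le]
    congr 1
    rw [hη]
    field_simp
    norm_num
  have hTδ : t * T ^ (-(D.δ / 2)) = 1 := by
    rw [hTdef, ← Real.rpow_mul ht0.le, show 2 / D.δ * -(D.δ / 2) = -1 by field_simp, Real.rpow_neg_one,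
      mul_inv_cancel₀ ht0.ne']
  have htε : 1 ≤ t ^ ε := Real.one_le_rpow ht hε.le
  have hsne : s ≠ 1 := by
    rintro rfl
    simp [htdef] at ht
    linarith
  have hsnorm : ‖s‖ ≤ 4 * t := by
    have h1 := norm_le_abs_re_add_abs_im s
    have h2 : |s.re| ≤ 3 := abs_le.2 ⟨by linarith, hs3⟩
    linarith
  have hs1norm : t ≤ ‖s - 1‖ := by
    have := abs_im_le_norm (s - 1)
    simpa using this
  have hTpow : ∀ r : ℝ, r ≤ 2 * η → T ^ r ≤ t ^ ε := fun r hr =>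
    hTε ▸ Real.rpow_le_rpow_of_exponent_le hT hr
  have e1 : ‖∑ n ∈ Finset.Icc 0 ⌊T⌋₊, (D.a n : ℂ) * (n : ℂ) ^ (-s)‖ ≤ S * t ^ ε := by
    rw [← hTε]
    exact D.norm_sum_truncated_le hη0 hs1 hT
  have e2 : ‖(D.A T : ℂ) * (T : ℂ) ^ (-s)‖ ≤ (D.ρ + D.C) * t ^ ε := by
    rw [norm_mul, norm_real, Real.norm_of_nonneg (D.A_nonneg T), norm_cpow_eq_rpow_re_of_pos hT0]
    calc D.A T * T ^ (-s).re ≤ (D.ρ + D.C) * T * T ^ (-s).re := by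
          gcongr
          exact D.A_le hT
      _ = (D.ρ + D.C) * T ^ (1 - s.re) := by
          rw [mul_assoc, sub_eq_add_neg, Real.rpow_add hT0, Real.rpow_one, neg_re]
      _ ≤ _ := by
          gcongr
          exact hTpow _ (by linarith)
  have e3 : ‖D.ρ * s * (T : ℂ) ^ (1 - s) / (s - 1)‖ ≤ 4 * D.ρ * t ^ ε := by
    rw [norm_div, norm_mul, norm_mul, norm_real, Real.norm_of_nonneg hρ.le,
      norm_cpow_eq_rpow_re_of_pos hT0, div_le_iff₀ (by linarith)]
    calc D.ρ * ‖s‖ * T ^ (1 - s).re ≤ D.ρ * (4 * t) * t ^ ε := by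
          gcongr
          exact hTpow _ (by simp; linarith)
      _ = 4 * D.ρ * t ^ ε * t := by ring
      _ ≤ _ := by gcongr
  have e4 : ‖s * ∫ u in Ioi T, D.kernel s u‖ ≤ 8 * D.C / D.δ * t ^ ε := by
    rw [norm_mul]
    have h1 := D.norm_integral_kernel_le (s := s) (by linarith) hT
    have h2 : T ^ (1 - D.δ - s.re) / (D.δ + s.re - 1) ≤ T ^ (-(D.δ / 2)) / (D.δ / 2) := by
      gcongr
      · linarith
      · linarith
    calc ‖s‖ * ‖∫ u in Ioi T, D.kernel s u‖
        ≤ 4 * t * (D.C * (T ^ (-(D.δ / 2)) / (D.δ / 2))) := by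
          gcongr
          exact h1.trans (by gcongr)
      _ = 8 * D.C / D.δ * (t * T ^ (-(D.δ / 2))) := by
          field_simp
          ring
      _ ≤ _ := by
          rw [hTδ]
          gcongr
  rw [D.F_eq_truncated (by linarith) hsne hT]
  refine (norm_add_le _ _).trans ?_
  refine (add_le_add ((norm_add_le _ _).trans (add_le_add ((norm_sub_le _ _).trans
    (add_le_add e1 e2)) e3)) e4).trans ?_
  rw [← add_mul, ← add_mul, ← add_mul]
  exact mul_le_mul_of_nonneg_right (le_max_right _ _) (by positivity)

theorem exists_norm_F_real_le :
    ∃ C : ℝ, 1 ≤ C ∧ ∀ σ : ℝ, 1 < σ → σ ≤ 3 → ‖D.F σ‖ ≤ C / (σ - 1) := by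
  have hδ := D.δ_pos
  have hC := D.C_nonneg
  have hρ := D.ρ_pos
  refine ⟨max 1 (3 * D.ρ + 6 * (D.C / D.δ)), le_max_left _ _, fun σ h1 h3 => ?_⟩
  have hσ : 0 < σ - 1 := by linarith
  have hJ : ‖D.J σ‖ ≤ D.C / D.δ := by
    have := D.norm_integral_kernel_le (s := (σ : ℂ)) (by simp; linarith) le_rfl
    refine this.trans ?_
    rw [Real.one_rpow, div_eq_mul_one_div D.C]
    gcongr
    simp
    linarith
  have e1 : ‖(D.ρ : ℂ) * σ / (σ - 1)‖ ≤ 3 * D.ρ / (σ - 1) := by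
    rw [norm_div, norm_mul, norm_real, norm_real, Real.norm_of_nonneg hρ.le,
      Real.norm_of_nonneg (by linarith), ← ofReal_one, ← ofReal_sub, norm_real,
      Real.norm_of_nonneg hσ.le]
    rw [mul_comm D.ρ]
    gcongr
  have e2 : ‖(σ : ℂ) * D.J σ‖ ≤ 6 * (D.C / D.δ) / (σ - 1) := by
    rw [norm_mul, norm_real, Real.norm_of_nonneg (by linarith), le_div_iff₀ hσ]
    calc σ * ‖D.J σ‖ * (σ - 1) ≤ 3 * (D.C / D.δ) * 2 := by
          gcongr
          linarith
      _ = _ := by ring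
  rw [F]
  refine (norm_add_le _ _).trans ((add_le_add e1 e2).trans ?_)
  rw [← add_div]
  gcongr
  exact le_max_right _ _

end PrimeSystem

/-- The trigonometric inequality behind the nonvanishing on the line of real part one. -/
theorem re_log_comb_nonneg {r : ℝ} (h0 : 0 ≤ r) (h1 : r < 1) {z : ℂ} (hz : ‖z‖ = 1) :
    0 ≤ 3 * (-log (1 - r)).re + 4 * (-log (1 - r * z)).re + (-log (1 - r * z ^ 2)).re := by
  have hac₀ : ‖(r : ℂ)‖ < 1 := by
    simpa only [norm_real, Real.norm_of_nonneg h0] using h1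
  have hac₁ : ‖r * z‖ < 1 := by rwa [norm_mul, hz, mul_one]
  have hac₂ : ‖r * z ^ 2‖ < 1 := by rwa [norm_mul, norm_pow, hz, one_pow, mul_one]
  rw [← ((hasSum_re <| hasSum_taylorSeries_neg_log hac₀).mul_left 3).add
    ((hasSum_re <| hasSum_taylorSeries_neg_log hac₁).mul_left 4) |>.add
    (hasSum_re <| hasSum_taylorSeries_neg_log hac₂) |>.tsum_eq]
  refine tsum_nonneg fun n => ?_
  simp only [← ofReal_pow, div_natCast_re, ofReal_re, mul_pow, mul_re, ofReal_im, zero_mul,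
    sub_zero]
  rcases n.eq_zero_or_pos with rfl | hn
  · simp
  · simp only [← mul_div_assoc, ← add_div]
    refine div_nonneg ?_ n.cast_nonneg
    rw [← pow_mul, pow_mul', sq, mul_re, ← sq, ← sq, ← sq_norm_sub_sq_re, norm_pow, hz]
    calc (0 : ℝ) ≤ 2 * r ^ n * ((z ^ n).re + 1) ^ 2 := by positivity
      _ = _ := by ring

namespace PrimeSystem

variable (D : PrimeSystem)

theorem norm_natCast_cpow_neg_le_half {n : ℕ} (hn : 2 ≤ n) {s : ℂ} (hs : 1 ≤ s.re) :
    ‖(n : ℂ) ^ (-s)‖ ≤ 1 / 2 := by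
  have h2 : (2 : ℝ) ≤ n := by exact_mod_cast hn
  rw [← ofReal_natCast, norm_cpow_eq_rpow_re_of_pos (by linarith), neg_re]
  calc (n : ℝ) ^ (-s.re) ≤ (n : ℝ) ^ (-1 : ℝ) :=
        Real.rpow_le_rpow_of_exponent_le (by linarith) (by linarith)
    _ = (n : ℝ)⁻¹ := Real.rpow_neg_one _
    _ ≤ 1 / 2 := by
        rw [one_div]
        gcongr

theorem two_le_of_c_ne_zero {n : ℕ} (h : D.c n ≠ 0) : 2 ≤ n := by
  by_contra! hn
  interval_cases n
  · exact h D.c_zero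
  · exact h D.c_one

theorem summable_c_log {s : ℂ} (hs : 1 < s.re) :
    Summable fun n : ℕ => (D.c n : ℂ) * -log (1 - (n : ℂ) ^ (-s)) := by
  refine Summable.of_norm_bounded ((D.summable_a_rpow hs).mul_left (3 / 2)) fun n => ?_
  by_cases hc : D.c n = 0
  · rw [hc]
    have := D.a_nonneg n
    simp
    positivity
  have hn := D.two_le_of_c_ne_zero hc
  have hn0 : (0 : ℝ) < n := by
    have : (2 : ℝ) ≤ n := by exact_mod_cast hn
    linarith
  have h1 := norm_natCast_cpow_neg_le_half hn hs.le
  have h2 := norm_log_one_add_half_le_self (z := -(n : ℂ) ^ (-s)) (by rwa [norm_neg])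
  rw [norm_neg] at h2
  have h3 : ‖(n : ℂ) ^ (-s)‖ = (n : ℝ) ^ (-s.re) := by
    rw [← ofReal_natCast, norm_cpow_eq_rpow_re_of_pos hn0, neg_re]
  rw [norm_mul, norm_neg, norm_real, Real.norm_of_nonneg (D.c_nonneg n), sub_eq_add_neg]
  rw [h3] at h2
  calc D.c n * ‖log (1 + -(n : ℂ) ^ (-s))‖ ≤ D.a n * (3 / 2 * (n : ℝ) ^ (-s.re)) :=
        mul_le_mul (D.c_le n) h2 (norm_nonneg _) (D.a_nonneg n)
    _ = _ := by ring

theorem F_eq_exp {s : ℂ} (hs : 1 < s.re) :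
    D.F s = exp (∑' n : ℕ, (D.c n : ℂ) * -log (1 - (n : ℂ) ^ (-s))) := by
  rw [← D.LSeries_a_eq_F hs, D.euler s hs]

theorem one_le_norm_F_comb {σ : ℝ} (hσ : 1 < σ) (t : ℝ) :
    1 ≤ ‖D.F σ‖ ^ 3 * ‖D.F (σ + t * I)‖ ^ 4 * ‖D.F (σ + 2 * t * I)‖ := by
  have r0 : 1 < (σ : ℂ).re := by simpa using hσ
  have r1 : 1 < ((σ : ℂ) + t * I).re := by simpa using hσ
  have r2 : 1 < ((σ : ℂ) + 2 * t * I).re := by simpa using hσ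
  rw [D.F_eq_exp r0, D.F_eq_exp r1, D.F_eq_exp r2, norm_exp, norm_exp, norm_exp, ← Real.exp_nat_mul,
    ← Real.exp_nat_mul, ← Real.exp_add, ← Real.exp_add, Real.one_le_exp_iff]
  rw [← ((hasSum_re (D.summable_c_log r0).hasSum).mul_left ((3 : ℕ) : ℝ)).add
    ((hasSum_re (D.summable_c_log r1).hasSum).mul_left ((4 : ℕ) : ℝ)) |>.add
    (hasSum_re (D.summable_c_log r2).hasSum) |>.tsum_eq]
  refine tsum_nonneg fun n => ?_
  by_cases hc : D.c n = 0
  · simp [hc]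
  have hn := D.two_le_of_c_ne_zero hc
  have hn2 : (2 : ℝ) ≤ n := by exact_mod_cast hn
  have hn0 : (n : ℂ) ≠ 0 := by
    rw [Nat.cast_ne_zero]
    omega
  set r : ℝ := (n : ℝ) ^ (-σ) with hr
  set z : ℂ := (n : ℂ) ^ (-(t * I)) with hz
  have hz1 : ‖z‖ = 1 := by
    rw [hz, ← ofReal_natCast, norm_cpow_eq_rpow_re_of_pos (by linarith)]
    simp
  have e0 : (n : ℂ) ^ (-(σ : ℂ)) = r := by
    rw [hr, ofReal_cpow (by linarith)]
    simp
  have e1 : (n : ℂ) ^ (-((σ : ℂ) + t * I)) = r * z := by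
    rw [neg_add, cpow_add _ _ hn0, e0]
  have e2 : (n : ℂ) ^ (-((σ : ℂ) + 2 * t * I)) = r * z ^ 2 := by
    rw [neg_add, cpow_add _ _ hn0, e0, hz, ← cpow_nat_mul]
    congr 2
    push_cast
    ring
  have h := re_log_comb_nonneg (r := r) (by positivity)
    (Real.rpow_lt_one_of_one_lt_of_neg (by linarith) (by linarith)) hz1
  rw [e0, e1, e2]
  simp only [re_ofReal_mul]
  push_cast
  have := mul_nonneg (D.c_nonneg n) h
  linarith

end PrimeSystem

end GrowthBounds
end PrimeIdealCount

namespace PrimeIdealCount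

section LogarithmicDerivative

open MeasureTheory Set Complex

namespace PrimeSystem

variable (D : PrimeSystem)

theorem F_ne_zero_of_one_lt {s : ℂ} (hs : 1 < s.re) : D.F s ≠ 0 := by
  rw [D.F_eq_exp hs]
  exact exp_ne_zero _

theorem F_one_add_ne_zero {t : ℝ} (ht : t ≠ 0) : D.F (1 + t * I) ≠ 0 := by
  intro h0
  obtain ⟨C, hC, hF⟩ := D.exists_norm_F_real_le
  have hre : ∀ u : ℝ, 1 - D.δ < ((1 : ℂ) + u * I).re := fun u => by simp [D.δ_pos]
  have hne : ∀ u : ℝ, u ≠ 0 → (1 : ℂ) + u * I ≠ 1 := fun u hu h => by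
    have := congrArg im h
    simp at this
    exact hu this
  have hd := (D.differentiableAt_F (hre t) (hne t ht)).isBigO_sub
  have hc : Tendsto D.F (nhds (1 + (2 * t : ℝ) * I)) (nhds (D.F (1 + (2 * t : ℝ) * I))) :=
    (D.differentiableAt_F (hre (2 * t)) (hne (2 * t) (by simpa using ht))).continuousAt
  have hmap : ∀ u : ℝ, Tendsto (fun σ : ℝ => (σ : ℂ) + u * I) (nhdsWithin 1 (Ioi 1))
      (nhds (1 + u * I)) := fun u => by
    have : ContinuousAt (fun σ : ℝ => (σ : ℂ) + u * I) 1 := by fun_prop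
    simpa [ContinuousAt] using this.tendsto.mono_left nhdsWithin_le_nhds
  have h1 := hd.comp_tendsto (hmap t)
  obtain ⟨K, hK0, hK⟩ := h1.exists_pos
  have h2 := ((hc.norm.comp (hmap (2 * t))).eventually
    (gt_mem_nhds (lt_add_one ‖D.F (1 + (2 * t : ℝ) * I)‖)))
  set B := ‖D.F (1 + (2 * t : ℝ) * I)‖ + 1 with hB
  have hB0 : 0 < B := by positivity
  have h3 : ∀ᶠ σ : ℝ in nhdsWithin 1 (Ioi 1), 1 ≤ C ^ 3 * K ^ 4 * B * (σ - 1) := by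
    filter_upwards [hK.bound, h2, self_mem_nhdsWithin,
      nhdsWithin_le_nhds (Iio_mem_nhds (show (1 : ℝ) < 3 by norm_num))] with σ e1 e2 e3 e4
    have e3' : 0 < σ - 1 := sub_pos.2 e3
    have e5 := D.one_le_norm_F_comb e3 t
    have e6 := hF σ e3 (le_of_lt e4)
    simp only [Function.comp_apply, h0, sub_zero, add_sub_add_right_eq_sub] at e1
    have e7 : ‖(σ : ℂ) - 1‖ = σ - 1 := by
      rw [← ofReal_one, ← ofReal_sub, norm_real, Real.norm_of_nonneg e3'.le]
    rw [e7] at e1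
    have e8 : ‖D.F (σ + 2 * t * I)‖ ≤ B := by
      have := le_of_lt e2
      simpa using this
    calc 1 ≤ _ := e5
      _ ≤ (C / (σ - 1)) ^ 3 * (K * (σ - 1)) ^ 4 * B := by gcongr
      _ = _ := by
        field_simp
  have h4 : Tendsto (fun σ : ℝ => C ^ 3 * K ^ 4 * B * (σ - 1)) (nhdsWithin 1 (Ioi 1)) (nhds 0) := by
    have : ContinuousAt (fun σ : ℝ => C ^ 3 * K ^ 4 * B * (σ - 1)) 1 := by fun_prop
    simpa [ContinuousAt] using this.tendsto.mono_left nhdsWithin_le_nhds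
  exact absurd (ge_of_tendsto h4 h3) (by norm_num)

theorem H_ne_zero {s : ℂ} (hs : 1 ≤ s.re) : D.H s ≠ 0 := by
  by_cases h1 : s = 1
  · rw [h1, H_one]
    exact_mod_cast D.ρ_pos.ne'
  rw [D.H_eq h1]
  refine mul_ne_zero (sub_ne_zero.2 h1) ?_
  rcases hs.lt_or_eq with h | h
  · exact D.F_ne_zero_of_one_lt h
  · have e : s = 1 + s.im * I := by
      exact Complex.ext (by simp [← h]) (by simp)
    rw [e]
    refine D.F_one_add_ne_zero fun him => h1 ?_
    rw [e, him]
    simp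

theorem exists_norm_deriv_F_le {ε : ℝ} (hε : 0 < ε) (hε1 : ε ≤ 1) :
    ∃ C η : ℝ, 1 ≤ C ∧ 0 < η ∧ η < D.δ ∧ ∀ s : ℂ, 1 - η ≤ s.re → s.re ≤ 2 → 2 ≤ |s.im| →
      ‖deriv D.F s‖ ≤ C * |s.im| ^ ε := by
  obtain ⟨C, η, hC, hη, hηδ, h⟩ := D.exists_norm_F_le hε hε1
  have hδ := D.δ_pos
  have hδ2 := D.δ_le
  refine ⟨max 1 (C * 2 / (η / 2)), η / 2, le_max_left _ _, by positivity, by linarith,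
    fun s h1 h2 ht => ?_⟩
  have hpt : ∀ z ∈ Metric.closedBall s (η / 2), 1 - η ≤ z.re ∧ z.re ≤ 3 ∧ 1 ≤ |z.im| ∧
      |z.im| ≤ 2 * |s.im| := by
    intro z hz
    rw [Metric.mem_closedBall, dist_eq] at hz
    have e1 := abs_le.1 ((abs_re_le_norm (z - s)).trans hz)
    have e2 := (abs_im_le_norm (z - s)).trans hz
    rw [sub_re] at e1
    rw [sub_im] at e2
    have e3 := abs_sub_abs_le_abs_sub z.im s.im
    have e4 := abs_sub_abs_le_abs_sub s.im z.im
    rw [abs_sub_comm] at e4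
    refine ⟨by linarith, by linarith, by linarith, by linarith⟩
  have hne : ∀ z ∈ Metric.closedBall s (η / 2), z ≠ 1 := by
    rintro z hz rfl
    have := (hpt 1 hz).2.2.1
    simp at this
    linarith
  have hdiff : DifferentiableOn ℂ D.F (Metric.closedBall s (η / 2)) := fun z hz =>
    (D.differentiableAt_F (by linarith [(hpt z hz).1]) (hne z hz)).differentiableWithinAt
  have hbd : ∀ z ∈ Metric.sphere s (η / 2), ‖D.F z‖ ≤ C * 2 * |s.im| ^ ε := by
    intro z hz
    obtain ⟨p1, p2, p3, p4⟩ := hpt z (Metric.sphere_subset_closedBall hz)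
    calc ‖D.F z‖ ≤ C * |z.im| ^ ε := h z p1 p2 p3
      _ ≤ C * (2 * |s.im|) ^ ε := by gcongr
      _ = C * ((2 : ℝ) ^ ε * |s.im| ^ ε) := by rw [Real.mul_rpow (by norm_num) (abs_nonneg _)]
      _ ≤ C * ((2 : ℝ) ^ (1 : ℝ) * |s.im| ^ ε) := by
          gcongr
          norm_num
      _ = _ := by
          rw [Real.rpow_one]
          ring
  have := norm_deriv_le_of_forall_mem_sphere_norm_le (by positivity : 0 < η / 2)
    (hdiff.mono (Metric.closure_ball_subset_closedBall)).diffContOnCl hbd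
  refine this.trans ?_
  rw [mul_div_right_comm]
  exact mul_le_mul_of_nonneg_right (le_max_right _ _) (by positivity)

theorem exists_le_norm_F {ε : ℝ} (hε : 0 < ε) (hε1 : ε ≤ 1) :
    ∃ c κ : ℝ, 0 < c ∧ 0 < κ ∧ κ ≤ 1 ∧ κ < D.δ ∧ ∀ s : ℂ, 2 ≤ |s.im| →
      1 - κ * |s.im| ^ (-(5 * ε)) ≤ s.re → s.re ≤ 2 → c * |s.im| ^ (-(4 * ε)) ≤ ‖D.F s‖ := by
  obtain ⟨C₀, η₀, hC₀, hη₀, hηδ₀, h₀⟩ := D.exists_norm_F_le hε hε1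
  obtain ⟨C₁, hC₁, h₁⟩ := D.exists_norm_F_real_le
  obtain ⟨C₂, η₂, hC₂, hη₂, hηδ₂, h₂⟩ := D.exists_norm_deriv_F_le hε hε1
  set B := 2 * C₁ ^ 3 * C₀ with hB
  have hB1 : 1 ≤ B := by
    have : 1 ≤ C₁ ^ 3 := one_le_pow₀ hC₁
    nlinarith
  set l := min (min 1 η₂) (1 / (4 * B * C₂)) with hl
  have hl0 : 0 < l := by positivity
  have hl1 : l ≤ 1 := (min_le_left _ _).trans (min_le_left _ _)
  have hlη : l ≤ η₂ := (min_le_left _ _).trans (min_le_right _ _)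
  have hlB : l ≤ 1 / (4 * B * C₂) := min_le_right _ _
  have hl4 : l ^ 4 ≤ l := pow_le_of_le_one hl0.le hl1 (by norm_num)
  refine ⟨l ^ 3 / (2 * B), l ^ 4, by positivity, by positivity, hl4.trans hl1,
    by linarith, fun s ht hs hs2 => ?_⟩
  set t := |s.im| with htdef
  have ht0 : 0 < t := by linarith
  set η := l ^ 4 * t ^ (-(5 * ε)) with hη
  have hη0 : 0 < η := by positivity
  have hηl : η ≤ l ^ 4 := mul_le_of_le_one_right (by positivity)
    (Real.rpow_le_one_of_one_le_of_nonpos (by linarith) (by linarith))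
  have hright : ∀ σ : ℝ, 1 + η ≤ σ → σ ≤ 2 →
      l ^ 3 / B * t ^ (-(4 * ε)) ≤ ‖D.F (σ + s.im * I)‖ := by
    intro σ hσ hσ2
    have hσ1 : 1 < σ := by linarith
    have e1 := D.one_le_norm_F_comb hσ1 s.im
    have e2 := h₁ σ hσ1 (by linarith)
    have e3 : ‖D.F (σ + 2 * s.im * I)‖ ≤ C₀ * (2 * t ^ ε) := by
      have := h₀ (σ + 2 * s.im * I) (by simp; linarith) (by simp; linarith)
        (by simp [abs_mul]; linarith)
      refine this.trans ?_
      have e : |((σ : ℂ) + 2 * s.im * I).im| = 2 * t := by simp [abs_mul, htdef]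
      rw [e, Real.mul_rpow (by norm_num) ht0.le]
      gcongr
      calc (2 : ℝ) ^ ε ≤ (2 : ℝ) ^ (1 : ℝ) := by
            gcongr
            norm_num
        _ = 2 := Real.rpow_one _
    set f := ‖D.F (σ + s.im * I)‖ with hf
    have hση : η ≤ σ - 1 := by linarith
    have e4 : 1 ≤ (C₁ / η) ^ 3 * f ^ 4 * (C₀ * (2 * t ^ ε)) := by
      refine e1.trans ?_
      gcongr
      exact e2.trans (by gcongr)
    have e5 : η ^ 3 ≤ B * t ^ ε * f ^ 4 := by
      have : (C₁ / η) ^ 3 * f ^ 4 * (C₀ * (2 * t ^ ε)) = (B * t ^ ε * f ^ 4) / η ^ 3 := by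
        rw [hB]
        field_simp
      rw [this, le_div_iff₀ (by positivity), one_mul] at e4
      exact e4
    have e6 : (l ^ 3 * t ^ (-(4 * ε))) ^ 4 ≤ (B * f) ^ 4 := by
      have e7 : (l ^ 3 * t ^ (-(4 * ε))) ^ 4 = η ^ 3 * t ^ (-ε) := by
        rw [hη, mul_pow, mul_pow, ← Real.rpow_natCast (t ^ _), ← Real.rpow_mul ht0.le,
          ← Real.rpow_natCast (t ^ _), ← Real.rpow_mul ht0.le, mul_assoc, ← Real.rpow_add ht0,
          ← pow_mul, ← pow_mul]
        congr 2
        push_cast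
        ring
      rw [e7]
      calc η ^ 3 * t ^ (-ε) ≤ B * t ^ ε * f ^ 4 * t ^ (-ε) := by gcongr
        _ = B * f ^ 4 * (t ^ ε * t ^ (-ε)) := by ring
        _ = B * f ^ 4 := by rw [← Real.rpow_add ht0, add_neg_cancel, Real.rpow_zero, mul_one]
        _ ≤ B ^ 4 * f ^ 4 := by
            gcongr
            exact le_self_pow₀ hB1 (by norm_num)
        _ = _ := by ring
    have e8 := le_of_pow_le_pow_left₀ (by norm_num) (by positivity) e6
    rw [div_mul_eq_mul_div, div_le_iff₀ (by positivity), mul_comm f]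
    exact e8
  have hs_eq : s = (s.re : ℂ) + s.im * I := (re_add_im s).symm
  rcases le_total (1 + η) s.re with hcase | hcase
  · have := hright s.re hcase hs2
    rw [← hs_eq] at this
    refine le_trans ?_ this
    gcongr
    linarith
  · have e1 := hright (1 + η) le_rfl (by linarith)
    have hconv : Convex ℝ (Icc (1 - η) (1 + η) ×ℂ {s.im}) :=
      ((convex_Icc (1 - η) (1 + η)).linear_preimage reLm).inter
        ((convex_singleton s.im).linear_preimage imLm)
    have hin : ∀ z ∈ Icc (1 - η) (1 + η) ×ℂ {s.im}, 1 - η₂ ≤ z.re ∧ z.re ≤ 2 ∧ z.im = s.im := by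
      rintro z ⟨⟨p1, p2⟩, p3⟩
      exact ⟨by linarith, by linarith, p3⟩
    have e2 := hconv.norm_image_sub_le_of_norm_deriv_le (f := D.F) (C := C₂ * t ^ ε)
      (x := s) (y := ((1 + η : ℝ) : ℂ) + s.im * I)
      (fun z hz => by
        obtain ⟨p1, p2, p3⟩ := hin z hz
        refine D.differentiableAt_F (by linarith) ?_
        rintro rfl
        simp at p3
        rw [htdef, ← p3] at ht
        simp at ht
        linarith)
      (fun z hz => by
        obtain ⟨p1, p2, p3⟩ := hin z hz
        have := h₂ z p1 p2 (by rw [p3]; exact ht)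
        rwa [p3] at this)
      (by
        refine ⟨⟨hs, hcase⟩, rfl⟩)
      (by
        refine ⟨⟨?_, ?_⟩, ?_⟩
        · simp
          linarith
        · simp
        · simp)
    have e3 : ‖((1 + η : ℝ) : ℂ) + s.im * I - s‖ ≤ 2 * η := by
      have : ((1 + η : ℝ) : ℂ) + s.im * I - s = ((1 + η - s.re : ℝ) : ℂ) := by
        push_cast
        linear_combination (-1 : ℂ) * hs_eq
      rw [this, norm_real, Real.norm_eq_abs, abs_of_nonneg (by linarith)]
      linarith
    have e4 : C₂ * t ^ ε * (2 * η) ≤ l ^ 3 / (2 * B) * t ^ (-(4 * ε)) := by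
      have e5 : C₂ * t ^ ε * (2 * η) = 2 * C₂ * l ^ 4 * t ^ (-(4 * ε)) := by
        rw [hη, show -(4 * ε) = ε + -(5 * ε) by ring, Real.rpow_add ht0]
        ring
      rw [e5]
      gcongr
      rw [le_div_iff₀ (by positivity)] at hlB ⊢
      calc 2 * C₂ * l ^ 4 * (2 * B) = l ^ 3 * (l * (4 * B * C₂)) := by ring
        _ ≤ l ^ 3 * 1 := by gcongr
        _ = _ := mul_one _
    have e6 : ‖D.F (((1 + η : ℝ) : ℂ) + s.im * I) - D.F s‖ ≤ l ^ 3 / (2 * B) * t ^ (-(4 * ε)) :=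
      e2.trans ((mul_le_mul_of_nonneg_left e3 (by positivity)).trans e4)
    have e7 := norm_sub_norm_le (D.F (((1 + η : ℝ) : ℂ) + s.im * I)) (D.F s)
    have e8 : l ^ 3 / B * t ^ (-(4 * ε)) = 2 * (l ^ 3 / (2 * B) * t ^ (-(4 * ε))) := by
      field_simp
    linarith

end PrimeSystem

end LogarithmicDerivative
end PrimeIdealCount

namespace PrimeIdealCount

section SecondDerivative

open MeasureTheory Set Complex

namespace PrimeSystem

variable (D : PrimeSystem)

theorem logDeriv_H_eq {s : ℂ} (hs : 1 - D.δ < s.re) (h1 : s ≠ 1) (hF : D.F s ≠ 0) :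
    logDeriv D.H s = 1 / (s - 1) + logDeriv D.F s := by
  have he : D.H =ᶠ[nhds s] fun z => (z - 1) * D.F z := by
    filter_upwards [isOpen_ne.mem_nhds h1] with z hz
    exact D.H_eq hz
  have hd := D.differentiableAt_F hs h1
  have e1 : logDeriv D.H s = logDeriv (fun z => (z - 1) * D.F z) s := by
    rw [logDeriv_apply, logDeriv_apply, he.deriv_eq, he.eq_of_nhds]
  rw [e1, logDeriv_mul (f := fun z => z - 1) s (sub_ne_zero.2 h1) hF (by fun_prop) hd]
  simp [logDeriv_apply]

theorem analyticAt_logDeriv_H {s : ℂ} (hs : 1 - D.δ < s.re) (h : D.H s ≠ 0) :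
    AnalyticAt ℂ (logDeriv D.H) s := by
  have hH : AnalyticAt ℂ D.H s := by
    refine DifferentiableOn.analyticAt (s := {z : ℂ | 1 - D.δ < z.re})
      (fun z hz => (D.differentiableAt_H hz).differentiableWithinAt) ?_
    exact (isOpen_lt continuous_const continuous_re).mem_nhds hs
  exact hH.deriv.div hH h

theorem exists_norm_logDeriv_H_le {ε : ℝ} (hε : 0 < ε) (hε1 : ε ≤ 1) :
    ∃ C κ : ℝ, 0 < C ∧ 0 < κ ∧ κ ≤ 1 ∧ κ < D.δ ∧ ∀ s : ℂ, 2 ≤ |s.im| →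
      1 - κ * |s.im| ^ (-(5 * ε)) ≤ s.re → s.re ≤ 2 →
        D.H s ≠ 0 ∧ ‖logDeriv D.H s‖ ≤ C * |s.im| ^ (5 * ε) := by
  obtain ⟨C, η, hC, hη, hηδ, h⟩ := D.exists_norm_deriv_F_le hε hε1
  obtain ⟨c, κ, hc, hκ, hκ1, hκδ, h'⟩ := D.exists_le_norm_F hε hε1
  refine ⟨1 + C / c, min κ η, by positivity, by positivity, (min_le_left _ _).trans hκ1,
    (min_le_left _ _).trans_lt hκδ, fun s ht hs hs2 => ?_⟩
  set t := |s.im| with htd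
  have ht0 : 0 < t := by linarith
  have hp0 : 0 < t ^ (-(5 * ε)) := by positivity
  have hp1 : t ^ (-(5 * ε)) ≤ 1 :=
    Real.rpow_le_one_of_one_le_of_nonpos (by linarith) (by linarith)
  have hsκ : 1 - κ * t ^ (-(5 * ε)) ≤ s.re := by
    have := mul_le_mul_of_nonneg_right (min_le_left κ η) hp0.le
    linarith
  have hsη : 1 - η ≤ s.re := by
    have e1 := mul_le_mul_of_nonneg_right (min_le_right κ η) hp0.le
    have e2 := mul_le_mul_of_nonneg_left hp1 hη.le
    linarith
  have hlow := h' s ht hsκ hs2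
  have hup := h s hsη hs2 ht
  have hF0 : D.F s ≠ 0 := by
    rw [← norm_pos_iff]
    exact lt_of_lt_of_le (by positivity) hlow
  have hs1 : s ≠ 1 := by
    rintro rfl
    simp [htd] at ht
    linarith
  have hne : (s - 1) ≠ 0 := sub_ne_zero.2 hs1
  refine ⟨by rw [D.H_eq hs1]; exact mul_ne_zero hne hF0, ?_⟩
  rw [D.logDeriv_H_eq (by linarith) hs1 hF0]
  have e1 : ‖1 / (s - 1)‖ ≤ t ^ (5 * ε) := by
    have e2 : 1 ≤ ‖s - 1‖ := by
      have := abs_im_le_norm (s - 1)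
      simp only [sub_im, one_im, sub_zero] at this
      linarith
    calc ‖1 / (s - 1)‖ ≤ 1 := by
          rw [norm_div, norm_one]
          exact div_le_one_of_le₀ e2 (norm_nonneg _)
      _ ≤ _ := Real.one_le_rpow (by linarith) (by positivity)
  have e3 : ‖logDeriv D.F s‖ ≤ C / c * t ^ (5 * ε) := by
    rw [logDeriv_apply, norm_div]
    calc ‖deriv D.F s‖ / ‖D.F s‖ ≤ (C * t ^ ε) / (c * t ^ (-(4 * ε))) := by gcongr
      _ = C / c * (t ^ ε * (t ^ (-(4 * ε)))⁻¹) := by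
          field_simp
      _ = C / c * t ^ (5 * ε) := by
          rw [← Real.rpow_neg ht0.le, ← Real.rpow_add ht0]
          ring_nf
  calc _ ≤ ‖1 / (s - 1)‖ + ‖logDeriv D.F s‖ := norm_add_le _ _
    _ ≤ t ^ (5 * ε) + C / c * t ^ (5 * ε) := add_le_add e1 e3
    _ = _ := by ring

theorem exists_norm_iteratedDeriv_logDeriv_H_le :
    ∃ C : ℝ, 0 < C ∧ ∀ s : ℂ, 1 ≤ s.re → s.re ≤ 3 / 2 →
      ‖iteratedDeriv 2 (logDeriv D.H) s‖ ≤ C * (1 + |s.im|) ^ (1 / 2 : ℝ) := by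
  obtain ⟨C, κ, hC, hκ, hκ1, hκδ, h⟩ :=
    D.exists_norm_logDeriv_H_le (ε := 1 / 30) (by norm_num) (by norm_num)
  have hδ := D.δ_pos
  have hcont : ContinuousOn (iteratedDeriv 2 (logDeriv D.H))
      (Icc (1 : ℝ) (3 / 2) ×ℂ Icc (-3 : ℝ) 3) := by
    rintro s ⟨⟨h1, h2⟩, -⟩
    have h3 : 1 ≤ s.re := h1
    have := (D.analyticAt_logDeriv_H (by linarith) (D.H_ne_zero h3)).iterated_deriv 2
    rw [← iteratedDeriv_eq_iterate] at this
    exact this.continuousAt.continuousWithinAt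
  obtain ⟨K, hK⟩ := (isCompact_Icc.reProdIm isCompact_Icc).exists_bound_of_continuousOn hcont
  set C' := 16 * C / κ ^ 2 with hC'
  refine ⟨max C' K, lt_max_of_lt_left (by positivity), fun s h1 h2 => ?_⟩
  have hpos : (1 : ℝ) ≤ (1 + |s.im|) ^ (1 / 2 : ℝ) :=
    Real.one_le_rpow (by linarith [abs_nonneg s.im]) (by norm_num)
  rcases le_total |s.im| 3 with ht | ht
  · have e1 := hK s ⟨⟨h1, h2⟩, abs_le.1 ht⟩
    calc _ ≤ K := e1
      _ ≤ max C' K := le_max_right _ _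
      _ ≤ _ := le_mul_of_one_le_right (le_trans (by positivity : 0 ≤ C') (le_max_left _ _)) hpos
  set t := |s.im| with htd
  have ht0 : 0 < 2 * t := by linarith
  have hp0 : 0 < (2 * t) ^ (-(5 * (1 / 30 : ℝ))) := by positivity
  have hp1 : (2 * t) ^ (-(5 * (1 / 30 : ℝ))) ≤ 1 :=
    Real.rpow_le_one_of_one_le_of_nonpos (by linarith) (by norm_num)
  set r := κ * (2 * t) ^ (-(5 * (1 / 30 : ℝ))) / 2 with hr
  have hr0 : 0 < r := by positivity
  have hr1 : r ≤ 1 / 2 := by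
    have : κ * (2 * t) ^ (-(5 * (1 / 30 : ℝ))) ≤ 1 * 1 := by gcongr
    linarith
  have hrκ : 2 * r ≤ κ := by
    have := mul_le_mul_of_nonneg_left hp1 hκ.le
    linarith
  have hpt : ∀ z ∈ Metric.closedBall s r, 1 - r ≤ z.re ∧ z.re ≤ 2 ∧ 2 ≤ |z.im| ∧
      |z.im| ≤ 2 * t := by
    intro z hz
    rw [Metric.mem_closedBall, dist_eq] at hz
    have e1 := abs_le.1 ((abs_re_le_norm (z - s)).trans hz)
    have e2 := (abs_im_le_norm (z - s)).trans hz
    rw [sub_re] at e1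
    rw [sub_im] at e2
    have e3 := abs_sub_abs_le_abs_sub z.im s.im
    have e4 := abs_sub_abs_le_abs_sub s.im z.im
    rw [abs_sub_comm] at e4
    refine ⟨by linarith, by linarith, by linarith, by linarith⟩
  have hreg : ∀ z ∈ Metric.closedBall s r,
      D.H z ≠ 0 ∧ ‖logDeriv D.H z‖ ≤ C * (2 * t) ^ (5 * (1 / 30 : ℝ)) := by
    intro z hz
    obtain ⟨p1, p2, p3, p4⟩ := hpt z hz
    have p5 : 0 < |z.im| := by linarith
    have e1 : (2 * t) ^ (-(5 * (1 / 30 : ℝ))) ≤ |z.im| ^ (-(5 * (1 / 30 : ℝ))) :=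
      Real.rpow_le_rpow_of_nonpos p5 p4 (by norm_num)
    have e2 := mul_le_mul_of_nonneg_left e1 hκ.le
    obtain ⟨q1, q2⟩ := h z p3 (by linarith) p2
    refine ⟨q1, q2.trans ?_⟩
    gcongr
  have hdiff : DifferentiableOn ℂ (logDeriv D.H) (Metric.closedBall s r) := fun z hz =>
    (D.analyticAt_logDeriv_H (by linarith [(hpt z hz).1])
      (hreg z hz).1).differentiableAt.differentiableWithinAt
  have hmain := norm_iteratedDeriv_le_of_forall_mem_sphere_norm_le 2 hr0
    (hdiff.mono (Metric.closure_ball_subset_closedBall)).diffContOnCl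
    (fun z hz => (hreg z (Metric.sphere_subset_closedBall hz)).2)
  have e1 : (Nat.factorial 2 : ℝ) * (C * (2 * t) ^ (5 * (1 / 30 : ℝ))) / r ^ 2 =
      8 * C / κ ^ 2 * (2 * t) ^ (1 / 2 : ℝ) := by
    have : (2 * t) ^ (1 / 2 : ℝ) =
        (2 * t) ^ (5 * (1 / 30 : ℝ)) * (((2 * t) ^ (-(5 * (1 / 30 : ℝ)))) ^ 2)⁻¹ := by
      rw [← Real.rpow_natCast, ← Real.rpow_mul ht0.le, ← Real.rpow_neg ht0.le,
        ← Real.rpow_add ht0]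
      norm_num
    rw [this, hr]
    have : (Nat.factorial 2 : ℝ) = 2 := by norm_num
    rw [this]
    field_simp
    norm_num
  have e2 : (2 * t) ^ (1 / 2 : ℝ) ≤ 2 * (1 + t) ^ (1 / 2 : ℝ) := by
    calc (2 * t) ^ (1 / 2 : ℝ) = 2 ^ (1 / 2 : ℝ) * t ^ (1 / 2 : ℝ) :=
          Real.mul_rpow (by norm_num) (by linarith)
      _ ≤ 2 ^ (1 : ℝ) * (1 + t) ^ (1 / 2 : ℝ) := by
          gcongr
          · norm_num
          · norm_num
          · linarith
      _ = _ := by rw [Real.rpow_one]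
  calc _ ≤ _ := hmain
    _ = _ := e1
    _ ≤ 8 * C / κ ^ 2 * (2 * (1 + t) ^ (1 / 2 : ℝ)) := by gcongr
    _ = C' * (1 + t) ^ (1 / 2 : ℝ) := by rw [hC']; ring
    _ ≤ _ := by
        gcongr
        exact le_max_left _ _

end PrimeSystem

end SecondDerivative
end PrimeIdealCount

namespace PrimeIdealCount

section LogCubeSeries

open MeasureTheory Set Complex

namespace PrimeSystem

variable (D : PrimeSystem)

/-- The contribution of proper prime powers to the logarithm of the Euler product. -/
noncomputable def R (s : ℂ) : ℂ :=
  ∑' n : ℕ, (D.c n : ℂ) * (-log (1 - (n : ℂ) ^ (-s)) - (n : ℂ) ^ (-s))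

theorem norm_natCast_cpow_neg_eq {n : ℕ} (hn : 2 ≤ n) (s : ℂ) :
    ‖(n : ℂ) ^ (-s)‖ = (n : ℝ) ^ (-s.re) := by
  rw [← ofReal_natCast, norm_cpow_eq_rpow_re_of_pos (by positivity), neg_re]

theorem norm_natCast_cpow_neg_le {n : ℕ} (hn : 2 ≤ n) {s : ℂ} (hs : 3 / 4 < s.re) :
    ‖(n : ℂ) ^ (-s)‖ ≤ 3 / 4 := by
  have h2 : (2 : ℝ) ≤ n := by exact_mod_cast hn
  rw [norm_natCast_cpow_neg_eq hn]
  have e1 : (n : ℝ) ^ (-s.re) ≤ (2 : ℝ) ^ (-(1 / 2) : ℝ) :=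
    calc (n : ℝ) ^ (-s.re) ≤ (n : ℝ) ^ (-(1 / 2) : ℝ) :=
          Real.rpow_le_rpow_of_exponent_le (by linarith) (by linarith)
      _ ≤ _ := Real.rpow_le_rpow_of_nonpos (by norm_num) h2 (by norm_num)
  refine e1.trans ?_
  rw [Real.rpow_neg (by norm_num), ← Real.sqrt_eq_rpow, inv_le_comm₀ (by positivity) (by norm_num)]
  exact Real.le_sqrt_of_sq_le (by norm_num)

theorem norm_R_term_le (n : ℕ) {s : ℂ} (hs : 3 / 4 < s.re) :
    ‖(D.c n : ℂ) * (-log (1 - (n : ℂ) ^ (-s)) - (n : ℂ) ^ (-s))‖ ≤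
      2 * (D.a n * (n : ℝ) ^ (-(3 / 2) : ℝ)) := by
  by_cases hc : D.c n = 0
  · rw [hc]
    have := D.a_nonneg n
    simp only [ofReal_zero, zero_mul, norm_zero]
    positivity
  have hn := D.two_le_of_c_ne_zero hc
  have h2 : (2 : ℝ) ≤ n := by exact_mod_cast hn
  set w := (n : ℂ) ^ (-s) with hw
  have h1 : ‖w‖ ≤ 3 / 4 := norm_natCast_cpow_neg_le hn hs
  have h3 := norm_log_one_add_sub_self_le (z := -w) (by rw [norm_neg]; linarith)
  rw [norm_neg] at h3
  have h4 : ‖-log (1 - w) - w‖ ≤ 2 * ‖w‖ ^ 2 := by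
    have e : -log (1 - w) - w = -(log (1 + -w) - -w) := by
      rw [sub_eq_add_neg 1 w]
      ring
    rw [e, norm_neg]
    refine h3.trans ?_
    have : (1 - ‖w‖)⁻¹ ≤ 4 := by
      rw [inv_le_comm₀ (by linarith) (by norm_num)]
      linarith
    nlinarith [sq_nonneg ‖w‖]
  have h5 : ‖w‖ ^ 2 ≤ (n : ℝ) ^ (-(3 / 2) : ℝ) := by
    rw [hw, norm_natCast_cpow_neg_eq hn, ← Real.rpow_natCast, ← Real.rpow_mul (by positivity)]
    refine Real.rpow_le_rpow_of_exponent_le (by linarith) ?_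
    push_cast
    linarith
  rw [norm_mul, norm_real, Real.norm_of_nonneg (D.c_nonneg n)]
  calc D.c n * ‖-log (1 - w) - w‖ ≤ D.a n * (2 * (n : ℝ) ^ (-(3 / 2) : ℝ)) :=
        mul_le_mul (D.c_le n) (h4.trans (by linarith)) (norm_nonneg _) (D.a_nonneg n)
    _ = _ := by ring

theorem summable_R_bound : Summable fun n : ℕ => 2 * (D.a n * (n : ℝ) ^ (-(3 / 2) : ℝ)) :=
  (D.summable_a_rpow (by norm_num)).mul_left 2

theorem differentiableOn_R : DifferentiableOn ℂ D.R {s : ℂ | 3 / 4 < s.re} := by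
  refine differentiableOn_tsum_of_summable_norm D.summable_R_bound (fun n s hs => ?_)
    (isOpen_lt continuous_const continuous_re) (fun n s hs => D.norm_R_term_le n hs)
  by_cases hc : D.c n = 0
  · simp only [hc, ofReal_zero, zero_mul]
    exact differentiableWithinAt_const 0
  have hn := D.two_le_of_c_ne_zero hc
  have hn0 : (n : ℂ) ≠ 0 := by
    have : n ≠ 0 := by lia
    exact_mod_cast this
  have hslit : 1 - (n : ℂ) ^ (-s) ∈ slitPlane := by
    have h1 : ‖-(n : ℂ) ^ (-s)‖ < 1 := by
      rw [norm_neg]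
      exact (norm_natCast_cpow_neg_le hn hs).trans_lt (by norm_num)
    simpa [sub_eq_add_neg] using mem_slitPlane_of_norm_lt_one h1
  have hd : DifferentiableAt ℂ (fun s : ℂ => (n : ℂ) ^ (-s)) s :=
    differentiableAt_neg_iff.2 differentiableAt_id |>.const_cpow (Or.inl hn0)
  exact ((((hd.const_sub 1).clog hslit).neg.sub hd).const_mul _).differentiableWithinAt

theorem norm_R_le {s : ℂ} (hs : 3 / 4 < s.re) :
    ‖D.R s‖ ≤ ∑' n : ℕ, 2 * (D.a n * (n : ℝ) ^ (-(3 / 2) : ℝ)) :=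
  tsum_of_norm_bounded D.summable_R_bound.hasSum fun n => D.norm_R_term_le n hs

theorem exists_norm_iteratedDeriv_R_le :
    ∃ K : ℝ, 0 ≤ K ∧ ∀ s : ℂ, 1 ≤ s.re → ‖iteratedDeriv 3 D.R s‖ ≤ K := by
  set B := ∑' n : ℕ, 2 * (D.a n * (n : ℝ) ^ (-(3 / 2) : ℝ)) with hB
  have hB0 : 0 ≤ B := tsum_nonneg fun n => by
    have := D.a_nonneg n
    positivity
  refine ⟨Nat.factorial 3 * B / (1 / 8) ^ 3, by positivity, fun s hs => ?_⟩
  have hpt : ∀ z ∈ Metric.closedBall s (1 / 8), 3 / 4 < z.re := by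
    intro z hz
    rw [Metric.mem_closedBall, dist_eq] at hz
    have e1 := abs_le.1 ((abs_re_le_norm (z - s)).trans hz)
    rw [sub_re] at e1
    linarith
  have hd : DifferentiableOn ℂ D.R (closure (Metric.ball s (1 / 8))) :=
    D.differentiableOn_R.mono fun z hz => hpt z (Metric.closure_ball_subset_closedBall hz)
  exact norm_iteratedDeriv_le_of_forall_mem_sphere_norm_le 3 (by norm_num) hd.diffContOnCl
    fun z hz => D.norm_R_le (hpt z (Metric.sphere_subset_closedBall hz))

theorem LSeriesSummable_c {s : ℂ} (hs : 1 < s.re) : LSeriesSummable (fun n => (D.c n : ℂ)) s := by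
  refine Summable.of_norm_bounded (D.LSeriesSummable_a hs).norm fun n => ?_
  refine LSeries.norm_term_le s ?_
  rw [norm_real, norm_real, Real.norm_of_nonneg (D.c_nonneg n), Real.norm_of_nonneg (D.a_nonneg n)]
  exact D.c_le n

theorem abscissa_c_lt {s : ℂ} (hs : 1 < s.re) :
    LSeries.abscissaOfAbsConv (fun n => (D.c n : ℂ)) < s.re := by
  have h := (D.LSeriesSummable_c (s := ((1 + s.re) / 2 : ℝ)) (by
    rw [ofReal_re]; linarith)).abscissaOfAbsConv_le
  refine h.trans_lt ?_
  rw [ofReal_re]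
  exact_mod_cast (by linarith : (1 + s.re) / 2 < s.re)

theorem logDeriv_F_eq {s : ℂ} (hs : 1 < s.re) :
    logDeriv D.F s = deriv (LSeries fun n => (D.c n : ℂ)) s + deriv D.R s := by
  have hd1 : DifferentiableAt ℂ (LSeries fun n => (D.c n : ℂ)) s :=
    (LSeries_hasDerivAt (D.abscissa_c_lt hs)).differentiableAt
  have hd2 : DifferentiableAt ℂ D.R s := D.differentiableOn_R.differentiableAt
    ((isOpen_lt continuous_const continuous_re).mem_nhds (by
      show 3 / 4 < s.re
      linarith))
  have he : D.F =ᶠ[nhds s] fun z => exp ((LSeries fun n => (D.c n : ℂ)) z + D.R z) := by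
    filter_upwards [(isOpen_lt continuous_const continuous_re).mem_nhds hs] with z hz
    have hz' : 1 < z.re := hz
    rw [D.F_eq_exp hz']
    congr 1
    have h1 := D.LSeriesSummable_c hz'
    have h2 : Summable fun n : ℕ => (D.c n : ℂ) * (-log (1 - (n : ℂ) ^ (-z)) - (n : ℂ) ^ (-z)) :=
      Summable.of_norm_bounded D.summable_R_bound fun n => D.norm_R_term_le n (by linarith)
    rw [LSeries, R, ← Summable.tsum_add h1 h2]
    refine tsum_congr fun n => ?_
    rcases Nat.eq_zero_or_pos n with rfl | hn
    · simp [D.c_zero]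
    · rw [LSeries.term_of_ne_zero hn.ne', cpow_neg]
      ring
  rw [logDeriv_apply, he.deriv_eq, he.eq_of_nhds]
  have := ((hd1.hasDerivAt.add hd2.hasDerivAt).cexp).deriv
  simp only [Pi.add_apply] at this
  rw [this]
  field_simp

theorem iteratedDeriv_three_LSeries_c {s : ℂ} (hs : 1 < s.re) :
    iteratedDeriv 3 (LSeries fun n => (D.c n : ℂ)) s =
      iteratedDeriv 2 (logDeriv D.H) s - 2 / (s - 1) ^ 3 - iteratedDeriv 3 D.R s := by
  have hδ := D.δ_pos
  have hs1 : s ≠ 1 := by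
    rintro rfl
    simp at hs
  have hR : AnalyticAt ℂ D.R s := D.differentiableOn_R.analyticAt
    ((isOpen_lt continuous_const continuous_re).mem_nhds (by
      show 3 / 4 < s.re
      linarith))
  have hH := D.analyticAt_logDeriv_H (s := s) (by linarith) (D.H_ne_zero hs.le)
  have hinv : AnalyticAt ℂ (fun z : ℂ => (1 * z - 1)⁻¹) s := by
    refine AnalyticAt.inv (by fun_prop) ?_
    rw [one_mul]
    exact sub_ne_zero.2 hs1
  have he : deriv (LSeries fun n => (D.c n : ℂ)) =ᶠ[nhds s]
      (logDeriv D.H - fun z : ℂ => (1 * z - 1)⁻¹) - deriv D.R := by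
    filter_upwards [(isOpen_lt continuous_const continuous_re).mem_nhds hs] with z hz
    have hz' : 1 < z.re := hz
    have hz1 : z ≠ 1 := by
      rintro rfl
      simp at hz'
    have e1 := D.logDeriv_F_eq hz'
    have e2 := D.logDeriv_H_eq (by linarith) hz1 (D.F_ne_zero_of_one_lt hz')
    simp only [Pi.sub_apply]
    rw [e2, e1]
    ring
  rw [iteratedDeriv_succ', he.iteratedDeriv_eq,
    iteratedDeriv_sub (hH.sub hinv).contDiffAt hR.deriv.contDiffAt,
    iteratedDeriv_sub hH.contDiffAt hinv.contDiffAt, iteratedDeriv_succ' (f := D.R)]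
  congr 2
  rw [iteratedDeriv_eq_iterate, iter_deriv_inv_linear_sub]
  have : (-1 - (2 : ℕ) : ℤ) = -(3 : ℕ) := by norm_num
  simp only [this, zpow_neg, zpow_natCast]
  simp [Nat.factorial]
  ring

theorem LSeries_log_cube_eq {s : ℂ} (hs : 1 < s.re) :
    LSeries (fun n => ((D.c n * Real.log n ^ 3 : ℝ) : ℂ)) s =
      -iteratedDeriv 3 (LSeries fun n => (D.c n : ℂ)) s := by
  rw [LSeries_iteratedDeriv 3 (D.abscissa_c_lt hs)]
  have : LSeries.logMul^[3] (fun n => (D.c n : ℂ)) =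
      fun n : ℕ => ((D.c n * Real.log n ^ 3 : ℝ) : ℂ) := by
    ext n
    simp only [Function.iterate_succ, Function.iterate_zero, Function.comp_apply, id_eq,
      LSeries.logMul, ← natCast_log]
    push_cast
    ring
  rw [this]
  ring

theorem exists_norm_LSeries_log_cube_sub_le :
    ∃ C : ℝ, 0 < C ∧ ∀ s : ℂ, 1 < s.re → s.re ≤ 3 / 2 →
      ‖LSeries (fun n => ((D.c n * Real.log n ^ 3 : ℝ) : ℂ)) s - 2 / (s - 1) ^ 3‖ ≤
        C * (1 + |s.im|) ^ (1 / 2 : ℝ) := by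
  obtain ⟨C, hC, h⟩ := D.exists_norm_iteratedDeriv_logDeriv_H_le
  obtain ⟨K, hK, h'⟩ := D.exists_norm_iteratedDeriv_R_le
  refine ⟨C + K, by positivity, fun s hs hs2 => ?_⟩
  rw [D.LSeries_log_cube_eq hs, D.iteratedDeriv_three_LSeries_c hs]
  have e : -(iteratedDeriv 2 (logDeriv D.H) s - 2 / (s - 1) ^ 3 - iteratedDeriv 3 D.R s) -
      2 / (s - 1) ^ 3 = iteratedDeriv 3 D.R s - iteratedDeriv 2 (logDeriv D.H) s := by ring
  rw [e]
  have hpos : (1 : ℝ) ≤ (1 + |s.im|) ^ (1 / 2 : ℝ) :=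
    Real.one_le_rpow (by linarith [abs_nonneg s.im]) (by norm_num)
  calc _ ≤ ‖iteratedDeriv 3 D.R s‖ + ‖iteratedDeriv 2 (logDeriv D.H) s‖ := norm_sub_le _ _
    _ ≤ K * (1 + |s.im|) ^ (1 / 2 : ℝ) + C * (1 + |s.im|) ^ (1 / 2 : ℝ) := by
        refine add_le_add ((h' s hs.le).trans (le_mul_of_one_le_right hK hpos)) (h s hs.le hs2)
    _ = _ := by ring

theorem LSeriesSummable_log_cube {s : ℂ} (hs : 1 < s.re) :
    LSeriesSummable (fun n => ((D.c n * Real.log n ^ 3 : ℝ) : ℂ)) s := by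
  have : LSeries.logMul^[3] (fun n => (D.c n : ℂ)) =
      fun n : ℕ => ((D.c n * Real.log n ^ 3 : ℝ) : ℂ) := by
    ext n
    simp only [Function.iterate_succ, Function.iterate_zero, Function.comp_apply, id_eq,
      LSeries.logMul, ← natCast_log]
    push_cast
    ring
  rw [← this]
  refine LSeriesSummable_of_abscissaOfAbsConv_lt_re ?_
  rw [LSeries.absicssaOfAbsConv_logPowMul]
  exact D.abscissa_c_lt hs

end PrimeSystem

end LogCubeSeries
end PrimeIdealCount

namespace PrimeIdealCount

section MellinByParts

open MeasureTheory Set Complex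

theorem integrableOn_mul_cpow {f : ℝ → ℝ} (hfm : AEStronglyMeasurable f (volume.restrict (Ioi 1)))
    {K α : ℝ} (hf : ∀ u : ℝ, 1 < u → |f u| ≤ K * u ^ α) {w : ℂ} (hw : α + w.re < -1) :
    IntegrableOn (fun u : ℝ => (f u : ℂ) * (u : ℂ) ^ w) (Ioi 1) := by
  have h1 : IntegrableOn (fun u : ℝ => K * u ^ (α + w.re)) (Ioi 1) :=
    (integrableOn_Ioi_rpow_of_lt hw one_pos).const_mul _
  refine Integrable.mono' h1 ((continuous_ofReal.comp_aestronglyMeasurable hfm).mul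
    (measurable_ofReal.pow_const w).aestronglyMeasurable) ?_
  refine (ae_restrict_iff' measurableSet_Ioi).2 (Eventually.of_forall fun u hu => ?_)
  have hu0 : 0 < u := one_pos.trans hu
  rw [norm_mul, norm_real, Real.norm_eq_abs, norm_cpow_eq_rpow_re_of_pos hu0, Real.rpow_add hu0,
    ← mul_assoc]
  gcongr
  exact hf u hu

/-- Integration by parts for Mellin-type integrals. -/
theorem mul_integral_cpow_eq {F f : ℝ → ℝ} (hcont : ContinuousOn F (Ici 1)) (hF1 : F 1 = 0)
    (hderiv : ∀ u : ℝ, 1 < u → HasDerivWithinAt F (f u) (Ioi u) u)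
    (hfm : AEStronglyMeasurable f (volume.restrict (Ioi 1))) {K K' α β : ℝ}
    (hf : ∀ u : ℝ, 1 < u → |f u| ≤ K * u ^ α) (hF : ∀ u : ℝ, 1 < u → |F u| ≤ K' * u ^ β)
    {z : ℂ} (hα : α + 1 < z.re) (hβ : β < z.re) :
    z * ∫ u in Ioi (1 : ℝ), (F u : ℂ) * (u : ℂ) ^ (-z - 1) =
      ∫ u in Ioi (1 : ℝ), (f u : ℂ) * (u : ℂ) ^ (-z) := by
  have hFm : AEStronglyMeasurable F (volume.restrict (Ioi 1)) :=
    (hcont.mono Ioi_subset_Ici_self).aestronglyMeasurable measurableSet_Ioi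
  have hi1 : IntegrableOn (fun u : ℝ => (f u : ℂ) * (u : ℂ) ^ (-z)) (Ioi 1) :=
    integrableOn_mul_cpow hfm hf (by rw [neg_re]; linarith)
  have hi2 : IntegrableOn (fun u : ℝ => (F u : ℂ) * (u : ℂ) ^ (-z - 1)) (Ioi 1) :=
    integrableOn_mul_cpow hFm hF (by rw [sub_re, neg_re, one_re]; linarith)
  have hi : IntegrableOn (fun u : ℝ => (f u : ℂ) * (u : ℂ) ^ (-z) +
      (F u : ℂ) * (-z * (u : ℂ) ^ (-z - 1))) (Ioi 1) := by
    refine hi1.add ((hi2.const_mul (-z)).congr ?_)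
    exact Eventually.of_forall fun u => by
      simp only
      ring
  have hlim := intervalIntegral_tendsto_integral_Ioi 1 hi tendsto_id
  have hval : ∀ T : ℝ, 1 ≤ T → ∫ u in (1 : ℝ)..T, ((f u : ℂ) * (u : ℂ) ^ (-z) +
      (F u : ℂ) * (-z * (u : ℂ) ^ (-z - 1))) = (F T : ℂ) * (T : ℂ) ^ (-z) := by
    intro T hT
    have := intervalIntegral.integral_eq_sub_of_hasDeriv_right
      (f := fun u : ℝ => (F u : ℂ) * (u : ℂ) ^ (-z)) (a := 1) (b := T)
      (f' := fun u : ℝ => (f u : ℂ) * (u : ℂ) ^ (-z) + (F u : ℂ) * (-z * (u : ℂ) ^ (-z - 1)))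
      ?_ ?_ ?_
    · rw [this, hF1]
      simp
    · rw [uIcc_of_le hT]
      refine (continuous_ofReal.comp_continuousOn (hcont.mono Icc_subset_Ici_self)).mul ?_
      exact fun t ht => (continuousAt_ofReal_cpow_const _ _
        (Or.inr (by linarith [ht.1]))).continuousWithinAt
    · rw [min_eq_left hT, max_eq_right hT]
      intro u hu
      have hu0 : u ≠ 0 := by linarith [hu.1]
      have hz : -z ≠ 0 ∨ True := Or.inr trivial
      have e1 : HasDerivAt (fun x : ℝ => (x : ℂ) ^ (-z)) (-z * (u : ℂ) ^ (-z - 1)) u := by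
        have := (hasDerivAt_id (u : ℂ)).cpow_const (c := -z)
          (Or.inl (by simpa using one_pos.trans hu.1))
        simpa using this.comp_ofReal
      exact (hderiv u hu.1).ofReal_comp.mul e1.hasDerivWithinAt
    · rw [intervalIntegrable_iff_integrableOn_Ioc_of_le hT]
      exact hi.mono_set Ioc_subset_Ioi_self
  have hzero : Tendsto (fun T : ℝ => (F T : ℂ) * (T : ℂ) ^ (-z)) atTop (nhds 0) := by
    have h0 : Tendsto (fun T : ℝ => K' * T ^ (-(z.re - β))) atTop (nhds 0) := by
      simpa using (tendsto_rpow_neg_atTop (by linarith : 0 < z.re - β)).const_mul K'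
    refine squeeze_zero_norm' ?_ h0
    filter_upwards [eventually_gt_atTop 1] with T hT
    have hT0 : 0 < T := by linarith
    rw [norm_mul, norm_real, Real.norm_eq_abs, norm_cpow_eq_rpow_re_of_pos hT0,
      show -(z.re - β) = β + (-z).re by rw [neg_re]; ring, Real.rpow_add hT0, ← mul_assoc]
    gcongr
    exact hF T hT
  have hkey := tendsto_nhds_unique hlim (hzero.congr' (by
    filter_upwards [eventually_ge_atTop 1] with T hT
    exact (hval T hT).symm))
  rw [integral_add hi1 ((hi2.const_mul (-z)).congr (Eventually.of_forall fun u => by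
      simp only
      ring))] at hkey
  have e : ∫ u in Ioi (1 : ℝ), (F u : ℂ) * (-z * (u : ℂ) ^ (-z - 1)) =
      -z * ∫ u in Ioi (1 : ℝ), (F u : ℂ) * (u : ℂ) ^ (-z - 1) := by
    rw [← integral_const_mul]
    congr 1
    ext u
    ring
  rw [e] at hkey
  linear_combination -hkey

theorem log_pow_le_mul_rpow (k : ℕ) {ε : ℝ} (hε : 0 < ε) {u : ℝ} (hu : 1 ≤ u) :
    |Real.log u ^ k| ≤ (k / ε) ^ k * u ^ ε := by
  rcases Nat.eq_zero_or_pos k with rfl | hk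
  · simpa using Real.one_le_rpow hu hε.le
  have hk' : (0 : ℝ) < k := by exact_mod_cast hk
  have h := Real.log_le_rpow_div (by linarith : (0 : ℝ) ≤ u) (div_pos hε hk')
  have hl := Real.log_nonneg hu
  rw [abs_of_nonneg (pow_nonneg hl k)]
  calc Real.log u ^ k ≤ (u ^ (ε / k) / (ε / k)) ^ k := by gcongr
    _ = (k / ε) ^ k * (u ^ (ε / k)) ^ k := by
        rw [← mul_pow]
        congr 1
        field_simp
    _ = _ := by
        rw [← Real.rpow_natCast (u ^ _), ← Real.rpow_mul (by linarith)]
        congr 2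
        field_simp

theorem integral_log_pow_succ_mul_cpow (k : ℕ) {z : ℂ} (hz : 0 < z.re) :
    z * ∫ u in Ioi (1 : ℝ), ((Real.log u ^ (k + 1) : ℝ) : ℂ) * (u : ℂ) ^ (-z - 1) =
      (k + 1) * ∫ u in Ioi (1 : ℝ), ((Real.log u ^ k : ℝ) : ℂ) * (u : ℂ) ^ (-z - 1) := by
  have hcl : ∀ k : ℕ, ContinuousOn (fun u : ℝ => Real.log u ^ k) (Ici 1) := fun k =>
    (Real.continuousOn_log.mono fun u hu => by
      have : (1 : ℝ) ≤ u := hu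
      simp
      linarith).pow k
  have hε : 0 < z.re / 2 := by linarith
  have key := mul_integral_cpow_eq (F := fun u => Real.log u ^ (k + 1))
    (f := fun u => (k + 1) * Real.log u ^ k / u) (α := z.re / 2 - 1) (β := z.re / 2) (z := z)
    (K := (k + 1) * (k / (z.re / 2)) ^ k) (hcl (k + 1)) (by simp) (fun u hu => ?_) ?_
    (fun u hu => ?_) (fun u hu => log_pow_le_mul_rpow (k + 1) hε hu.le) (by linarith) (by linarith)
  · rw [key, ← integral_const_mul]
    refine setIntegral_congr_fun measurableSet_Ioi fun u hu => ?_
    have hu0 : (u : ℂ) ≠ 0 := by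
      have : (1 : ℝ) < u := hu
      exact_mod_cast (by linarith : u ≠ 0)
    rw [cpow_sub _ _ hu0, cpow_one]
    push_cast
    field_simp
  · have hu0 : u ≠ 0 := by linarith
    have := ((Real.hasDerivAt_log hu0).pow (k + 1)).hasDerivWithinAt (s := Ioi u)
    simp only [Nat.cast_add, Nat.cast_one, Nat.add_sub_cancel] at this
    exact this
  · refine ContinuousOn.aestronglyMeasurable ?_ measurableSet_Ioi
    refine ContinuousOn.div (continuousOn_const.mul ((hcl k).mono Ioi_subset_Ici_self))
      continuousOn_id fun u hu => ?_
    have : (1 : ℝ) < u := hu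
    exact (one_pos.trans this).ne'
  · have hu0 : 0 < u := by linarith
    have := log_pow_le_mul_rpow k hε hu.le
    rw [abs_div, abs_mul, abs_of_nonneg (by positivity : (0 : ℝ) ≤ (k : ℝ) + 1), abs_of_pos hu0,
      div_le_iff₀ hu0, Real.rpow_sub hu0, Real.rpow_one]
    calc ((k : ℝ) + 1) * |Real.log u ^ k| ≤ (k + 1) * ((k / (z.re / 2)) ^ k * u ^ (z.re / 2)) := by
          gcongr
      _ = _ := by field_simp

theorem integral_log_sq_mul_cpow {s : ℂ} (hs : 1 < s.re) :
    ∫ u in Ioi (1 : ℝ), ((Real.log u ^ 2 : ℝ) : ℂ) * (u : ℂ) ^ (-s) = 2 / (s - 1) ^ 3 := by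
  have hz : 0 < (s - 1).re := by simpa using hs
  have hne : s - 1 ≠ 0 := by
    intro h
    rw [h] at hz
    simp at hz
  have h0 : ∫ u in Ioi (1 : ℝ), ((Real.log u ^ 0 : ℝ) : ℂ) * (u : ℂ) ^ (-(s - 1) - 1) =
      1 / (s - 1) := by
    simp only [pow_zero, ofReal_one, one_mul]
    rw [integral_Ioi_cpow_of_lt (by simp; linarith) one_pos]
    have : -(s - 1) - 1 + 1 = -(s - 1) := by ring
    rw [this, ofReal_one, one_cpow, neg_div_neg_eq]
  have h1 := integral_log_pow_succ_mul_cpow 0 hz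
  have h2 := integral_log_pow_succ_mul_cpow 1 hz
  rw [h0] at h1
  simp only [zero_add, one_add_one_eq_two] at h1 h2
  have e : -(s - 1) - 1 = -s := by ring
  rw [e] at h1 h2
  rw [eq_div_iff (pow_ne_zero 3 hne)]
  push_cast at h1 h2 ⊢
  field_simp at h1
  simp only [pow_one] at h2
  linear_combination (s - 1) ^ 2 * h2 + 2 * h1

/-- The main term, a primitive of `log ^ 2`. -/
noncomputable def mainTerm (u : ℝ) : ℝ := u * Real.log u ^ 2 - 2 * u * Real.log u + 2 * u - 2

theorem hasDerivAt_mainTerm {u : ℝ} (hu : 0 < u) :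
    HasDerivAt mainTerm (Real.log u ^ 2) u := by
  have h1 := Real.hasDerivAt_log hu.ne'
  have h := ((((hasDerivAt_id u).mul (h1.pow 2)).sub
    (((hasDerivAt_id u).const_mul 2).mul h1)).add ((hasDerivAt_id u).const_mul 2)).sub_const 2
  refine h.congr_deriv ?_
  simp
  field_simp
  ring

theorem continuousOn_mainTerm : ContinuousOn mainTerm (Ici 1) := fun u hu =>
  (hasDerivAt_mainTerm (one_pos.trans_le hu)).continuousAt.continuousWithinAt

theorem mainTerm_one : mainTerm 1 = 0 := by simp [mainTerm]

theorem monotoneOn_mainTerm : MonotoneOn mainTerm (Ici 1) := by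
  refine monotoneOn_of_deriv_nonneg (convex_Ici 1) continuousOn_mainTerm ?_ ?_
  all_goals
    intro u hu
    rw [interior_Ici] at hu
    have hu0 : (0 : ℝ) < u := one_pos.trans hu
  · exact (hasDerivAt_mainTerm hu0).differentiableAt.differentiableWithinAt
  · rw [(hasDerivAt_mainTerm hu0).deriv]
    positivity

theorem mainTerm_sub_le {u v : ℝ} (hu : 1 ≤ u) (huv : u ≤ v) :
    mainTerm v - mainTerm u ≤ Real.log v ^ 2 * (v - u) := by
  refine (convex_Icc u v).image_sub_le_mul_sub_of_deriv_le
    (continuousOn_mainTerm.mono fun x hx => hu.trans hx.1) ?_ ?_ u (left_mem_Icc.2 huv) v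
    (right_mem_Icc.2 huv) huv
  all_goals
    intro x hx
    rw [interior_Icc] at hx
    have hx0 : (0 : ℝ) < x := by linarith [hx.1]
  · exact (hasDerivAt_mainTerm hx0).differentiableAt.differentiableWithinAt
  · rw [(hasDerivAt_mainTerm hx0).deriv]
    have h1 : 0 ≤ Real.log x := Real.log_nonneg (by linarith [hx.1])
    have h2 : Real.log x ≤ Real.log v := Real.log_le_log hx0 hx.2.le
    gcongr

theorem mainTerm_nonneg {u : ℝ} (hu : 1 ≤ u) : 0 ≤ mainTerm u := by
  rw [← mainTerm_one]
  exact monotoneOn_mainTerm self_mem_Ici hu hu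

theorem mainTerm_le {u : ℝ} (hu : 1 ≤ u) {ε : ℝ} (hε : 0 < ε) :
    |mainTerm u| ≤ (2 / ε) ^ 2 * u ^ (1 + ε) := by
  rw [abs_of_nonneg (mainTerm_nonneg hu)]
  have h := mainTerm_sub_le le_rfl hu
  rw [mainTerm_one, sub_zero] at h
  have h2 := log_pow_le_mul_rpow 2 hε hu
  rw [abs_of_nonneg (sq_nonneg _)] at h2
  rw [Real.rpow_add (by linarith), Real.rpow_one]
  calc mainTerm u ≤ Real.log u ^ 2 * (u - 1) := h
    _ ≤ Real.log u ^ 2 * u := by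
        gcongr
        linarith
    _ ≤ ((2 : ℕ) / ε) ^ 2 * u ^ ε * u := by gcongr
    _ = _ := by push_cast; ring

theorem mul_integral_mainTerm {s : ℂ} (hs : 1 < s.re) :
    s * ∫ u in Ioi (1 : ℝ), (mainTerm u : ℂ) * (u : ℂ) ^ (-s - 1) = 2 / (s - 1) ^ 3 := by
  have hε : 0 < (s.re - 1) / 2 := by linarith
  rw [← integral_log_sq_mul_cpow hs]
  refine mul_integral_cpow_eq (f := fun u => Real.log u ^ 2) (α := (s.re - 1) / 2)
    (β := 1 + (s.re - 1) / 2)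
    continuousOn_mainTerm mainTerm_one (fun u hu =>
      (hasDerivAt_mainTerm (one_pos.trans hu)).hasDerivWithinAt) ?_
    (fun u hu => log_pow_le_mul_rpow 2 hε hu.le) (fun u hu => mainTerm_le hu.le hε)
    (by linarith) (by linarith)
  exact (Real.measurable_log.pow_const 2).aestronglyMeasurable

end MellinByParts
end PrimeIdealCount

namespace PrimeIdealCount

section Tauberian

open MeasureTheory Set Complex

/-- The summatory function of `b`. -/
noncomputable def summatory (b : ℕ → ℝ) (u : ℝ) : ℝ := ∑ n ∈ Finset.Icc 0 ⌊u⌋₊, b n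

theorem measurable_summatory (b : ℕ → ℝ) : Measurable (summatory b) :=
  (measurable_from_top (f := fun m : ℕ => ∑ n ∈ Finset.Icc 0 m, b n)).comp Nat.measurable_floor

theorem summatory_nonneg {b : ℕ → ℝ} (hb : ∀ n, 0 ≤ b n) (u : ℝ) : 0 ≤ summatory b u :=
  Finset.sum_nonneg fun n _ => hb n

theorem monotone_summatory {b : ℕ → ℝ} (hb : ∀ n, 0 ≤ b n) : Monotone (summatory b) := by
  intro u v huv
  exact Finset.sum_le_sum_of_subset_of_nonneg
    (Finset.Icc_subset_Icc_right (Nat.floor_mono huv)) fun n _ _ => hb n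

theorem continuousWithinAt_summatory (b : ℕ → ℝ) {u : ℝ} (hu : 0 ≤ u) :
    ContinuousWithinAt (summatory b) (Ioi u) u := by
  have h : ∀ᶠ v in nhdsWithin u (Ioi u), summatory b v = summatory b u := by
    have h1 : ∀ᶠ v : ℝ in nhdsWithin u (Ioi u), v < (⌊u⌋₊ : ℝ) + 1 :=
      nhdsWithin_le_nhds (Iio_mem_nhds (Nat.lt_floor_add_one u))
    filter_upwards [h1, self_mem_nhdsWithin] with v hv hv'
    have hv0 : u < v := hv'
    have : ⌊v⌋₊ = ⌊u⌋₊ := by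
      rw [Nat.floor_eq_iff (by linarith)]
      exact ⟨(Nat.floor_le hu).trans hv0.le, hv⟩
    rw [summatory, summatory, this]
  exact tendsto_const_nhds.congr' (h.mono fun _ h => h.symm)

variable {b : ℕ → ℝ} (hb0 : b 0 = 0) (hb : ∀ n, 0 ≤ b n)
  (hsum : ∀ s : ℂ, 1 < s.re → LSeriesSummable (fun n => (b n : ℂ)) s)

include hb0 hb hsum

theorem exists_summatory_le {σ : ℝ} (hσ : 1 < σ) :
    ∃ K : ℝ, 0 ≤ K ∧ ∀ u : ℝ, 1 ≤ u → summatory b u ≤ K * u ^ σ := by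
  have h1 : Summable fun n : ℕ => b n * (n : ℝ) ^ (-σ) := by
    have := (hsum σ (by simpa using hσ)).norm
    refine this.congr fun n => ?_
    rw [LSeries.norm_term_eq]
    split_ifs with hn
    · rw [hn, hb0, zero_mul]
    · rw [norm_real, Real.norm_of_nonneg (hb n), ofReal_re, Real.rpow_neg (by positivity)]
      rfl
  refine ⟨∑' n : ℕ, b n * (n : ℝ) ^ (-σ), tsum_nonneg fun n => mul_nonneg (hb n) (by positivity),
    fun u hu => ?_⟩
  have hu0 : 0 < u := by linarith
  calc summatory b u ≤ ∑ n ∈ Finset.Icc 0 ⌊u⌋₊, b n * (n : ℝ) ^ (-σ) * u ^ σ := by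
        refine Finset.sum_le_sum fun n hn => ?_
        rcases Nat.eq_zero_or_pos n with rfl | hn0
        · simp [hb0]
        have hnu : (n : ℝ) ≤ u := (Nat.le_floor_iff hu0.le).1 (Finset.mem_Icc.1 hn).2
        have hn0' : (0 : ℝ) < n := by exact_mod_cast hn0
        rw [mul_assoc]
        refine le_mul_of_one_le_right (hb n) ?_
        calc (1 : ℝ) = (n : ℝ) ^ (-σ) * (n : ℝ) ^ σ := by
              rw [← Real.rpow_add hn0', neg_add_cancel, Real.rpow_zero]
          _ ≤ _ := by gcongr
    _ = (∑ n ∈ Finset.Icc 0 ⌊u⌋₊, b n * (n : ℝ) ^ (-σ)) * u ^ σ := by rw [Finset.sum_mul]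
    _ ≤ _ := by
        gcongr
        exact h1.sum_le_tsum _ fun n _ => mul_nonneg (hb n) (by positivity)

theorem mul_integral_summatory {s : ℂ} (hs : 1 < s.re) :
    s * ∫ u in Ioi (1 : ℝ), (summatory b u : ℂ) * (u : ℂ) ^ (-s - 1) =
      LSeries (fun n => (b n : ℂ)) s := by
  have hσ : 1 < (1 + s.re) / 2 := by linarith
  obtain ⟨K, hK, h⟩ := exists_summatory_le hb0 hb hsum hσ
  have hS : ∀ m : ℕ, ∑ k ∈ Finset.Icc 0 m, b k = ∑ k ∈ Finset.Icc 1 m, b k := fun m => by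
    rw [← Finset.insert_Icc_add_one_left_eq_Icc (Nat.zero_le _), Finset.sum_insert (by simp),
      hb0, zero_add, zero_add]
  rw [LSeries_eq_mul_integral_of_nonneg b (r := (1 + s.re) / 2) (by linarith) (by linarith) ?_ hb]
  · congr 1
    refine setIntegral_congr_fun measurableSet_Ioi fun u _ => ?_
    simp only [summatory, hS, ofReal_sum, neg_add']
  · refine Asymptotics.IsBigO.of_bound K ?_
    filter_upwards [eventually_ge_atTop 1] with n hn
    have h1 := h n (by exact_mod_cast hn)
    rw [summatory, Nat.floor_natCast, hS] at h1
    rwa [Real.norm_of_nonneg (Finset.sum_nonneg fun n _ => hb n),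
      Real.norm_of_nonneg (by positivity)]

omit hb0 hb hsum in
/-- The integrated error term. -/
noncomputable def errorPrimitive (b : ℕ → ℝ) (x : ℝ) : ℝ :=
  ∫ u in (1 : ℝ)..x, (summatory b u - mainTerm u)

omit hb0 hsum in
theorem intervalIntegrable_error {x y : ℝ} (hx : 1 ≤ x) (hy : 1 ≤ y) :
    IntervalIntegrable (fun u => summatory b u - mainTerm u) volume x y := by
  refine (monotone_summatory hb).intervalIntegrable.sub ?_
  refine (continuousOn_mainTerm.mono ?_).intervalIntegrable
  exact fun u hu => (le_min hx hy).trans hu.1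

theorem exists_abs_error_le {α : ℝ} (hα : 1 < α) :
    ∃ K : ℝ, 0 ≤ K ∧ (∀ u : ℝ, 1 ≤ u → |summatory b u - mainTerm u| ≤ K * u ^ α) ∧
      ∀ u : ℝ, 1 ≤ u → |errorPrimitive b u| ≤ K * u ^ (α + 1) := by
  obtain ⟨K, hK, h⟩ := exists_summatory_le hb0 hb hsum hα
  have h1 : ∀ u : ℝ, 1 ≤ u →
      |summatory b u - mainTerm u| ≤ (K + (2 / (α - 1)) ^ 2) * u ^ α := fun u hu => by
    have e1 := h u hu
    have e2 := mainTerm_le hu (sub_pos.2 hα)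
    rw [add_sub_cancel] at e2
    calc _ ≤ |summatory b u| + |mainTerm u| := abs_sub _ _
      _ ≤ K * u ^ α + (2 / (α - 1)) ^ 2 * u ^ α := by
          rw [abs_of_nonneg (summatory_nonneg hb u)]
          exact add_le_add e1 e2
      _ = _ := by ring
  refine ⟨K + (2 / (α - 1)) ^ 2, by positivity, h1, fun u hu => ?_⟩
  have hu0 : 0 < u := by linarith
  have := intervalIntegral.norm_integral_le_of_norm_le_const (a := 1) (b := u)
    (f := fun u => summatory b u - mainTerm u) (C := (K + (2 / (α - 1)) ^ 2) * u ^ α) (by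
      intro v hv
      rw [uIoc_of_le hu] at hv
      have hv1 : 1 ≤ v := hv.1.le
      refine (h1 v hv1).trans ?_
      gcongr
      exact hv.2)
  rw [Real.norm_eq_abs] at this
  refine this.trans ?_
  rw [Real.rpow_add hu0, Real.rpow_one, ← mul_assoc, abs_of_nonneg (by linarith)]
  gcongr
  linarith

omit hb0 hsum in
theorem continuousOn_errorPrimitive : ContinuousOn (errorPrimitive b) (Ici 1) := by
  intro u hu
  have hu1 : (1 : ℝ) ≤ u := hu
  have h := intervalIntegral.continuousOn_primitive_interval (a := 1) (b := u + 1)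
    (f := fun u => summatory b u - mainTerm u) (μ := volume) (by
      rw [uIcc_of_le (by linarith), integrableOn_Icc_iff_integrableOn_Ioc]
      exact (intervalIntegrable_iff_integrableOn_Ioc_of_le (by linarith)).1
        (intervalIntegrable_error hb le_rfl (by linarith)))
  rw [uIcc_of_le (by linarith)] at h
  have h2 := h u ⟨hu1, by linarith⟩
  refine h2.mono_of_mem_nhdsWithin ?_
  rw [mem_nhdsWithin]
  exact ⟨Iio (u + 1), isOpen_Iio, by simp, fun v hv => ⟨hv.2, (le_of_lt hv.1)⟩⟩

omit hb0 hsum in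
theorem hasDerivWithinAt_errorPrimitive {u : ℝ} (hu : 1 < u) :
    HasDerivWithinAt (errorPrimitive b) (summatory b u - mainTerm u) (Ioi u) u := by
  refine (intervalIntegral.integral_hasDerivWithinAt_right (s := Ici u) (t := Ioi u)
    (intervalIntegrable_error hb le_rfl hu.le) ?_ ?_).mono Ioi_subset_Ici_self
  · have hm : ContinuousOn mainTerm (Ioi u) :=
      continuousOn_mainTerm.mono fun v hv => hu.le.trans (le_of_lt hv)
    exact ⟨Ioi u, self_mem_nhdsWithin, ((measurable_summatory b).aestronglyMeasurable).sub
      (hm.aestronglyMeasurable measurableSet_Ioi)⟩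
  · exact (continuousWithinAt_summatory b (by linarith)).sub
      (hasDerivAt_mainTerm (by linarith)).continuousAt.continuousWithinAt

theorem integral_errorPrimitive {s : ℂ} (hs : 1 < s.re) :
    ∫ u in Ioi (1 : ℝ), (errorPrimitive b u : ℂ) * (u : ℂ) ^ (-(s + 1) - 1) =
      (LSeries (fun n => (b n : ℂ)) s - 2 / (s - 1) ^ 3) / (s * (s + 1)) := by
  have hα : 1 < (1 + s.re) / 2 := by linarith
  obtain ⟨K, hK, h1, h2⟩ := exists_abs_error_le hb0 hb hsum hα
  have hmT : AEStronglyMeasurable mainTerm (volume.restrict (Ioi 1)) :=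
    (continuousOn_mainTerm.mono Ioi_subset_Ici_self).aestronglyMeasurable measurableSet_Ioi
  have hmS : AEStronglyMeasurable (summatory b) (volume.restrict (Ioi 1)) :=
    (measurable_summatory b).aestronglyMeasurable
  have key := mul_integral_cpow_eq (z := s + 1) (continuousOn_errorPrimitive hb)
    (by simp [errorPrimitive]) (fun u hu => hasDerivWithinAt_errorPrimitive hb hu)
    (hmS.sub hmT) (fun u hu => h1 u hu.le) (fun u hu => h2 u hu.le)
    (by rw [add_re, one_re]; linarith) (by rw [add_re, one_re]; linarith)
  obtain ⟨K', hK', h3⟩ := exists_summatory_le hb0 hb hsum hα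
  have hi1 : IntegrableOn (fun u : ℝ => (summatory b u : ℂ) * (u : ℂ) ^ (-s - 1)) (Ioi 1) :=
    integrableOn_mul_cpow hmS (fun u hu => by
      rw [abs_of_nonneg (summatory_nonneg hb u)]
      exact h3 u hu.le) (by rw [sub_re, neg_re, one_re]; linarith)
  have hi2 : IntegrableOn (fun u : ℝ => (mainTerm u : ℂ) * (u : ℂ) ^ (-s - 1)) (Ioi 1) :=
    integrableOn_mul_cpow hmT (fun u hu => mainTerm_le hu.le (sub_pos.2 hα)) (by
      rw [sub_re, neg_re, one_re]; linarith)
  have e1 : ∫ u in Ioi (1 : ℝ), (((summatory b u - mainTerm u : ℝ)) : ℂ) * (u : ℂ) ^ (-(s + 1)) =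
      (∫ u in Ioi (1 : ℝ), (summatory b u : ℂ) * (u : ℂ) ^ (-s - 1)) -
        ∫ u in Ioi (1 : ℝ), (mainTerm u : ℂ) * (u : ℂ) ^ (-s - 1) := by
    rw [← integral_sub hi1 hi2]
    refine setIntegral_congr_fun measurableSet_Ioi fun u _ => ?_
    simp only [neg_add']
    push_cast
    ring
  have hs0 : s ≠ 0 := by
    rintro rfl
    simp at hs
    linarith
  have hs1 : s + 1 ≠ 0 := by
    intro h
    have := congrArg re h
    simp at this
    linarith
  have e2 := mul_integral_summatory hb0 hb hsum hs
  have e3 := mul_integral_mainTerm hs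
  rw [eq_div_iff (mul_ne_zero hs0 hs1), ← e2, ← e3, ← mul_sub, ← e1, ← key]
  ring

end Tauberian
end PrimeIdealCount

namespace PrimeIdealCount

section Inversion

open MeasureTheory Set Complex

theorem one_add_abs_im_le {s : ℂ} (hs : 1 ≤ s.re) : (1 + |s.im|) / 2 ≤ ‖s‖ := by
  have h1 := abs_re_le_norm s
  have h2 := abs_im_le_norm s
  have h3 := le_abs_self s.re
  linarith

/-- The error primitive extended by zero. -/
noncomputable def errorExt (b : ℕ → ℝ) : ℝ → ℂ :=
  (Ioi (1 : ℝ)).indicator fun u => (errorPrimitive b u : ℂ)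

theorem mellin_integrand_errorExt (b : ℕ → ℝ) (w : ℂ) :
    (fun t : ℝ => (t : ℂ) ^ (w - 1) • errorExt b t) =
      (Ioi (1 : ℝ)).indicator fun t => (errorPrimitive b t : ℂ) * (t : ℂ) ^ (w - 1) := by
  ext t
  simp only [errorExt, indicator, smul_eq_mul]
  split_ifs
  · ring
  · simp

theorem mellin_errorExt {b : ℕ → ℝ} (hb0 : b 0 = 0) (hb : ∀ n, 0 ≤ b n)
    (hsum : ∀ s : ℂ, 1 < s.re → LSeriesSummable (fun n => (b n : ℂ)) s) {s : ℂ} (hs : 1 < s.re) :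
    mellin (errorExt b) (-(s + 1)) =
      (LSeries (fun n => (b n : ℂ)) s - 2 / (s - 1) ^ 3) / (s * (s + 1)) := by
  rw [mellin, mellin_integrand_errorExt, setIntegral_indicator measurableSet_Ioi,
    inter_eq_right.2 (Ioi_subset_Ioi zero_le_one), integral_errorPrimitive hb0 hb hsum hs]

theorem mellinConvergent_errorExt {b : ℕ → ℝ} (hb0 : b 0 = 0) (hb : ∀ n, 0 ≤ b n)
    (hsum : ∀ s : ℂ, 1 < s.re → LSeriesSummable (fun n => (b n : ℂ)) s) {s : ℂ} (hs : 1 < s.re) :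
    MellinConvergent (errorExt b) (-(s + 1)) := by
  have hα : 1 < (1 + s.re) / 2 := by linarith
  obtain ⟨K, hK, h1, h2⟩ := exists_abs_error_le hb0 hb hsum hα
  rw [MellinConvergent, mellin_integrand_errorExt]
  refine IntegrableOn.mono_set ?_ (subset_univ _)
  rw [integrableOn_univ, integrable_indicator_iff measurableSet_Ioi]
  refine integrableOn_mul_cpow (((continuousOn_errorPrimitive hb).mono
    Ioi_subset_Ici_self).aestronglyMeasurable measurableSet_Ioi) (fun u hu => h2 u hu.le) ?_
  rw [sub_re, neg_re, add_re, one_re]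
  linarith

theorem norm_transform_le {F s : ℂ} {C : ℝ} (hs : 1 < s.re)
    (hF : ‖F‖ ≤ C * (1 + |s.im|) ^ (1 / 2 : ℝ)) :
    ‖F / (s * (s + 1))‖ ≤ 4 * C * (1 + |s.im|) ^ (-(3 / 2 : ℝ)) := by
  have hp : 0 < 1 + |s.im| := by positivity
  have h1 := one_add_abs_im_le hs.le
  have h2 := one_add_abs_im_le (s := s + 1) (by simp; linarith)
  rw [add_im, one_im, add_zero] at h2
  have hC : 0 ≤ C * (1 + |s.im|) ^ (1 / 2 : ℝ) := (norm_nonneg _).trans hF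
  rw [norm_div, norm_mul]
  calc ‖F‖ / (‖s‖ * ‖s + 1‖)
      ≤ C * (1 + |s.im|) ^ (1 / 2 : ℝ) / ((1 + |s.im|) / 2 * ((1 + |s.im|) / 2)) := by gcongr
    _ = _ := by
        rw [show -(3 / 2 : ℝ) = 1 / 2 - 2 by norm_num, Real.rpow_sub hp, Real.rpow_two]
        field_simp
        try ring

theorem exists_abs_errorPrimitive_le {b : ℕ → ℝ} (hb0 : b 0 = 0) (hb : ∀ n, 0 ≤ b n)
    (hsum : ∀ s : ℂ, 1 < s.re → LSeriesSummable (fun n => (b n : ℂ)) s) {C : ℝ}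
    (hC : ∀ s : ℂ, 1 < s.re → s.re ≤ 3 / 2 →
      ‖LSeries (fun n => (b n : ℂ)) s - 2 / (s - 1) ^ 3‖ ≤ C * (1 + |s.im|) ^ (1 / 2 : ℝ)) :
    ∃ M : ℝ, ∀ x : ℝ, 1 < x → |errorPrimitive b x| ≤ M * x ^ 2 := by
  have hJ : Integrable fun y : ℝ => 4 * C * (1 + |y|) ^ (-(3 / 2 : ℝ)) := by
    have := integrable_one_add_norm (E := ℝ) (μ := volume) (r := 3 / 2)
      (by rw [Module.finrank_self]; norm_num)
    simpa only [Real.norm_eq_abs] using this.const_mul (4 * C)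
  have habs : LSeries.abscissaOfAbsConv (fun n => (b n : ℂ)) ≤ (1 : ℝ) :=
    LSeries.abscissaOfAbsConv_le_of_forall_lt_LSeriesSummable fun y hy =>
      hsum y (by simpa using hy)
  refine ⟨1 / (2 * Real.pi) * ∫ y : ℝ, 4 * C * (1 + |y|) ^ (-(3 / 2 : ℝ)), fun x hx => ?_⟩
  have hx0 : 0 < x := by linarith
  have key : ∀ σ : ℝ, 1 < σ → σ ≤ 3 / 2 → |errorPrimitive b x| ≤
      (1 / (2 * Real.pi) * ∫ y : ℝ, 4 * C * (1 + |y|) ^ (-(3 / 2 : ℝ))) * x ^ (σ + 1) := by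
    intro σ h1 h2
    have hw : ∀ y : ℝ, ((-(σ + 1) : ℝ) : ℂ) + y * I = -((σ - y * I) + 1) := fun y => by
      push_cast
      ring
    have hre : ∀ y : ℝ, ((σ : ℂ) - y * I).re = σ := fun y => by simp
    have him : ∀ y : ℝ, ((σ : ℂ) - y * I).im = -y := fun y => by simp
    have hmel : ∀ y : ℝ, mellin (errorExt b) (((-(σ + 1) : ℝ) : ℂ) + y * I) =
        (LSeries (fun n => (b n : ℂ)) (σ - y * I) - 2 / ((σ - y * I : ℂ) - 1) ^ 3) /
          ((σ - y * I) * ((σ - y * I) + 1)) := fun y => by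
      rw [hw, mellin_errorExt hb0 hb hsum (by rwa [hre])]
    have hbd : ∀ y : ℝ, ‖mellin (errorExt b) (((-(σ + 1) : ℝ) : ℂ) + y * I)‖ ≤
        4 * C * (1 + |y|) ^ (-(3 / 2 : ℝ)) := fun y => by
      rw [hmel]
      have := norm_transform_le (by rwa [hre]) (hC (σ - y * I) (by rwa [hre]) (by rwa [hre]))
      rwa [him, abs_neg] at this
    have hcont : Continuous fun y : ℝ => mellin (errorExt b) (((-(σ + 1) : ℝ) : ℂ) + y * I) := by
      simp only [hmel]
      have hline : Continuous fun y : ℝ => (σ : ℂ) - y * I := by fun_prop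
      have hne : ∀ (a : ℝ) (y : ℝ), 0 < σ + a → (σ : ℂ) - y * I + a ≠ 0 := fun a y ha h => by
        have := congrArg re h
        simp at this
        linarith
      refine Continuous.div (Continuous.sub ?_ (continuous_const.div ((hline.sub
        continuous_const).pow 3) fun y => pow_ne_zero 3 ?_)) (hline.mul (hline.add
          continuous_const)) fun y => mul_ne_zero ?_ ?_
      · refine ((LSeries_analyticOnNhd _).continuousOn).comp_continuous hline fun y => ?_
        simp only [mem_ofPred_eq, hre]
        exact habs.trans_lt (by exact_mod_cast h1)
      · simpa [sub_eq_add_neg] using hne (-1) y (by linarith)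
      · simpa using hne 0 y (by linarith)
      · simpa using hne 1 y (by linarith)
    have hintg : VerticalIntegrable (mellin (errorExt b)) (-(σ + 1)) :=
      hJ.mono' hcont.aestronglyMeasurable (Eventually.of_forall hbd)
    have hmc : MellinConvergent (errorExt b) ((-(σ + 1) : ℝ) : ℂ) := by
      have := mellinConvergent_errorExt hb0 hb hsum (s := σ) (by simpa using h1)
      push_cast
      exact this
    have hcx : ContinuousAt (errorExt b) x := by
      have h3 : ContinuousAt (fun u => (errorPrimitive b u : ℂ)) x :=
        continuous_ofReal.continuousAt.comp
          ((continuousOn_errorPrimitive hb).continuousAt (Ici_mem_nhds hx))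
      refine h3.congr ?_
      filter_upwards [Ioi_mem_nhds hx] with u hu
      rw [errorExt, indicator_of_mem hu]
    have hinv := mellinInv_mellin_eq _ _ hx0 hmc hintg hcx
    rw [errorExt, indicator_of_mem (show x ∈ Ioi (1 : ℝ) from hx), ← errorExt, mellinInv] at hinv
    have hn := congrArg norm hinv
    rw [norm_real, Real.norm_eq_abs] at hn
    rw [← hn, norm_smul, Real.norm_of_nonneg (by positivity), mul_assoc]
    gcongr
    rw [← integral_mul_const]
    refine norm_integral_le_of_norm_le (hJ.mul_const _) (Eventually.of_forall fun y => ?_)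
    rw [norm_smul, norm_cpow_eq_rpow_re_of_pos hx0, mul_comm]
    have e : (-(((-(σ + 1) : ℝ) : ℂ) + y * I)).re = σ + 1 := by simp
    rw [e]
    gcongr
    exact hbd y
  have hlim : Tendsto (fun σ : ℝ => (1 / (2 * Real.pi) * ∫ y : ℝ,
      4 * C * (1 + |y|) ^ (-(3 / 2 : ℝ))) * x ^ (σ + 1)) (nhdsWithin 1 (Ioi 1))
      (nhds ((1 / (2 * Real.pi) * ∫ y : ℝ, 4 * C * (1 + |y|) ^ (-(3 / 2 : ℝ))) * x ^ 2)) := by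
    have h : Continuous fun σ : ℝ => x ^ (σ + 1) :=
      (continuous_const.rpow (by fun_prop) fun _ => Or.inl hx0.ne')
    have h' := (h.tendsto 1).mono_left (nhdsWithin_le_nhds (s := Ioi 1))
    norm_num at h'
    exact h'.const_mul _
  refine ge_of_tendsto hlim ?_
  filter_upwards [Ioc_mem_nhdsGT (show (1 : ℝ) < 3 / 2 by norm_num)] with σ hσ
  exact key σ hσ.1 hσ.2

end Inversion
end PrimeIdealCount

namespace PrimeIdealCount

section Unsmoothing

open MeasureTheory Set

theorem two_le_log {x : ℝ} (hx : Real.exp 2 ≤ x) : 2 ≤ Real.log x := by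
  rw [← Real.log_exp 2]
  exact Real.log_le_log (Real.exp_pos _) hx

theorem errorPrimitive_sub {b : ℕ → ℝ} (hb : ∀ n, 0 ≤ b n) {u v : ℝ} (hu : 1 ≤ u) (hv : 1 ≤ v) :
    errorPrimitive b v - errorPrimitive b u = ∫ t in u..v, (summatory b t - mainTerm t) :=
  intervalIntegral.integral_interval_sub_left (intervalIntegrable_error hb le_rfl hv)
    (intervalIntegrable_error hb le_rfl hu)

/-- A monotone function is controlled from above by an integral to the right. -/
theorem summatory_mul_le {b : ℕ → ℝ} (hb : ∀ n, 0 ≤ b n) {u v : ℝ} (hu : 1 ≤ u) (huv : u ≤ v) :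
    (summatory b u - mainTerm v) * (v - u) ≤ errorPrimitive b v - errorPrimitive b u := by
  rw [errorPrimitive_sub hb hu (hu.trans huv), mul_comm, ← smul_eq_mul,
    ← intervalIntegral.integral_const]
  refine intervalIntegral.integral_mono_on huv (by simp)
    (intervalIntegrable_error hb hu (hu.trans huv)) fun t ht => ?_
  exact sub_le_sub (monotone_summatory hb ht.1)
    (monotoneOn_mainTerm (hu.trans ht.1) (hu.trans huv) ht.2)

theorem le_summatory_mul {b : ℕ → ℝ} (hb : ∀ n, 0 ≤ b n) {u v : ℝ} (hu : 1 ≤ u) (huv : u ≤ v) :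
    errorPrimitive b v - errorPrimitive b u ≤ (summatory b v - mainTerm u) * (v - u) := by
  rw [errorPrimitive_sub hb hu (hu.trans huv), mul_comm, ← smul_eq_mul,
    ← intervalIntegral.integral_const]
  refine intervalIntegral.integral_mono_on huv
    (intervalIntegrable_error hb hu (hu.trans huv)) (by simp) fun t ht => ?_
  exact sub_le_sub (monotone_summatory hb ht.2)
    (monotoneOn_mainTerm hu (hu.trans ht.1) ht.1)

theorem abs_summatory_sub_mainTerm_le {b : ℕ → ℝ} (hb : ∀ n, 0 ≤ b n) {M : ℝ}
    (hM : ∀ x : ℝ, 1 < x → |errorPrimitive b x| ≤ M * x ^ 2) {x : ℝ} (hx : Real.exp 2 ≤ x) :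
    |summatory b x - mainTerm x| ≤ (5 * M + 4) * (x * Real.log x) := by
  have hl : 2 ≤ Real.log x := two_le_log hx
  have hx3 : 3 ≤ x := by have := Real.add_one_le_exp 2; linarith
  have hl0 : 0 < Real.log x := by linarith
  set l := Real.log x with hldef
  set h := x / l with hh
  have hhpos : 0 < h := by positivity
  have hhl : h * l = x := by rw [hh]; field_simp
  have hhx : h ≤ x / 2 := by rw [hh]; gcongr
  have hM0 : 0 ≤ M := by
    have := (abs_nonneg _).trans (hM x (by linarith))
    exact nonneg_of_mul_nonneg_left this (by positivity)
  have hxl : x ^ 2 / h = x * l := by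
    rw [hh]
    field_simp
  have hlog2 : Real.log (x + h) ≤ 2 * l := by
    rw [hldef, ← Real.log_rpow (by linarith) 2]
    refine Real.log_le_log (by positivity) ?_
    rw [Real.rpow_two]
    nlinarith
  have E0 := abs_le.1 (hM x (by linarith))
  rw [abs_le]
  constructor
  · have hx1 : 1 < x - h := by linarith
    have h1 := le_summatory_mul hb (u := x - h) (v := x) hx1.le (by linarith)
    have h2 := mainTerm_sub_le (u := x - h) (v := x) hx1.le (by linarith)
    have E1 := abs_le.1 (hM (x - h) hx1)
    rw [← hldef] at h2
    have e1 : (x - h) ^ 2 ≤ x ^ 2 := by nlinarith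
    have h3 : -(2 * M) * x ^ 2 ≤ (summatory b x - mainTerm (x - h)) * h := by nlinarith
    have h4 : -(2 * M) * x ^ 2 / h ≤ summatory b x - mainTerm (x - h) := by
      rw [div_le_iff₀ hhpos]
      exact h3
    rw [mul_div_assoc, hxl] at h4
    have h5 : l ^ 2 * (x - (x - h)) = x * l := by rw [← hhl]; ring
    rw [h5] at h2
    have : 0 ≤ x * l := by positivity
    nlinarith
  · have h1 := summatory_mul_le hb (u := x) (v := x + h) (by linarith) (by linarith)
    have h2 := mainTerm_sub_le (u := x) (v := x + h) (by linarith) (by linarith)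
    have E1 := abs_le.1 (hM (x + h) (by linarith))
    have e1 : (x + h) ^ 2 ≤ 4 * x ^ 2 := by nlinarith
    have h3 : (summatory b x - mainTerm (x + h)) * h ≤ (5 * M) * x ^ 2 := by nlinarith
    have h4 : summatory b x - mainTerm (x + h) ≤ (5 * M) * x ^ 2 / h := by
      rw [le_div_iff₀ hhpos]
      exact h3
    rw [mul_div_assoc, hxl] at h4
    have h5 : Real.log (x + h) ^ 2 * (x + h - x) ≤ 4 * (x * l) := by
      have : 0 ≤ Real.log (x + h) := Real.log_nonneg (by linarith)
      calc _ ≤ (2 * l) ^ 2 * h := by rw [add_sub_cancel_left]; gcongr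
        _ = 4 * ((h * l) * l) := by ring
        _ = _ := by rw [hhl]
    linarith

theorem abs_summatory_sub_le {b : ℕ → ℝ} (hb : ∀ n, 0 ≤ b n) {M : ℝ}
    (hM : ∀ x : ℝ, 1 < x → |errorPrimitive b x| ≤ M * x ^ 2) {x : ℝ} (hx : Real.exp 2 ≤ x) :
    |summatory b x - x * Real.log x ^ 2| ≤ (5 * M + 9) * (x * Real.log x) := by
  have h1 := abs_le.1 (abs_summatory_sub_mainTerm_le hb hM hx)
  have hl : 2 ≤ Real.log x := two_le_log hx
  have hx3 : 3 ≤ x := by have := Real.add_one_le_exp 2; linarith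
  have h2 : mainTerm x = x * Real.log x ^ 2 - 2 * (x * Real.log x) + 2 * x - 2 := by
    rw [mainTerm]; ring
  have h3 : 2 * x ≤ x * Real.log x := by nlinarith
  rw [abs_le]
  constructor <;> nlinarith

theorem exists_summatory_le_mul_log_sq {b : ℕ → ℝ} (hb : ∀ n, 0 ≤ b n) {K : ℝ} (hK : 0 ≤ K)
    (h : ∀ x : ℝ, Real.exp 2 ≤ x → |summatory b x - x * Real.log x ^ 2| ≤ K * (x * Real.log x)) :
    ∃ K' : ℝ, 0 ≤ K' ∧ ∀ x u : ℝ, Real.exp 2 ≤ x → 1 ≤ u → u ≤ x →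
      summatory b u ≤ K' * (u * Real.log x ^ 2) := by
  have hs := summatory_nonneg hb (Real.exp 2)
  refine ⟨1 + K + summatory b (Real.exp 2), by positivity, fun x u hx hu hux => ?_⟩
  have hl : 2 ≤ Real.log x := two_le_log hx
  have hl2 : 1 ≤ Real.log x ^ 2 := by nlinarith
  have hu2 : u ≤ u * Real.log x ^ 2 := le_mul_of_one_le_right (by linarith) hl2
  rcases le_total (Real.exp 2) u with h2 | h2
  · have e1 := (abs_le.1 (h u h2)).2
    have e2 := two_le_log h2
    have e3 : Real.log u ≤ Real.log x := Real.log_le_log (by linarith) hux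
    have e4 : u * Real.log u ≤ u * Real.log x ^ 2 := by
      have : 0 ≤ u := by linarith
      gcongr
      nlinarith
    have e5 : u * Real.log u ^ 2 ≤ u * Real.log x ^ 2 := by
      have : 0 ≤ u := by linarith
      gcongr
    have e6 : K * (u * Real.log u) ≤ K * (u * Real.log x ^ 2) := by gcongr
    nlinarith
  · have e1 := monotone_summatory hb h2
    have : summatory b (Real.exp 2) * 1 ≤ summatory b (Real.exp 2) * (u * Real.log x ^ 2) := by
      gcongr
      linarith
    have h0 : 0 ≤ u * Real.log x ^ 2 := by linarith
    nlinarith [mul_nonneg hK h0]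

theorem sum_mul_log_div_le {b : ℕ → ℝ} (hb0 : b 0 = 0) (hb : ∀ n, 0 ≤ b n) {K x : ℝ} (hx : 1 ≤ x)
    (h : ∀ u : ℝ, 1 ≤ u → u ≤ x → summatory b u ≤ K * u) :
    ∑ n ∈ Finset.Icc 0 ⌊x⌋₊, b n * (Real.log x - Real.log n) ≤ K * x := by
  have hK : 0 ≤ K := by
    have := (summatory_nonneg hb 1).trans (h 1 le_rfl hx)
    linarith
  have hderiv : ∀ t ∈ Icc (1 : ℝ) x, DifferentiableAt ℝ Real.log t := fun t ht =>
    Real.differentiableAt_log (by linarith [ht.1])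
  have hcont : ContinuousOn (deriv Real.log) (Icc 1 x) := by
    rw [Real.deriv_log']
    exact continuousOn_inv₀.mono fun t ht => by
      have : 1 ≤ t := ht.1
      simp
      linarith
  have key := sum_mul_eq_sub_integral_mul₀ (f := Real.log) b hb0 x hderiv
    (hcont.integrableOn_Icc)
  have e1 : ∑ n ∈ Finset.Icc 0 ⌊x⌋₊, b n * (Real.log x - Real.log n) =
      ∫ t in Ioc 1 x, deriv Real.log t * ∑ k ∈ Finset.Icc 0 ⌊t⌋₊, b k := by
    simp only [mul_sub, Finset.sum_sub_distrib, ← Finset.sum_mul]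
    have : ∑ n ∈ Finset.Icc 0 ⌊x⌋₊, b n * Real.log n = ∑ n ∈ Finset.Icc 0 ⌊x⌋₊, Real.log n * b n :=
      Finset.sum_congr rfl fun n _ => mul_comm _ _
    rw [this, key]
    ring
  rw [e1]
  have hb' : ‖∫ t in Ioc 1 x, deriv Real.log t * ∑ k ∈ Finset.Icc 0 ⌊t⌋₊, b k‖ ≤
      K * volume.real (Ioc 1 x) := by
    refine norm_setIntegral_le_of_norm_le_const (by simp) fun t ht => ?_
    have ht0 : 0 < t := by linarith [ht.1]
    have hs := h t ht.1.le ht.2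
    rw [Real.deriv_log, norm_mul, Real.norm_of_nonneg (by positivity),
      ← summatory, Real.norm_of_nonneg (summatory_nonneg hb t), inv_mul_le_iff₀ ht0, mul_comm t]
    exact hs
  refine (le_abs_self _).trans (hb'.trans ?_)
  rw [Real.volume_real_Ioc_of_le hx]
  gcongr
  linarith

theorem abs_count_sub_le {c : ℕ → ℝ} (hc0 : c 0 = 0) (hc : ∀ n, 0 ≤ c n) {Ka : ℝ}
    (hA : ∀ x : ℝ, 1 ≤ x → summatory c x ≤ Ka * x) {K : ℝ} (hK : 0 ≤ K)
    (h : ∀ x : ℝ, Real.exp 2 ≤ x →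
      |summatory (fun n => c n * Real.log n ^ 3) x - x * Real.log x ^ 2| ≤ K * (x * Real.log x)) :
    ∃ K' : ℝ, ∀ x : ℝ, Real.exp 2 ≤ x →
      |summatory c x - x / Real.log x| ≤ K' * (x / Real.log x ^ 2) := by
  have hb0 : (fun n : ℕ => c n * Real.log n ^ 3) 0 = 0 := by simp
  have hb : ∀ n : ℕ, 0 ≤ (fun n : ℕ => c n * Real.log n ^ 3) n := fun n =>
    mul_nonneg (hc n) (pow_nonneg (Real.log_natCast_nonneg n) 3)
  obtain ⟨K1, hK1, h1⟩ := exists_summatory_le_mul_log_sq hb hK h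
  have hKa : 0 ≤ Ka := by
    have := (summatory_nonneg hc 1).trans (hA 1 le_rfl)
    linarith
  refine ⟨K + 48 * Ka + 24 * K1, fun x hx => ?_⟩
  have hl : 2 ≤ Real.log x := two_le_log hx
  have hx3 : 3 ≤ x := by have := Real.add_one_le_exp 2; linarith
  have hx0 : 0 < x := by linarith
  have hB := abs_le.1 (h x hx)
  have hn : ∀ n ∈ Finset.Icc 0 ⌊x⌋₊, Real.log n ≤ Real.log x := by
    intro n hn
    rcases Nat.eq_zero_or_pos n with rfl | hn0
    · simp; linarith
    · exact Real.log_le_log (by exact_mod_cast hn0)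
        ((Nat.le_floor_iff hx0.le).1 (Finset.mem_Icc.1 hn).2)
  have low : summatory (fun n => c n * Real.log n ^ 3) x ≤ summatory c x * Real.log x ^ 3 := by
    rw [summatory, summatory, Finset.sum_mul]
    refine Finset.sum_le_sum fun n hn' => ?_
    have := hn n hn'
    have h0 := Real.log_natCast_nonneg n
    have := hc n
    gcongr
  have hlogsum := sum_mul_log_div_le hb0 hb (K := K1 * Real.log x ^ 2) (x := x) (by linarith)
    fun u hu hux => by
      have := h1 x u hx hu hux
      linarith
  have hsqrt1 : 1 ≤ √x := Real.one_le_sqrt.2 (by linarith)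
  have hsqrtx : √x ≤ x := by
    rw [Real.sqrt_le_left hx0.le]
    nlinarith
  have hlogsqrt : Real.log √x = Real.log x / 2 := Real.log_sqrt hx0.le
  have hD : ∑ n ∈ Finset.Icc 0 ⌊x⌋₊, c n * (Real.log x - Real.log n) ≤
      Real.log x * summatory c √x + 8 / Real.log x ^ 3 *
        ∑ n ∈ Finset.Icc 0 ⌊x⌋₊, (c n * Real.log n ^ 3) * (Real.log x - Real.log n) := by
    have hsub : Finset.Icc 0 ⌊√x⌋₊ ⊆ Finset.Icc 0 ⌊x⌋₊ :=
      Finset.Icc_subset_Icc_right (Nat.floor_mono hsqrtx)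
    have hnn : ∀ n ∈ Finset.Icc 0 ⌊x⌋₊,
        0 ≤ (c n * Real.log n ^ 3) * (Real.log x - Real.log n) := fun n hn' =>
      mul_nonneg (hb n) (sub_nonneg.2 (hn n hn'))
    rw [← Finset.sum_sdiff hsub, add_comm]
    refine add_le_add ?_ ?_
    · rw [summatory, Finset.mul_sum]
      refine Finset.sum_le_sum fun n _ => ?_
      have h0 := Real.log_natCast_nonneg n
      have := hc n
      nlinarith
    · rw [Finset.mul_sum]
      refine (Finset.sum_le_sum (g := fun n => 8 / Real.log x ^ 3 *
        ((c n * Real.log n ^ 3) * (Real.log x - Real.log n))) fun n hn' => ?_).trans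
        (Finset.sum_le_sum_of_subset_of_nonneg Finset.sdiff_subset fun n hn' _ =>
          mul_nonneg (by positivity) (hnn n hn'))
      rw [Finset.mem_sdiff, Finset.mem_Icc, Finset.mem_Icc] at hn'
      have hns : √x < n := by
        by_contra hcon
        push Not at hcon
        exact hn'.2 ⟨Nat.zero_le _, Nat.le_floor hcon⟩
      have hln : Real.log x / 2 ≤ Real.log n := by
        rw [← hlogsqrt]
        exact Real.log_le_log (by linarith) hns.le
      have h8 : 1 ≤ 8 / Real.log x ^ 3 * Real.log n ^ 3 := by
        rw [div_mul_eq_mul_div, one_le_div (by positivity)]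
        calc Real.log x ^ 3 = 8 * (Real.log x / 2) ^ 3 := by ring
          _ ≤ _ := by gcongr
      have hnx := sub_nonneg.2 (hn n (Finset.mem_Icc.2 hn'.1))
      calc c n * (Real.log x - Real.log n) = c n * (Real.log x - Real.log n) * 1 := (mul_one _).symm
        _ ≤ c n * (Real.log x - Real.log n) * (8 / Real.log x ^ 3 * Real.log n ^ 3) := by
            have := mul_nonneg (hc n) hnx
            gcongr
        _ = _ := by ring
  have up : summatory c x * Real.log x ^ 3 - summatory (fun n => c n * Real.log n ^ 3) x ≤
      3 * Real.log x ^ 2 * ∑ n ∈ Finset.Icc 0 ⌊x⌋₊, c n * (Real.log x - Real.log n) := by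
    rw [summatory, summatory, Finset.sum_mul, ← Finset.sum_sub_distrib, Finset.mul_sum]
    refine Finset.sum_le_sum fun n hn' => ?_
    have h2 := hn n hn'
    have h0 := Real.log_natCast_nonneg n
    have e : Real.log x ^ 3 - Real.log n ^ 3 ≤
        3 * Real.log x ^ 2 * (Real.log x - Real.log n) := by
      have : Real.log x ^ 2 + Real.log x * Real.log n + Real.log n ^ 2 ≤ 3 * Real.log x ^ 2 := by
        nlinarith
      nlinarith [sub_nonneg.2 h2]
    nlinarith [mul_le_mul_of_nonneg_left e (hc n)]
  have hsq : Real.log x ^ 2 * √x ≤ 16 * x := by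
    have := (le_abs_self _).trans (log_pow_le_mul_rpow 2 (ε := 1 / 2) (by norm_num)
      (show 1 ≤ x by linarith))
    rw [← Real.sqrt_eq_rpow] at this
    norm_num at this
    nlinarith [Real.mul_self_sqrt hx0.le]
  have hAs := hA √x hsqrt1
  set l := Real.log x with hldef
  have hl0 : 0 < l := by linarith
  have t1 : 3 * l ^ 2 * (l * summatory c √x) ≤ 48 * Ka * (x * l) := by
    calc 3 * l ^ 2 * (l * summatory c √x) ≤ 3 * l ^ 2 * (l * (Ka * √x)) := by gcongr
      _ = 3 * Ka * l * (l ^ 2 * √x) := by ring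
      _ ≤ 3 * Ka * l * (16 * x) := by gcongr
      _ = _ := by ring
  have t2 : 3 * l ^ 2 * (8 / l ^ 3 *
      ∑ n ∈ Finset.Icc 0 ⌊x⌋₊, (c n * Real.log n ^ 3) * (l - Real.log n)) ≤ 24 * K1 * (x * l) := by
    calc _ ≤ 3 * l ^ 2 * (8 / l ^ 3 * (K1 * l ^ 2 * x)) := by gcongr
      _ = _ := by field_simp; ring
  have t3 : summatory c x * l ^ 3 - summatory (fun n => c n * Real.log n ^ 3) x ≤
      (48 * Ka + 24 * K1) * (x * l) := by
    refine up.trans ((mul_le_mul_of_nonneg_left hD (by positivity)).trans ?_)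
    rw [mul_add]
    linarith
  have e1 : x / l = x * l ^ 2 / l ^ 3 := by field_simp
  have e2 : x / l ^ 2 = x * l / l ^ 3 := by field_simp
  have e3 : summatory c x = summatory c x * l ^ 3 / l ^ 3 := by field_simp
  have hxl : 0 ≤ x * l := by positivity
  rw [e1, e2, e3, ← sub_div, ← mul_div_assoc, abs_div, abs_of_pos (show 0 < l ^ 3 by positivity)]
  gcongr
  rw [abs_le]
  constructor
  · nlinarith [mul_nonneg hKa hxl, mul_nonneg hK1 hxl]
  · nlinarith [mul_nonneg hKa hxl, mul_nonneg hK1 hxl]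

end Unsmoothing
end PrimeIdealCount

namespace PrimeIdealCount

theorem PrimeSystem.exists_abs_summatory_sub_le (D : PrimeSystem) :
    ∃ K : ℝ, ∀ x : ℝ, Real.exp 2 ≤ x →
      |summatory D.c x - x / Real.log x| ≤ K * (x / Real.log x ^ 2) := by
  have hb0 : (fun n : ℕ => D.c n * Real.log n ^ 3) 0 = 0 := by simp
  have hb : ∀ n : ℕ, 0 ≤ (fun n : ℕ => D.c n * Real.log n ^ 3) n := fun n =>
    mul_nonneg (D.c_nonneg n) (pow_nonneg (Real.log_natCast_nonneg n) 3)
  obtain ⟨C, hC, h⟩ := D.exists_norm_LSeries_log_cube_sub_le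
  obtain ⟨M, hM⟩ := exists_abs_errorPrimitive_le hb0 hb (fun s hs => D.LSeriesSummable_log_cube hs) h
  have hA : ∀ x : ℝ, 1 ≤ x → summatory D.c x ≤ (D.ρ + D.C) * x := fun x hx =>
    (Finset.sum_le_sum fun n _ => D.c_le n).trans (D.A_le hx)
  have h1 : ∀ x : ℝ, Real.exp 2 ≤ x →
      |summatory (fun n => D.c n * Real.log n ^ 3) x - x * Real.log x ^ 2| ≤
        |5 * M + 9| * (x * Real.log x) := fun x hx => by
    refine (abs_summatory_sub_le hb hM hx).trans ?_
    have hl := two_le_log hx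
    have hx0 := (Real.exp_pos 2).trans_le hx
    gcongr
    exact le_abs_self _
  exact abs_count_sub_le D.c_zero D.c_nonneg hA (abs_nonneg _) h1

section EulerProduct

variable {M ι : Type*} [CommMonoid M] [IsLeftCancelMul M] (p : ι → M) (f : M →* ℂ)

open Classical in
theorem prod_one_sub_mul_tsum
    (hprime : ∀ i x y, p i ∣ x * y → p i ∣ x ∨ p i ∣ y) (hdvd : ∀ i j, p i ∣ p j → i = j)
    (hf : Summable fun x => ‖f x‖) (S : Finset ι) :
    (∏ i ∈ S, (1 - f (p i))) * ∑' x, f x = ∑' x, if ∀ i ∈ S, ¬ p i ∣ x then f x else 0 := by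
  induction S using Finset.induction_on with
  | empty => simp
  | insert j S hj ih =>
    have hsum : ∀ (P : M → Prop) [DecidablePred P], Summable fun x => if P x then f x else 0 := fun P _ => by
      refine Summable.of_norm_bounded hf fun x => ?_
      split_ifs
      · exact le_rfl
      · simp
    rw [Finset.prod_insert hj, mul_assoc, ih, sub_mul, one_mul, ← tsum_mul_left]
    have e : ∑' x, f (p j) * (if ∀ i ∈ S, ¬ p i ∣ x then f x else 0) =
        ∑' x, if (∀ i ∈ S, ¬ p i ∣ x) ∧ p j ∣ x then f x else 0 := by
      rw [← (mul_right_injective (p j)).tsum_eq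
        (f := fun x => if (∀ i ∈ S, ¬ p i ∣ x) ∧ p j ∣ x then f x else 0)]
      · refine tsum_congr fun x => ?_
        have h1 : (∀ i ∈ S, ¬ p i ∣ p j * x) ↔ ∀ i ∈ S, ¬ p i ∣ x := by
          refine forall₂_congr fun i hi => not_congr ⟨fun h => ?_, fun h => h.mul_left _⟩
          rcases hprime i _ _ h with h | h
          · exact absurd (hdvd i j h ▸ hi) hj
          · exact h
        simp only [h1, dvd_mul_right, and_true, map_mul, mul_ite, mul_zero]
      · intro x hx
        have : (∀ i ∈ S, ¬ p i ∣ x) ∧ p j ∣ x := by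
          by_contra hcon
          exact hx (if_neg hcon)
        obtain ⟨y, rfl⟩ := this.2
        exact ⟨y, rfl⟩
    rw [e, ← (hsum fun x => ∀ i ∈ S, ¬ p i ∣ x).tsum_sub
      (hsum fun x => (∀ i ∈ S, ¬ p i ∣ x) ∧ p j ∣ x)]
    refine tsum_congr fun x => ?_
    simp only [Finset.forall_mem_insert]
    by_cases h1 : ∀ i ∈ S, ¬ p i ∣ x <;> by_cases h2 : p j ∣ x <;> simp [h1, h2]

theorem tsum_eq_exp_tsum_neg_log
    (hprime : ∀ i x y, p i ∣ x * y → p i ∣ x ∨ p i ∣ y) (hdvd : ∀ i j, p i ∣ p j → i = j)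
    (hone : ∀ i, ¬ p i ∣ 1) (hex : ∀ x, x ≠ 1 → ∃ i, p i ∣ x)
    (hf : Summable fun x => ‖f x‖) (hfp : ∀ i, ‖f (p i)‖ < 1) :
    Summable (fun i => -Complex.log (1 - f (p i))) ∧
      ∑' x, f x = Complex.exp (∑' i, -Complex.log (1 - f (p i))) := by
  classical
  have hinj : Function.Injective p := fun i j h => hdvd i j (h ▸ dvd_rfl)
  have hs : Summable fun i => f (p i) := hf.of_norm.comp_injective hinj
  have hlog : Summable fun i => -Complex.log (1 - f (p i)) := by
    simpa only [sub_eq_add_neg] using (Complex.summable_log_one_add_of_summable hs.neg).neg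
  refine ⟨hlog, ?_⟩
  have hne : ∀ i, 1 - f (p i) ≠ 0 := fun i h => by
    have := hfp i
    rw [← sub_eq_zero.1 h] at this
    simp at this
  have h1 : Tendsto (fun S : Finset ι => (∏ i ∈ S, (1 - f (p i))) * ∑' x, f x) atTop
      (nhds (Complex.exp (-∑' i, -Complex.log (1 - f (p i))) * ∑' x, f x)) := by
    refine Tendsto.mul_const _ ?_
    refine ((Complex.continuous_exp.tendsto _).comp hlog.hasSum.neg).congr fun S => ?_
    simp only [Function.comp_apply, neg_neg, Finset.sum_neg_distrib]
    rw [Complex.exp_sum]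
    exact Finset.prod_congr rfl fun i _ => Complex.exp_log (hne i)
  have h2 : Tendsto (fun S : Finset ι => ∑' x, if ∀ i ∈ S, ¬ p i ∣ x then f x else 0) atTop
      (nhds (∑' x, if x = 1 then f x else 0)) := by
    refine tendsto_tsum_of_dominated_convergence hf (fun x => ?_) (Eventually.of_forall fun S x => ?_)
    · refine tendsto_const_nhds.congr' ?_
      by_cases hx : x = 1
      · refine Eventually.of_forall fun S => ?_
        simp only [hx, if_true]
        rw [if_pos fun i _ => hone i]
      · obtain ⟨i, hi⟩ := hex x hx
        filter_upwards [eventually_ge_atTop {i}] with S hS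
        simp only [hx, if_false]
        rw [if_neg]
        push Not
        exact ⟨i, Finset.singleton_subset_iff.1 hS, hi⟩
    · split_ifs
      · exact le_rfl
      · simp
  simp only [prod_one_sub_mul_tsum p f hprime hdvd hf] at h1
  have h3 := tendsto_nhds_unique h1 h2
  rw [tsum_ite_eq, map_one, Complex.exp_neg, inv_mul_eq_one₀ (Complex.exp_ne_zero _)] at h3
  exact h3.symm

end EulerProduct

section Fibers

theorem hasSum_fiber {T E : Type*} [NormedAddCommGroup E] [NormedSpace ℝ E] [CompleteSpace E]
    {N : T → ℕ}
    {g : ℕ → E} (h : Summable fun t => g (N t)) :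
    HasSum (fun n => (Nat.card {t // N t = n} : ℝ) • g n) (∑' t, g (N t)) := by
  have h1 : Summable ((fun t => g (N t)) ∘ Equiv.sigmaFiberEquiv N) :=
    (Equiv.summable_iff _).2 h
  have h2 := h1.hasSum.sigma (g := fun n => (Nat.card {t // N t = n} : ℝ) • g n) fun n => by
    have h3 : ∀ t : {t // N t = n}, ((fun t => g (N t)) ∘ Equiv.sigmaFiberEquiv N) ⟨n, t⟩ = g n :=
      fun t => by simp [Equiv.sigmaFiberEquiv, t.2]
    have h4 := h1.sigma_factor n
    have h5 := h4.hasSum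
    simp only [h3] at h5
    rw [tsum_const, ← Nat.cast_smul_eq_nsmul ℝ] at h5
    simpa only [h3] using h5
  have h6 : ∑' b, ((fun t => g (N t)) ∘ Equiv.sigmaFiberEquiv N) b = ∑' t, g (N t) :=
    Equiv.tsum_eq (Equiv.sigmaFiberEquiv N) (fun t => g (N t))
  rwa [h6] at h2

theorem summable_of_fiber {T : Type*} {N : T → ℕ} (hfin : ∀ m, {t | N t ≤ m}.Finite)
    {g : ℕ → ℝ} (hg : ∀ n, 0 ≤ g n) (h : Summable fun n => (Nat.card {t // N t = n} : ℝ) * g n) :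
    Summable fun t => g (N t) := by
  rw [← (Equiv.sigmaFiberEquiv N).summable_iff,
    summable_sigma_of_nonneg (f := (fun t => g (N t)) ∘ Equiv.sigmaFiberEquiv N) fun _ => hg _]
  have h3 : ∀ (n : ℕ) (t : {t // N t = n}),
      ((fun t => g (N t)) ∘ Equiv.sigmaFiberEquiv N) ⟨n, t⟩ = g n :=
    fun n t => by simp [Equiv.sigmaFiberEquiv, t.2]
  simp only [h3]
  have hf : ∀ n, Finite {t // N t = n} := fun n =>
    ((hfin n).subset fun t ht => le_of_eq ht).to_subtype
  refine ⟨fun n => ?_, ?_⟩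
  · have := hf n
    exact Summable.of_finite
  · refine h.congr fun n => ?_
    rw [tsum_const, nsmul_eq_mul]

theorem sum_card_fiber {T : Type*} {N : T → ℕ} (hfin : ∀ m, {t | N t ≤ m}.Finite) (m : ℕ) :
    ∑ n ∈ Finset.Icc 0 m, Nat.card {t // N t = n} = Nat.card {t // N t ≤ m} := by
  classical
  have h1 : Nat.card {t // N t ≤ m} = (hfin m).toFinset.card :=
    Nat.card_eq_card_finite_toFinset (hfin m)
  rw [h1, Finset.card_eq_sum_card_fiberwise (f := N) (t := Finset.Icc 0 m) fun t ht => by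
    simpa using ht]
  refine Finset.sum_congr rfl fun n hn => ?_
  rw [← Nat.card_eq_finsetCard]
  refine Nat.card_congr (Equiv.subtypeEquivRight fun t => ?_)
  simp only [Finset.mem_filter, Set.Finite.mem_toFinset, Set.mem_ofPred_eq]
  have := (Finset.mem_Icc.1 hn).2
  constructor
  · rintro rfl
    exact ⟨this, rfl⟩
  · exact fun h => h.2

end Fibers
end PrimeIdealCount

namespace PrimeIdealCount

open IsDedekindDomain
open scoped nonZeroDivisors

variable (K : Type*) [Field K] [NumberField K]

theorem finite_ideal_absNorm_le (m : ℕ) :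
    {I : (Ideal (𝓞 K))⁰ | Ideal.absNorm (I : Ideal (𝓞 K)) ≤ m}.Finite :=
  (Ideal.finite_setOfPred_absNorm_le (S := 𝓞 K) m).preimage Subtype.val_injective.injOn

/-- A nonzero prime ideal as a nonzero ideal. -/
def primeToIdeal (v : HeightOneSpectrum (𝓞 K)) : (Ideal (𝓞 K))⁰ :=
  ⟨v.asIdeal, mem_nonZeroDivisors_of_ne_zero v.ne_bot⟩

theorem primeToIdeal_injective : Function.Injective (primeToIdeal K) := fun v w h =>
  HeightOneSpectrum.ext (congrArg Subtype.val h)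

theorem finite_prime_absNorm_le (m : ℕ) :
    {v : HeightOneSpectrum (𝓞 K) | Ideal.absNorm v.asIdeal ≤ m}.Finite :=
  (finite_ideal_absNorm_le K m).preimage (primeToIdeal_injective K).injOn

theorem dvd_iff_coe_dvd (I J : (Ideal (𝓞 K))⁰) : I ∣ J ↔ (I : Ideal (𝓞 K)) ∣ J := by
  constructor
  · rintro ⟨L, rfl⟩
    exact ⟨L, rfl⟩
  · rintro ⟨L, hL⟩
    have : L ≠ 0 := by
      rintro rfl
      rw [mul_zero] at hL
      exact nonZeroDivisors.coe_ne_zero J hL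
    exact ⟨⟨L, mem_nonZeroDivisors_of_ne_zero this⟩, Subtype.ext hL⟩

theorem one_le_absNorm (I : (Ideal (𝓞 K))⁰) : 1 ≤ Ideal.absNorm (I : Ideal (𝓞 K)) :=
  Nat.one_le_iff_ne_zero.2 (Ideal.absNorm_ne_zero_of_nonZeroDivisors I)

theorem two_le_absNorm (v : HeightOneSpectrum (𝓞 K)) : 2 ≤ Ideal.absNorm v.asIdeal := by
  have h1 := one_le_absNorm K (primeToIdeal K v)
  have h2 : Ideal.absNorm v.asIdeal ≠ 1 := fun h =>
    v.isPrime.ne_top (Ideal.absNorm_eq_one_iff.1 h)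
  change 1 ≤ Ideal.absNorm v.asIdeal at h1
  omega

/-- The completely multiplicative function `I ↦ N(I) ^ (-s)`. -/
noncomputable def normCpow (s : ℂ) : (Ideal (𝓞 K))⁰ →* ℂ where
  toFun I := (Ideal.absNorm (I : Ideal (𝓞 K)) : ℂ) ^ (-s)
  map_one' := by simp
  map_mul' I J := by
    rw [Submonoid.coe_mul, map_mul, Nat.cast_mul, Complex.natCast_mul_natCast_cpow]

theorem norm_normCpow (s : ℂ) (I : (Ideal (𝓞 K))⁰) :
    ‖normCpow K s I‖ = (Ideal.absNorm (I : Ideal (𝓞 K)) : ℝ) ^ (-s.re) := by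
  change ‖((Ideal.absNorm (I : Ideal (𝓞 K)) : ℕ) : ℂ) ^ (-s)‖ = _
  rw [Complex.norm_natCast_cpow_of_pos (one_le_absNorm K I), Complex.neg_re]

instance isLeftCancelMul_ideal : IsLeftCancelMul (Ideal (𝓞 K))⁰ where
  mul_left_cancel I J L h := Subtype.ext
    (mul_left_cancel₀ (nonZeroDivisors.coe_ne_zero I) (congrArg Subtype.val h))

theorem euler_product_ideal {s : ℂ} (hs : 1 < s.re)
    (hsum : Summable fun I => ‖normCpow K s I‖) :
    (Summable fun v : HeightOneSpectrum (𝓞 K) =>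
      -Complex.log (1 - (Ideal.absNorm v.asIdeal : ℂ) ^ (-s))) ∧
    ∑' I, normCpow K s I = Complex.exp (∑' v : HeightOneSpectrum (𝓞 K),
      -Complex.log (1 - (Ideal.absNorm v.asIdeal : ℂ) ^ (-s))) := by
  refine tsum_eq_exp_tsum_neg_log (primeToIdeal K) (normCpow K s) ?_ ?_ ?_ ?_ hsum ?_
  · intro v I J h
    simp only [dvd_iff_coe_dvd] at h ⊢
    exact v.prime.dvd_or_dvd h
  · intro v w h
    rw [dvd_iff_coe_dvd] at h
    exact HeightOneSpectrum.ext
      ((w.isMaximal.eq_of_le v.isPrime.ne_top (Ideal.le_of_dvd h)).symm)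
  · intro v h
    rw [dvd_iff_coe_dvd] at h
    exact v.prime.not_isUnit (isUnit_of_dvd_one h)
  · intro I hI
    have h1 : (I : Ideal (𝓞 K)) ≠ ⊤ := fun h => hI (Subtype.ext (by rw [h, Submonoid.coe_one, Ideal.one_eq_top]))
    obtain ⟨m, hm, hle⟩ := Ideal.exists_le_maximal _ h1
    refine ⟨⟨m, hm.isPrime, ?_⟩, ?_⟩
    · rintro rfl
      exact nonZeroDivisors.coe_ne_zero I (le_bot_iff.1 hle)
    · rw [dvd_iff_coe_dvd]
      exact Ideal.dvd_iff_le.2 hle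
  · intro v
    rw [norm_normCpow]
    have h2 : (2 : ℝ) ≤ Ideal.absNorm v.asIdeal := by exact_mod_cast two_le_absNorm K v
    exact Real.rpow_lt_one_of_one_lt_of_neg (by change (1 : ℝ) < Ideal.absNorm v.asIdeal; linarith)
      (by linarith)

/-- The number of nonzero ideals of norm `n`. -/
noncomputable def idealCount (n : ℕ) : ℝ :=
  Nat.card {I : (Ideal (𝓞 K))⁰ // Ideal.absNorm (I : Ideal (𝓞 K)) = n}

/-- The number of nonzero prime ideals of norm `n`. -/
noncomputable def primeCount (n : ℕ) : ℝ :=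
  Nat.card {v : HeightOneSpectrum (𝓞 K) // Ideal.absNorm v.asIdeal = n}

theorem idealCount_nonneg (n : ℕ) : 0 ≤ idealCount K n := Nat.cast_nonneg _

theorem idealCount_zero : idealCount K 0 = 0 := by
  have : IsEmpty {I : (Ideal (𝓞 K))⁰ // Ideal.absNorm (I : Ideal (𝓞 K)) = 0} :=
    ⟨fun I => Ideal.absNorm_ne_zero_of_nonZeroDivisors I.1 I.2⟩
  simp [idealCount]

theorem primeCount_eq_zero {n : ℕ} (hn : n < 2) : primeCount K n = 0 := by
  have : IsEmpty {v : HeightOneSpectrum (𝓞 K) // Ideal.absNorm v.asIdeal = n} :=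
    ⟨fun v => by have := two_le_absNorm K v.1; have := v.2; omega⟩
  simp [primeCount]

theorem primeCount_le (n : ℕ) : primeCount K n ≤ idealCount K n := by
  have : Finite {I : (Ideal (𝓞 K))⁰ // Ideal.absNorm (I : Ideal (𝓞 K)) = n} :=
    ((finite_ideal_absNorm_le K n).subset fun I hI => le_of_eq hI).to_subtype
  rw [primeCount, idealCount, Nat.cast_le]
  refine Nat.card_le_card_of_injective (fun v => ⟨primeToIdeal K v.1, v.2⟩) fun v w h => ?_
  exact Subtype.ext (primeToIdeal_injective K (congrArg Subtype.val h))

theorem sum_idealCount {x : ℝ} (hx : 0 ≤ x) : ∑ n ∈ Finset.Icc 0 ⌊x⌋₊, idealCount K n =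
    Nat.card {I : (Ideal (𝓞 K))⁰ // (Ideal.absNorm (I : Ideal (𝓞 K)) : ℝ) ≤ x} := by
  simp only [idealCount]
  rw [← Nat.cast_sum, sum_card_fiber (finite_ideal_absNorm_le K)]
  simp only [Nat.le_floor_iff hx]

theorem sum_primeCount {x : ℝ} (hx : 0 ≤ x) : summatory (primeCount K) x =
    Nat.card {v : HeightOneSpectrum (𝓞 K) // (Ideal.absNorm v.asIdeal : ℝ) ≤ x} := by
  simp only [summatory, primeCount]
  rw [← Nat.cast_sum, sum_card_fiber (finite_prime_absNorm_le K)]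
  simp only [Nat.le_floor_iff hx]

theorem LSeriesSummable_idealCount {s : ℂ} (hs : 1 < s.re) :
    LSeriesSummable (fun n => (idealCount K n : ℂ)) s := by
  obtain ⟨ρ, C, hρ, h⟩ := exists_abs_card_ideal_sub_le K
  have hC : 0 ≤ C := by
    have := (abs_nonneg _).trans (h 1 le_rfl)
    simpa using this
  refine LSeriesSummable_of_sum_norm_bigO_and_nonneg (r := 1) ?_ (fun n => Nat.cast_nonneg _)
    zero_le_one hs
  refine Asymptotics.IsBigO.of_bound (ρ + C) ?_
  filter_upwards [eventually_ge_atTop 1] with n hn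
  have hn' : (1 : ℝ) ≤ n := by exact_mod_cast hn
  have h1 := (abs_le.1 (h n hn')).2
  rw [← sum_idealCount K (by linarith), Nat.floor_natCast] at h1
  have h2 : ∑ k ∈ Finset.Icc 1 n, idealCount K k ≤ ∑ k ∈ Finset.Icc 0 n, idealCount K k :=
    Finset.sum_le_sum_of_subset_of_nonneg (Finset.Icc_subset_Icc_left zero_le_one)
      fun k _ _ => Nat.cast_nonneg _
  have h3 : C * (n : ℝ) ^ (1 - 1 / (Module.finrank ℚ K : ℝ)) ≤ C * n := by
    gcongr
    exact Real.rpow_le_self_of_one_le hn' (by simp)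
  rw [Real.norm_of_nonneg (Finset.sum_nonneg fun n _ => idealCount_nonneg K n), Real.rpow_one,
    Real.norm_of_nonneg (by positivity)]
  linarith

theorem summable_norm_normCpow {s : ℂ} (hs : 1 < s.re) :
    Summable fun I => ‖normCpow K s I‖ := by
  simp only [norm_normCpow]
  refine summable_of_fiber (finite_ideal_absNorm_le K) (g := fun n : ℕ => (n : ℝ) ^ (-s.re))
    (fun n => by positivity) ?_
  refine (LSeriesSummable_idealCount K hs).norm.congr fun n => ?_
  rw [LSeries.norm_term_eq]
  split_ifs with hn
  · rw [hn]
    have := idealCount_zero K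
    rw [idealCount] at this
    rw [this, zero_mul]
  · rw [Complex.norm_real, Real.norm_of_nonneg (idealCount_nonneg K n), Real.rpow_neg (by positivity)]
    rfl

theorem LSeries_idealCount {s : ℂ} (hs : 1 < s.re) :
    LSeries (fun n => (idealCount K n : ℂ)) s =
      Complex.exp (∑' n : ℕ, (primeCount K n : ℂ) * -Complex.log (1 - (n : ℂ) ^ (-s))) := by
  have hs1 := summable_norm_normCpow K hs
  obtain ⟨h1, h2⟩ := euler_product_ideal K hs hs1
  have h3 := hasSum_fiber (N := fun v : HeightOneSpectrum (𝓞 K) => Ideal.absNorm v.asIdeal)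
    (g := fun n : ℕ => -Complex.log (1 - (n : ℂ) ^ (-s))) h1
  have h4 := hasSum_fiber (N := fun I : (Ideal (𝓞 K))⁰ => Ideal.absNorm (I : Ideal (𝓞 K)))
    (g := fun n : ℕ => (n : ℂ) ^ (-s)) hs1.of_norm
  have h5 : LSeries (fun n => (idealCount K n : ℂ)) s = ∑' I, normCpow K s I := by
    refine Eq.trans ?_ h4.tsum_eq
    refine tsum_congr fun n => ?_
    rcases eq_or_ne n 0 with rfl | hn
    · have := idealCount_zero K
      rw [idealCount] at this
      rw [LSeries.term_zero, this, zero_smul]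
    · rw [LSeries.term_of_ne_zero hn, Complex.real_smul, Complex.cpow_neg, div_eq_mul_inv]
      rfl
  rw [h5, h2, ← h3.tsum_eq]
  congr 1

/-- The prime system attached to a number field. -/
noncomputable def numberFieldSystem : PrimeSystem where
  a := idealCount K
  c := primeCount K
  ρ := (exists_abs_card_ideal_sub_le K).choose
  C := (exists_abs_card_ideal_sub_le K).choose_spec.choose
  δ := min (1 / (Module.finrank ℚ K : ℝ)) (1 / 2)
  ρ_pos := (exists_abs_card_ideal_sub_le K).choose_spec.choose_spec.1
  δ_pos := by
    have : 0 < Module.finrank ℚ K := Module.finrank_pos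
    positivity
  δ_le := min_le_right _ _
  a_zero := idealCount_zero K
  c_zero := primeCount_eq_zero K (by norm_num)
  c_one := primeCount_eq_zero K (by norm_num)
  c_nonneg _ := Nat.cast_nonneg _
  c_le := primeCount_le K
  abs_sum_sub_le x hx := by
    have h := (exists_abs_card_ideal_sub_le K).choose_spec.choose_spec.2
    have h0 := (abs_nonneg _).trans (h 1 le_rfl)
    rw [Real.one_rpow, mul_one] at h0
    rw [sum_idealCount K (by linarith)]
    refine (h x hx).trans ?_
    gcongr
    exact min_le_left _ _
  euler s hs := LSeries_idealCount K hs

/-- The prime ideal theorem with error term `O(X / log² X)`. -/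
theorem exists_abs_card_prime_sub_le :
    ∃ C : ℝ, ∀ x : ℝ, Real.exp 2 ≤ x →
      |(Nat.card {v : HeightOneSpectrum (𝓞 K) // (Ideal.absNorm v.asIdeal : ℝ) ≤ x} : ℝ) -
        x / Real.log x| ≤ C * (x / Real.log x ^ 2) := by
  obtain ⟨C, hC⟩ := (numberFieldSystem K).exists_abs_summatory_sub_le
  refine ⟨C, fun x hx => ?_⟩
  have h := hC x hx
  rwa [numberFieldSystem, sum_primeCount K ((Real.exp_pos 2).le.trans hx)] at h

end PrimeIdealCount

namespace PrimeIdealCount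
open IsDedekindDomain
section Quadratic

variable {K M : Type*} [Field K] [NumberField K] [Field M] [NumberField M] [Algebra K M]

theorem absNorm_map_eq_sq (h2 : Module.finrank K M = 2) (I : Ideal (𝓞 K)) :
    Ideal.absNorm (I.map (algebraMap (𝓞 K) (𝓞 M))) = Ideal.absNorm I ^ 2 := by
  rw [Ideal.absNorm_algebraMap, ← h2, IsFractionRing.finrank_eq (𝓞 K) K (𝓞 M) M]

theorem under_eq_iff {v : HeightOneSpectrum (𝓞 K)} {w : HeightOneSpectrum (𝓞 M)} :
    w.under (𝓞 K) = v ↔ w.asIdeal ∣ v.asIdeal.map (algebraMap (𝓞 K) (𝓞 M)) := by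
  rw [Ideal.dvd_iff_le, Ideal.map_le_iff_le_comap]
  constructor
  · rintro rfl
    exact le_rfl
  · intro h
    ext1
    exact (v.isMaximal.eq_of_le (w.under (𝓞 K)).isPrime.ne_top h).symm

theorem exists_absNorm_eq_pow (w : HeightOneSpectrum (𝓞 M)) :
    ∃ f, 1 ≤ f ∧ Ideal.absNorm w.asIdeal = Ideal.absNorm (w.under (𝓞 K)).asIdeal ^ f := by
  have : w.asIdeal.LiesOver (w.under (𝓞 K)).asIdeal := ⟨rfl⟩
  have h := Ideal.absNorm_eq_pow_inertiaDeg'_of_liesOver w.asIdeal (w.under (𝓞 K)).asIdeal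
    (w.under (𝓞 K)).isPrime (w.under (𝓞 K)).ne_bot
  refine ⟨_, Nat.one_le_iff_ne_zero.2 fun h0 => ?_, h⟩
  rw [h0, pow_zero] at h
  have := two_le_absNorm M w
  omega

theorem absNorm_under_le (w : HeightOneSpectrum (𝓞 M)) :
    Ideal.absNorm (w.under (𝓞 K)).asIdeal ≤ Ideal.absNorm w.asIdeal := by
  obtain ⟨f, hf, h⟩ := exists_absNorm_eq_pow (K := K) w
  rw [h]
  exact Nat.le_self_pow (by omega) _

theorem eq_of_dvd_of_absNorm_eq {I J : Ideal (𝓞 M)} (hJ : J ≠ ⊥) (h : I ∣ J)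
    (hn : Ideal.absNorm I = Ideal.absNorm J) : I = J := by
  obtain ⟨L, rfl⟩ := h
  rw [map_mul] at hn
  have h0 : Ideal.absNorm I ≠ 0 := fun h0 => hJ (by
    rw [Ideal.absNorm_eq_zero_iff] at h0
    rw [h0, Ideal.bot_mul])
  have h1 : Ideal.absNorm L = 1 := by
    have := Nat.eq_of_mul_eq_mul_left (Nat.pos_of_ne_zero h0) ((mul_one _).trans hn)
    exact this.symm
  rw [Ideal.absNorm_eq_one_iff] at h1
  rw [h1, Ideal.mul_top]

theorem map_asIdeal_ne_bot (v : HeightOneSpectrum (𝓞 K)) :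
    v.asIdeal.map (algebraMap (𝓞 K) (𝓞 M)) ≠ ⊥ := by
  rw [Ne, Ideal.map_eq_bot_iff_of_injective (RingOfIntegers.algebraMap.injective K M)]
  exact v.ne_bot

/-- A prime of residue degree greater than one in a quadratic extension is inert. -/
theorem asIdeal_eq_map_under (h2 : Module.finrank K M = 2) (w : HeightOneSpectrum (𝓞 M))
    (hw : Ideal.absNorm w.asIdeal ≠ Ideal.absNorm (w.under (𝓞 K)).asIdeal) :
    w.asIdeal = (w.under (𝓞 K)).asIdeal.map (algebraMap (𝓞 K) (𝓞 M)) ∧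
      Ideal.absNorm w.asIdeal = Ideal.absNorm (w.under (𝓞 K)).asIdeal ^ 2 := by
  obtain ⟨f, hf, h⟩ := exists_absNorm_eq_pow (K := K) w
  have hd : w.asIdeal ∣ (w.under (𝓞 K)).asIdeal.map (algebraMap (𝓞 K) (𝓞 M)) :=
    under_eq_iff.1 rfl
  have h3 : Ideal.absNorm w.asIdeal = Ideal.absNorm (w.under (𝓞 K)).asIdeal ^ 2 := by
    have h4 := map_dvd Ideal.absNorm hd
    rw [absNorm_map_eq_sq h2, h, Nat.pow_dvd_pow_iff_le_right (two_le_absNorm K _)] at h4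
    have : f = 1 ∨ f = 2 := by omega
    rcases this with rfl | rfl
    · exact absurd (h.trans (pow_one _)) hw
    · exact h
  exact ⟨eq_of_dvd_of_absNorm_eq (map_asIdeal_ne_bot _) hd (by rw [absNorm_map_eq_sq h2, h3]), h3⟩

theorem exists_sub_mem_of_absNorm_eq (w : HeightOneSpectrum (𝓞 M))
    (hw : Ideal.absNorm w.asIdeal = Ideal.absNorm (w.under (𝓞 K)).asIdeal) (x : 𝓞 M) :
    ∃ b : 𝓞 K, x - algebraMap (𝓞 K) (𝓞 M) b ∈ w.asIdeal := by
  have hle : (w.under (𝓞 K)).asIdeal ≤ w.asIdeal.comap (algebraMap (𝓞 K) (𝓞 M)) := le_rfl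
  have hinj : Function.Injective (Ideal.quotientMap w.asIdeal (algebraMap (𝓞 K) (𝓞 M)) hle) := Ideal.quotientMap_injective
  have : Finite (𝓞 M ⧸ w.asIdeal) := Ideal.finiteQuotientOfFreeOfNeBot _ w.ne_bot
  have : Finite (𝓞 K ⧸ (w.under (𝓞 K)).asIdeal) :=
    Ideal.finiteQuotientOfFreeOfNeBot _ (w.under (𝓞 K)).ne_bot
  have hcard : Nat.card (𝓞 K ⧸ (w.under (𝓞 K)).asIdeal) = Nat.card (𝓞 M ⧸ w.asIdeal) := by
    simpa only [Ideal.absNorm_apply, Submodule.cardQuot_apply] using hw.symm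
  have hbij := (Nat.bijective_iff_injective_and_card _).2 ⟨hinj, hcard⟩
  obtain ⟨y, hy⟩ := hbij.2 (Ideal.Quotient.mk _ x)
  obtain ⟨b, rfl⟩ := Ideal.Quotient.mk_surjective y
  refine ⟨b, ?_⟩
  exact Ideal.Quotient.eq.1 (hy.symm :
    Ideal.Quotient.mk w.asIdeal x = Ideal.Quotient.mk w.asIdeal (algebraMap (𝓞 K) (𝓞 M) b))

variable {α : 𝓞 M} {a : 𝓞 K}

theorem isSquare_of_absNorm_eq (hα : α ^ 2 = algebraMap (𝓞 K) (𝓞 M) a)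
    (w : HeightOneSpectrum (𝓞 M))
    (hw : Ideal.absNorm w.asIdeal = Ideal.absNorm (w.under (𝓞 K)).asIdeal) :
    ∃ b : 𝓞 K, a - b ^ 2 ∈ (w.under (𝓞 K)).asIdeal := by
  obtain ⟨b, hb⟩ := exists_sub_mem_of_absNorm_eq w hw α
  refine ⟨b, ?_⟩
  change algebraMap (𝓞 K) (𝓞 M) (a - b ^ 2) ∈ w.asIdeal
  rw [map_sub, map_pow, ← hα, sq_sub_sq]
  exact Ideal.mul_mem_left _ _ hb

/-- In a quadratic extension generated by a square root there is a conjugation. -/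
theorem exists_conj (h2 : Module.finrank K M = 2) (hα : α ^ 2 = algebraMap (𝓞 K) (𝓞 M) a)
    (hne : ∀ c : K, algebraMap K M c ≠ α) :
    ∃ σ : 𝓞 M ≃ₐ[𝓞 K] 𝓞 M, σ α = -α := by
  have : Algebra.IsQuadraticExtension K M := ⟨h2⟩
  have hα' : (α : M) ^ 2 = algebraMap K M a := by
    have := congrArg (algebraMap (𝓞 M) M) hα
    rw [map_pow] at this
    exact this
  have h1 : ¬ ∀ σ : M ≃ₐ[K] M, σ (α : M) = α := fun h => by
    obtain ⟨c, hc⟩ := (IsGalois.mem_range_algebraMap_iff_fixed (F := K) (E := M) (α : M)).2 h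
    exact hne c hc
  push Not at h1
  obtain ⟨σ, hσ⟩ := h1
  refine ⟨RingOfIntegers.mapAlgEquiv σ, ?_⟩
  ext
  change σ (α : M) = -(α : M)
  have h3 : σ (α : M) ^ 2 = (α : M) ^ 2 := by
    rw [← map_pow, hα', AlgEquiv.commutes]
  exact (sq_eq_sq_iff_eq_or_eq_neg.1 h3).resolve_left hσ

theorem exists_pair_of_isSquare (h2 : Module.finrank K M = 2)
    (hα : α ^ 2 = algebraMap (𝓞 K) (𝓞 M) a) (hne : ∀ c : K, algebraMap K M c ≠ α)
    (v : HeightOneSpectrum (𝓞 K)) (hv : 2 * a ∉ v.asIdeal)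
    (hb : ∃ b : 𝓞 K, a - b ^ 2 ∈ v.asIdeal) :
    ∃ w w' : HeightOneSpectrum (𝓞 M), w ≠ w' ∧
      v.asIdeal.map (algebraMap (𝓞 K) (𝓞 M)) = w.asIdeal * w'.asIdeal := by
  obtain ⟨b, hb⟩ := hb
  obtain ⟨σ, hσ⟩ := exists_conj h2 hα hne
  have htop : v.asIdeal.map (algebraMap (𝓞 K) (𝓞 M)) ≠ ⊤ := fun h => by
    have h1 := absNorm_map_eq_sq h2 v.asIdeal
    rw [h, Ideal.absNorm_top] at h1
    have := two_le_absNorm K v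
    nlinarith
  obtain ⟨m, hm, hvm⟩ := Ideal.exists_le_maximal _ htop
  let w₀ : HeightOneSpectrum (𝓞 M) :=
    ⟨m, hm.isPrime, fun h => map_asIdeal_ne_bot (M := M) v (le_bot_iff.1 (h ▸ hvm))⟩
  have hw₀ : w₀.under (𝓞 K) = v := under_eq_iff.2 (Ideal.dvd_iff_le.2 hvm)
  have key : ∃ w : HeightOneSpectrum (𝓞 M), w.under (𝓞 K) = v ∧
      α - algebraMap (𝓞 K) (𝓞 M) b ∈ w.asIdeal := by
    have h1 : algebraMap (𝓞 K) (𝓞 M) (a - b ^ 2) ∈ w₀.asIdeal := by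
      rw [← hw₀] at hb
      exact hb
    rw [map_sub, map_pow, ← hα, sq_sub_sq] at h1
    rcases w₀.isPrime.mem_or_mem h1 with h1 | h1
    · refine ⟨HeightOneSpectrum.equivOfRingEquiv (σ : 𝓞 M ≃+* 𝓞 M).symm w₀, ?_, ?_⟩
      · rw [← hw₀]
        ext x
        change σ (algebraMap (𝓞 K) (𝓞 M) x) ∈ w₀.asIdeal ↔ algebraMap (𝓞 K) (𝓞 M) x ∈ w₀.asIdeal
        rw [AlgEquiv.commutes]
      · change σ (α - algebraMap (𝓞 K) (𝓞 M) b) ∈ w₀.asIdeal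
        rw [map_sub, AlgEquiv.commutes, hσ, ← neg_add', neg_mem_iff]
        exact h1
    · exact ⟨w₀, hw₀, h1⟩
  obtain ⟨w, hw, hwb⟩ := key
  let w' : HeightOneSpectrum (𝓞 M) := HeightOneSpectrum.equivOfRingEquiv (σ : 𝓞 M ≃+* 𝓞 M).symm w
  have hmem : ∀ x, x ∈ w'.asIdeal ↔ σ x ∈ w.asIdeal := fun x => Iff.rfl
  have hw' : w'.under (𝓞 K) = v := by
    rw [← hw]
    ext x
    change σ (algebraMap (𝓞 K) (𝓞 M) x) ∈ w.asIdeal ↔ algebraMap (𝓞 K) (𝓞 M) x ∈ w.asIdeal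
    rw [AlgEquiv.commutes]
  have hne' : w ≠ w' := by
    intro h
    have h1 : σ (α - algebraMap (𝓞 K) (𝓞 M) b) ∈ w.asIdeal := by
      rw [← hmem, ← h]
      exact hwb
    rw [map_sub, AlgEquiv.commutes, hσ] at h1
    have h3 : algebraMap (𝓞 K) (𝓞 M) (2 * a) ∈ w.asIdeal := by
      have h4 := w.asIdeal.mul_mem_left α (sub_mem hwb h1)
      have h5 : α * (α - algebraMap (𝓞 K) (𝓞 M) b - (-α - algebraMap (𝓞 K) (𝓞 M) b)) =
          algebraMap (𝓞 K) (𝓞 M) (2 * a) := by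
        rw [map_mul, ← hα, map_ofNat]
        ring
      rwa [h5] at h4
    rw [← hw] at hv
    exact hv h3
  have hdvd : w.asIdeal * w'.asIdeal ∣ v.asIdeal.map (algebraMap (𝓞 K) (𝓞 M)) := by
    refine IsCoprime.mul_dvd ?_ (under_eq_iff.1 hw) (under_eq_iff.1 hw')
    rw [Ideal.isCoprime_iff_sup_eq]
    exact w.isMaximal.coprime_of_ne w'.isMaximal fun h => hne' (HeightOneSpectrum.ext h)
  refine ⟨w, w', hne', (eq_of_dvd_of_absNorm_eq (map_asIdeal_ne_bot v) hdvd ?_).symm⟩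
  refine Nat.dvd_antisymm (map_dvd Ideal.absNorm hdvd) ?_
  obtain ⟨f, hf, h⟩ := exists_absNorm_eq_pow (K := K) w
  obtain ⟨f', hf', h'⟩ := exists_absNorm_eq_pow (K := K) w'
  rw [map_mul, h, h', hw, hw', absNorm_map_eq_sq h2, ← pow_add]
  exact pow_dvd_pow _ (by omega)

theorem absNorm_eq_of_map_eq_mul (h2 : Module.finrank K M = 2) {v : HeightOneSpectrum (𝓞 K)}
    {w w' : HeightOneSpectrum (𝓞 M)}
    (h : v.asIdeal.map (algebraMap (𝓞 K) (𝓞 M)) = w.asIdeal * w'.asIdeal) :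
    w.under (𝓞 K) = v ∧ w'.under (𝓞 K) = v ∧
      Ideal.absNorm w.asIdeal = Ideal.absNorm v.asIdeal ∧
      Ideal.absNorm w'.asIdeal = Ideal.absNorm v.asIdeal := by
  have hw : w.under (𝓞 K) = v := under_eq_iff.2 (h ▸ dvd_mul_right _ _)
  have hw' : w'.under (𝓞 K) = v := under_eq_iff.2 (h ▸ dvd_mul_left _ _)
  obtain ⟨f, hf, h1⟩ := exists_absNorm_eq_pow (K := K) w
  obtain ⟨f', hf', h1'⟩ := exists_absNorm_eq_pow (K := K) w'
  have h3 := congrArg Ideal.absNorm h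
  rw [absNorm_map_eq_sq h2, map_mul, h1, h1', hw, hw', ← pow_add] at h3
  have h4 := Nat.pow_right_injective (two_le_absNorm K v) h3
  have hf1 : f = 1 := by omega
  have hf1' : f' = 1 := by omega
  rw [h1, h1', hw, hw', hf1, hf1', pow_one]
  exact ⟨rfl, rfl, rfl, rfl⟩

/-- The number of primes above `v` with the same norm as `v`. -/
noncomputable def degreeOneCount (M : Type*) [Field M] [NumberField M] [Algebra K M]
    (v : HeightOneSpectrum (𝓞 K)) : ℕ :=
  Nat.card {w : HeightOneSpectrum (𝓞 M) //
    w.under (𝓞 K) = v ∧ Ideal.absNorm w.asIdeal = Ideal.absNorm v.asIdeal}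

open Classical in
/-- The quadratic residue symbol of `a` modulo the prime `v`. -/
noncomputable def residueSymbol (v : HeightOneSpectrum (𝓞 K)) (a : 𝓞 K) : ℤ :=
  letI := Ideal.Quotient.field v.asIdeal
  letI : Fintype (𝓞 K ⧸ v.asIdeal) :=
    @Fintype.ofFinite _ (Ideal.finiteQuotientOfFreeOfNeBot v.asIdeal v.ne_bot)
  quadraticCharFun (𝓞 K ⧸ v.asIdeal) (Ideal.Quotient.mk v.asIdeal a)

theorem residueSymbol_mul (v : HeightOneSpectrum (𝓞 K)) (a b : 𝓞 K) :
    residueSymbol v (a * b) = residueSymbol v a * residueSymbol v b := by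
  classical
  letI := Ideal.Quotient.field v.asIdeal
  letI : Fintype (𝓞 K ⧸ v.asIdeal) :=
    @Fintype.ofFinite _ (Ideal.finiteQuotientOfFreeOfNeBot v.asIdeal v.ne_bot)
  rw [residueSymbol, map_mul]
  exact quadraticCharFun_mul _ _

theorem residueSymbol_one (v : HeightOneSpectrum (𝓞 K)) : residueSymbol v 1 = 1 := by
  classical
  letI := Ideal.Quotient.field v.asIdeal
  letI : Fintype (𝓞 K ⧸ v.asIdeal) :=
    @Fintype.ofFinite _ (Ideal.finiteQuotientOfFreeOfNeBot v.asIdeal v.ne_bot)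
  rw [residueSymbol, map_one]
  exact quadraticCharFun_one

theorem residueSymbol_eq (v : HeightOneSpectrum (𝓞 K)) {a : 𝓞 K} (ha : a ∉ v.asIdeal) :
    ((∃ b : 𝓞 K, a - b ^ 2 ∈ v.asIdeal) ∧ residueSymbol v a = 1) ∨
      (¬ (∃ b : 𝓞 K, a - b ^ 2 ∈ v.asIdeal) ∧ residueSymbol v a = -1) := by
  classical
  have h0 : Ideal.Quotient.mk v.asIdeal a ≠ 0 := by rwa [Ne, Ideal.Quotient.eq_zero_iff_mem]
  have hsq : (∃ b : 𝓞 K, a - b ^ 2 ∈ v.asIdeal) ↔ IsSquare (Ideal.Quotient.mk v.asIdeal a) := by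
    constructor
    · rintro ⟨b, hb⟩
      rw [← Ideal.Quotient.eq, map_pow] at hb
      exact ⟨_, hb.trans (sq _)⟩
    · rintro ⟨y, hy⟩
      obtain ⟨b, rfl⟩ := Ideal.Quotient.mk_surjective y
      exact ⟨b, by rw [← Ideal.Quotient.eq, hy, map_pow, sq]⟩
  rw [hsq]
  by_cases h : IsSquare (Ideal.Quotient.mk v.asIdeal a)
  · exact .inl ⟨h, by rw [residueSymbol, quadraticCharFun, if_neg h0, if_pos h]⟩
  · exact .inr ⟨h, by rw [residueSymbol, quadraticCharFun, if_neg h0, if_neg h]⟩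

theorem degreeOneCount_eq (h2 : Module.finrank K M = 2)
    (hα : α ^ 2 = algebraMap (𝓞 K) (𝓞 M) a) (hne : ∀ c : K, algebraMap K M c ≠ α)
    (v : HeightOneSpectrum (𝓞 K)) (hv : 2 * a ∉ v.asIdeal) :
    (degreeOneCount M v : ℤ) = 1 + residueSymbol v a := by
  have ha : a ∉ v.asIdeal := fun h => hv (v.asIdeal.mul_mem_left _ h)
  rcases residueSymbol_eq v ha with ⟨hsq, h1⟩ | ⟨hsq, h1⟩
  · obtain ⟨w, w', hww, hmap⟩ := exists_pair_of_isSquare h2 hα hne v hv hsq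
    obtain ⟨h3, h4, h5, h6⟩ := absNorm_eq_of_map_eq_mul h2 hmap
    have hset : {u : HeightOneSpectrum (𝓞 M) | u.under (𝓞 K) = v ∧
        Ideal.absNorm u.asIdeal = Ideal.absNorm v.asIdeal} = {w, w'} := by
      ext u
      constructor
      · rintro ⟨hu, -⟩
        have hd := under_eq_iff.1 hu
        rw [hmap] at hd
        rcases (Ideal.prime_of_isPrime u.ne_bot u.isPrime).dvd_or_dvd hd with h | h
        · exact .inl (HeightOneSpectrum.ext
            (w.isMaximal.eq_of_le u.isPrime.ne_top (Ideal.dvd_iff_le.1 h)).symm)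
        · exact .inr (HeightOneSpectrum.ext
            (w'.isMaximal.eq_of_le u.isPrime.ne_top (Ideal.dvd_iff_le.1 h)).symm)
      · rintro (rfl | rfl)
        · exact ⟨h3, h5⟩
        · exact ⟨h4, h6⟩
    have : degreeOneCount M v = 2 := by
      change Set.ncard {u : HeightOneSpectrum (𝓞 M) | u.under (𝓞 K) = v ∧
        Ideal.absNorm u.asIdeal = Ideal.absNorm v.asIdeal} = 2
      rw [hset, Set.ncard_pair hww]
    rw [this, h1]
    norm_num
  · have : IsEmpty {w : HeightOneSpectrum (𝓞 M) //
        w.under (𝓞 K) = v ∧ Ideal.absNorm w.asIdeal = Ideal.absNorm v.asIdeal} := by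
      refine ⟨fun ⟨w, hw, hn⟩ => hsq ?_⟩
      subst hw
      exact isSquare_of_absNorm_eq hα w hn
    rw [degreeOneCount, Nat.card_of_isEmpty, h1]
    norm_num

/-- A prime not containing `2 * a` splits in `M = K(√a)` iff `a` is a square modulo it. -/
theorem exists_mul_iff_residueSymbol_eq_one (h2 : Module.finrank K M = 2)
    (hα : α ^ 2 = algebraMap (𝓞 K) (𝓞 M) a) (hne : ∀ c : K, algebraMap K M c ≠ α)
    (v : HeightOneSpectrum (𝓞 K)) (hv : 2 * a ∉ v.asIdeal) :
    (∃ P Q : Ideal (𝓞 M), P ≠ Q ∧ P.IsPrime ∧ Q.IsPrime ∧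
      v.asIdeal.map (algebraMap (𝓞 K) (𝓞 M)) = P * Q) ↔ residueSymbol v a = 1 := by
  have ha : a ∉ v.asIdeal := fun h => hv (v.asIdeal.mul_mem_left _ h)
  have hsq : (∃ b : 𝓞 K, a - b ^ 2 ∈ v.asIdeal) ↔ residueSymbol v a = 1 := by
    rcases residueSymbol_eq v ha with ⟨hsq, h1⟩ | ⟨hsq, h1⟩ <;> simp [hsq, h1]
  rw [← hsq]
  constructor
  · rintro ⟨P, Q, hPQ, hP, hQ, h⟩
    have hb := map_asIdeal_ne_bot (M := M) v
    rw [h] at hb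
    let w : HeightOneSpectrum (𝓞 M) := ⟨P, hP, fun h => hb (by rw [h, Ideal.bot_mul])⟩
    let w' : HeightOneSpectrum (𝓞 M) := ⟨Q, hQ, fun h => hb (by rw [h, Ideal.mul_bot])⟩
    obtain ⟨h3, -, h5, -⟩ := absNorm_eq_of_map_eq_mul (w := w) (w' := w') h2 h
    subst h3
    exact isSquare_of_absNorm_eq hα w h5
  · intro hb
    obtain ⟨w, w', hww, h⟩ := exists_pair_of_isSquare h2 hα hne v hv hb
    exact ⟨w.asIdeal, w'.asIdeal, fun h => hww (HeightOneSpectrum.ext h), w.isPrime, w'.isPrime, h⟩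

end Quadratic
end PrimeIdealCount

namespace PrimeIdealCount
open IsDedekindDomain

theorem finite_prime_absNorm_le_real (K : Type*) [Field K] [NumberField K] (x : ℝ) :
    {v : HeightOneSpectrum (𝓞 K) | (Ideal.absNorm v.asIdeal : ℝ) ≤ x}.Finite :=
  (finite_prime_absNorm_le K ⌊x⌋₊).subset fun _ hv => Nat.le_floor hv

/-- The finite set of primes of norm at most `x`. -/
noncomputable def primesLE (K : Type*) [Field K] [NumberField K] (x : ℝ) :
    Finset (HeightOneSpectrum (𝓞 K)) :=
  (finite_prime_absNorm_le_real K x).toFinset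

theorem mem_primesLE {K : Type*} [Field K] [NumberField K] {x : ℝ}
    {v : HeightOneSpectrum (𝓞 K)} :
    v ∈ primesLE K x ↔ (Ideal.absNorm v.asIdeal : ℝ) ≤ x := by
  simp [primesLE]

theorem card_primesLE (K : Type*) [Field K] [NumberField K] (x : ℝ) : (primesLE K x).card =
    Nat.card {v : HeightOneSpectrum (𝓞 K) // (Ideal.absNorm v.asIdeal : ℝ) ≤ x} := by
  exact (Nat.subtype_card _ fun _ => mem_primesLE).symm

theorem card_primesLE_sub_isBigO (K : Type*) [Field K] [NumberField K] :
    (fun x : ℝ => ((primesLE K x).card : ℝ) - x / Real.log x) =O[atTop]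
      (fun x : ℝ => x / Real.log x ^ 2) := by
  obtain ⟨C, hC⟩ := exists_abs_card_prime_sub_le K
  refine Asymptotics.IsBigO.of_bound C ?_
  filter_upwards [eventually_ge_atTop (Real.exp 2)] with x hx
  have hx0 : 0 < x := (Real.exp_pos 2).trans_le hx
  rw [card_primesLE, Real.norm_eq_abs, Real.norm_eq_abs, abs_of_nonneg (a := x / _) (by positivity)]
  exact hC x hx

theorem sqrt_isBigO : Real.sqrt =O[atTop] (fun x : ℝ => x / Real.log x ^ 2) := by
  have h1 := (isLittleO_log_rpow_atTop (r := 1 / 4) (by norm_num)).isBigO.pow 2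
  have h2 : (fun x : ℝ => (x ^ (1 / 4 : ℝ)) ^ 2) =ᶠ[atTop] Real.sqrt := by
    filter_upwards [eventually_ge_atTop 0] with x hx
    rw [Real.sqrt_eq_rpow, ← Real.rpow_natCast, ← Real.rpow_mul hx]
    norm_num
  have h3 := h1.trans_eventuallyEq h2
  have h4 := (h3.mul (Asymptotics.isBigO_refl Real.sqrt atTop)).mul
    (Asymptotics.isBigO_refl (fun x : ℝ => (Real.log x ^ 2)⁻¹) atTop)
  refine (h4.congr' ?_ ?_)
  · filter_upwards [eventually_gt_atTop 1] with x hx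
    have := Real.log_pos hx
    field_simp
  · filter_upwards [eventually_ge_atTop 0] with x hx
    rw [Real.mul_self_sqrt hx, div_eq_mul_inv]

theorem one_isBigO : (fun _ : ℝ => (1 : ℝ)) =O[atTop] (fun x : ℝ => x / Real.log x ^ 2) := by
  refine Asymptotics.IsBigO.trans ?_ sqrt_isBigO
  refine Asymptotics.IsBigO.of_bound 1 ?_
  filter_upwards [eventually_ge_atTop 1] with x hx
  rw [norm_one, one_mul, Real.norm_of_nonneg (Real.sqrt_nonneg _)]
  exact Real.one_le_sqrt.2 hx

theorem card_primesLE_isBigO (K : Type*) [Field K] [NumberField K] :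
    (fun x : ℝ => ((primesLE K x).card : ℝ)) =O[atTop] (fun x : ℝ => x) := by
  have h1 : (fun x : ℝ => x / Real.log x ^ 2) =O[atTop] (fun x : ℝ => x) := by
    refine Asymptotics.IsBigO.of_bound 1 ?_
    filter_upwards [eventually_ge_atTop (Real.exp 2)] with x hx
    have hx0 : 0 < x := (Real.exp_pos 2).trans_le hx
    have hl : 2 ≤ Real.log x := two_le_log hx
    rw [Real.norm_of_nonneg (by positivity), Real.norm_of_nonneg hx0.le, one_mul]
    exact div_le_self hx0.le (by nlinarith)
  have h2 : (fun x : ℝ => x / Real.log x) =O[atTop] (fun x : ℝ => x) := by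
    refine Asymptotics.IsBigO.of_bound 1 ?_
    filter_upwards [eventually_ge_atTop (Real.exp 2)] with x hx
    have hx0 : 0 < x := (Real.exp_pos 2).trans_le hx
    have hl : 2 ≤ Real.log x := two_le_log hx
    rw [Real.norm_of_nonneg (by positivity), Real.norm_of_nonneg hx0.le, one_mul]
    exact div_le_self hx0.le (by linarith)
  simpa using ((card_primesLE_sub_isBigO K).trans h1).add h2

theorem card_primesLE_sqrt_isBigO (K : Type*) [Field K] [NumberField K] :
    (fun x : ℝ => ((primesLE K (√x)).card : ℝ)) =O[atTop] (fun x : ℝ => x / Real.log x ^ 2) :=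
  ((card_primesLE_isBigO K).comp_tendsto Real.tendsto_sqrt_atTop).trans sqrt_isBigO

theorem finite_prime_mem {K : Type*} [Field K] [NumberField K] {a : 𝓞 K} (ha : a ≠ 0) :
    {v : HeightOneSpectrum (𝓞 K) | a ∈ v.asIdeal}.Finite := by
  have h := Ideal.finite_factors (R := 𝓞 K) (I := Ideal.span {a})
    (by rwa [Ne, Submodule.zero_eq_bot, Ideal.span_singleton_eq_bot])
  refine h.subset fun v hv => ?_
  exact Ideal.dvd_span_singleton.2 hv

theorem abs_sum_le_of_support {ι : Type*} (f : ι → ℝ) (B : Finset ι) (hB : ∀ i ∉ B, f i = 0)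
    (s : Finset ι) : |∑ i ∈ s, f i| ≤ ∑ i ∈ B, |f i| := by
  classical
  have h1 : ∑ i ∈ s, f i = ∑ i ∈ s ∩ B, f i := by
    refine (Finset.sum_subset Finset.inter_subset_left fun i hi hn => hB i fun h => ?_).symm
    exact hn (Finset.mem_inter.2 ⟨hi, h⟩)
  rw [h1]
  exact (Finset.abs_sum_le_sum_abs _ _).trans
    (Finset.sum_le_sum_of_subset_of_nonneg Finset.inter_subset_right fun _ _ _ => abs_nonneg _)

section Quadratic

variable {K M : Type*} [Field K] [NumberField K] [Field M] [NumberField M] [Algebra K M]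

theorem card_primesLE_eq (h2 : Module.finrank K M = 2) (x : ℝ) :
    ∃ E : ℕ, E ≤ (primesLE K (√x)).card ∧
      (primesLE M x).card = ∑ v ∈ primesLE K x, degreeOneCount M v + E := by
  classical
  let p : HeightOneSpectrum (𝓞 M) → Prop := fun w =>
    Ideal.absNorm w.asIdeal = Ideal.absNorm (w.under (𝓞 K)).asIdeal
  refine ⟨((primesLE M x).filter fun w => ¬ p w).card, ?_, ?_⟩
  · refine Finset.card_le_card_of_injOn (fun w => w.under (𝓞 K)) ?_ ?_
    · intro w hw
      rw [Finset.mem_coe, Finset.mem_filter, mem_primesLE] at hw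
      rw [Finset.mem_coe, mem_primesLE]
      have h3 := (asIdeal_eq_map_under h2 w hw.2).2
      rw [h3] at hw
      refine Real.le_sqrt_of_sq_le ?_
      exact_mod_cast hw.1
    · intro w hw w' hw' h
      rw [Finset.mem_coe, Finset.mem_filter] at hw hw'
      ext1
      rw [(asIdeal_eq_map_under h2 w hw.2).1, (asIdeal_eq_map_under h2 w' hw'.2).1]
      exact congrArg (fun v : HeightOneSpectrum (𝓞 K) =>
        v.asIdeal.map (algebraMap (𝓞 K) (𝓞 M))) h
  · rw [← Finset.card_filter_add_card_filter_not (s := primesLE M x) p]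
    congr 1
    rw [Finset.card_eq_sum_card_fiberwise (f := fun w => w.under (𝓞 K)) (t := primesLE K x)]
    · refine Finset.sum_congr rfl fun v hv => ?_
      rw [mem_primesLE] at hv
      rw [degreeOneCount]
      refine (Nat.subtype_card _ fun w => ?_).symm
      rw [Finset.mem_filter, Finset.mem_filter, mem_primesLE]
      constructor
      · rintro ⟨⟨-, hw⟩, rfl⟩
        exact ⟨rfl, hw⟩
      · rintro ⟨rfl, hw⟩
        exact ⟨⟨by rwa [hw], hw⟩, rfl⟩
    · intro w hw
      rw [Finset.mem_coe, Finset.mem_filter, mem_primesLE] at hw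
      rw [Finset.mem_coe, mem_primesLE]
      refine le_trans ?_ hw.1
      exact_mod_cast absNorm_under_le w

variable {α : 𝓞 M} {a : 𝓞 K}

/-- The residue symbol of a non-square has mean value zero over the primes, with an error term. -/
theorem sum_residueSymbol_isBigO (h2 : Module.finrank K M = 2)
    (hα : α ^ 2 = algebraMap (𝓞 K) (𝓞 M) a) (hne : ∀ c : K, algebraMap K M c ≠ α) :
    (fun x : ℝ => ∑ v ∈ primesLE K x, (residueSymbol v a : ℝ)) =O[atTop]
      (fun x : ℝ => x / Real.log x ^ 2) := by
  have ha : 2 * a ≠ 0 := by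
    intro h
    have h0 : a = 0 := by simpa using h
    rw [h0, map_zero] at hα
    have h1 : α = 0 := by simpa using hα
    exact hne 0 (by rw [h1, map_zero]; rfl)
  set B := (finite_prime_mem ha).toFinset with hB
  let f : HeightOneSpectrum (𝓞 K) → ℝ := fun v =>
    (degreeOneCount M v : ℝ) - 1 - residueSymbol v a
  have hf : ∀ v ∉ B, f v = 0 := by
    intro v hv
    have hv' : 2 * a ∉ v.asIdeal := by simpa [hB] using hv
    have h3 : (degreeOneCount M v : ℝ) = 1 + residueSymbol v a := by
      exact_mod_cast degreeOneCount_eq h2 hα hne v hv'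
    simp only [f, h3]
    ring
  have h4 : (fun x : ℝ => ∑ v ∈ primesLE K x, f v) =O[atTop] (fun x : ℝ => x / Real.log x ^ 2) :=
    Asymptotics.IsBigO.trans (Asymptotics.IsBigO.of_bound (∑ i ∈ B, |f i|)
      (Eventually.of_forall fun x => by
        rw [norm_one, mul_one]
        exact abs_sum_le_of_support f B hf _)) one_isBigO
  choose E hE1 hE2 using card_primesLE_eq (K := K) (M := M) h2
  have h5 : (fun x : ℝ => (E x : ℝ)) =O[atTop] (fun x : ℝ => x / Real.log x ^ 2) :=
    Asymptotics.IsBigO.trans (Asymptotics.IsBigO.of_bound 1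
      (Eventually.of_forall fun x => by
        rw [one_mul, Real.norm_natCast, Real.norm_natCast]
        exact_mod_cast hE1 x)) (card_primesLE_sqrt_isBigO K)
  have h6 := (((card_primesLE_sub_isBigO M).sub (card_primesLE_sub_isBigO K)).sub h4).sub h5
  refine h6.congr_left fun x => ?_
  have h7 : ((primesLE M x).card : ℝ) = ∑ v ∈ primesLE K x, (degreeOneCount M v : ℝ) + E x := by
    exact_mod_cast hE2 x
  simp only [f, Finset.sum_sub_distrib, h7, Finset.sum_const, nsmul_eq_mul, mul_one]
  ring

end Quadratic
end PrimeIdealCount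

namespace PrimeIdealCount
open IsDedekindDomain

/-- The mean value of the residue symbol of a non-square. -/
theorem sum_residueSymbol_isBigO_of_sq_ne {K : Type*} [Field K] [NumberField K] (a : 𝓞 K)
    (ha : ∀ c : K, c ^ 2 ≠ a) :
    (fun x : ℝ => ∑ v ∈ primesLE K x, (residueSymbol v a : ℝ)) =O[atTop]
      (fun x : ℝ => x / Real.log x ^ 2) := by
  have hirr := X_pow_sub_C_irreducible_of_prime Nat.prime_two ha
  have : Fact (Irreducible (Polynomial.X ^ 2 - Polynomial.C (a : K))) := ⟨hirr⟩
  let M := AdjoinRoot (Polynomial.X ^ 2 - Polynomial.C (a : K))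
  have hfr : Module.finrank K M = 2 := by
    rw [(AdjoinRoot.powerBasis hirr.ne_zero).finrank, AdjoinRoot.powerBasis_dim,
      Polynomial.natDegree_X_pow_sub_C]
  have : Module.Finite K M := Module.finite_of_finrank_pos (by omega)
  have : NumberField M := NumberField.of_module_finite K M
  let r : M := AdjoinRoot.root _
  have hr : r ^ 2 = algebraMap K M a := by
    have h := AdjoinRoot.eval₂_root (Polynomial.X ^ 2 - Polynomial.C (a : K))
    rw [Polynomial.eval₂_sub, Polynomial.eval₂_pow, Polynomial.eval₂_X, Polynomial.eval₂_C,
      sub_eq_zero] at h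
    exact h
  have hintg : IsIntegral ℤ r := by
    refine IsIntegral.of_pow (n := 2) (by norm_num) ?_
    rw [hr]
    exact a.isIntegral_coe.algebraMap
  let α : 𝓞 M := ⟨r, hintg⟩
  refine sum_residueSymbol_isBigO (M := M) (α := α) hfr ?_ ?_
  · ext
    exact hr
  · intro c hc
    refine ha c ((algebraMap K M).injective ?_)
    rw [map_pow, hc]
    exact hr

/-- A quadratic extension of number fields is generated by the square root of an integer. -/
theorem exists_sq_eq_of_finrank_eq_two {K M : Type*} [Field K] [NumberField K] [Field M]
    [NumberField M] [Algebra K M] (h2 : Module.finrank K M = 2) :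
    ∃ (α : 𝓞 M) (a : 𝓞 K), α ^ 2 = algebraMap (𝓞 K) (𝓞 M) a ∧ ∀ c : K, algebraMap K M c ≠ α := by
  have : Algebra.IsQuadraticExtension K M := ⟨h2⟩
  have hK : (primitiveRoots (Module.finrank K M) K).Nonempty := by
    rw [h2]
    exact ⟨-1, (mem_primitiveRoots (by norm_num)).2 (IsPrimitiveRoot.neg_one 0 (by norm_num))⟩
  obtain ⟨β, ⟨c, hc⟩, htop⟩ := exists_root_adjoin_eq_top_of_isCyclic K M hK
  rw [h2] at hc
  have hβ : ∀ d : K, algebraMap K M d ≠ β := by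
    rintro d rfl
    have h1 : IntermediateField.adjoin K {algebraMap K M d} = ⊥ :=
      IntermediateField.adjoin_simple_eq_bot_iff.2 (IntermediateField.algebraMap_mem _ _)
    rw [h1] at htop
    have h3 := IntermediateField.finrank_bot (F := K) (E := M)
    rw [htop, IntermediateField.finrank_top', h2] at h3
    omega
  have halg : IsAlgebraic ℤ β :=
    (IsFractionRing.isAlgebraic_iff ℤ ℚ M).2 (Algebra.IsAlgebraic.isAlgebraic β)
  obtain ⟨m, hm, hmi⟩ := halg.exists_integral_multiple
  have hmM : (m : K) ≠ 0 := Int.cast_ne_zero.2 hm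
  have hmul : m • β = algebraMap K M m * β := by
    rw [zsmul_eq_mul, map_intCast]
  have hsq : algebraMap K M ((m : K) ^ 2 * c) = (m • β) ^ 2 := by
    rw [hmul, map_mul, hc, map_pow, mul_pow]
  have hintg : IsIntegral ℤ ((m : K) ^ 2 * c) := by
    rw [← isIntegral_algebraMap_iff (algebraMap K M).injective, hsq]
    exact hmi.pow 2
  refine ⟨⟨m • β, hmi⟩, ⟨(m : K) ^ 2 * c, hintg⟩, ?_, fun d hd => hβ (d / m) ?_⟩
  · ext
    exact hsq.symm
  · have h4 : algebraMap K M d = algebraMap K M m * β := hd.trans hmul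
    rw [map_div₀, h4, mul_div_cancel_left₀]
    exact (map_ne_zero _).2 hmM

theorem residueSymbol_prod {K : Type*} [Field K] [NumberField K] (v : HeightOneSpectrum (𝓞 K))
    {ι : Type*} (s : Finset ι) (a : ι → 𝓞 K) :
    residueSymbol v (∏ i ∈ s, a i) = ∏ i ∈ s, residueSymbol v (a i) := by
  classical
  induction s using Finset.induction_on with
  | empty => exact residueSymbol_one v
  | insert i s hi ih => rw [Finset.prod_insert hi, Finset.prod_insert hi, residueSymbol_mul, ih]

theorem sum_prod_residueSymbol_isBigO {K : Type*} [Field K] [NumberField K] {ι : Type*}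
    [Fintype ι] (a : ι → 𝓞 K)
    (ha : ∀ s : Finset ι, s.Nonempty → ∀ c : K, c ^ 2 ≠ (∏ i ∈ s, a i : 𝓞 K)) :
    (fun x : ℝ => ∑ v ∈ primesLE K x, ∏ i, (1 + -(residueSymbol v (a i) : ℝ)) -
      x / Real.log x) =O[atTop] (fun x : ℝ => x / Real.log x ^ 2) := by
  classical
  have h1 : (fun x : ℝ => ∑ s ∈ (Finset.univ : Finset ι).powerset.erase ∅,
      (-1) ^ s.card * ∑ v ∈ primesLE K x, (residueSymbol v (∏ i ∈ s, a i) : ℝ)) =O[atTop]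
      (fun x : ℝ => x / Real.log x ^ 2) := by
    refine Asymptotics.IsBigO.fun_sum fun s hs => ?_
    exact (sum_residueSymbol_isBigO_of_sq_ne _
      (ha s (Finset.nonempty_iff_ne_empty.2 (Finset.ne_of_mem_erase hs)))).const_mul_left _
  refine ((card_primesLE_sub_isBigO K).add h1).congr_left fun x => ?_
  have h2 : ∀ v : HeightOneSpectrum (𝓞 K), ∏ i, (1 + -(residueSymbol v (a i) : ℝ)) =
      1 + ∑ s ∈ (Finset.univ : Finset ι).powerset.erase ∅,
        (-1) ^ s.card * (residueSymbol v (∏ i ∈ s, a i) : ℝ) := by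
    intro v
    rw [Finset.prod_one_add, ← Finset.add_sum_erase _ _ (Finset.empty_mem_powerset _),
      Finset.prod_empty]
    congr 1
    refine Finset.sum_congr rfl fun s _ => ?_
    rw [residueSymbol_prod, Int.cast_prod, Finset.prod_neg]
  simp only [h2, Finset.sum_add_distrib, Finset.sum_const, nsmul_eq_mul, mul_one]
  rw [Finset.sum_comm]
  simp only [Finset.mul_sum]
  ring

/-- The primes which split in none of the extensions given by square roots of `a i`. -/
theorem card_nonsplit_sub_isBigO {K : Type*} [Field K] [NumberField K] {ι : Type*}
    [Fintype ι] (a : ι → 𝓞 K)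
    (ha : ∀ s : Finset ι, s.Nonempty → ∀ c : K, c ^ 2 ≠ (∏ i ∈ s, a i : 𝓞 K))
    (p : HeightOneSpectrum (𝓞 K) → Prop) [DecidablePred p]
    (hp : ∀ v, (∀ i, 2 * a i ∉ v.asIdeal) → (p v ↔ ∀ i, residueSymbol v (a i) ≠ 1)) :
    (fun x : ℝ => (((primesLE K x).filter p).card : ℝ) -
      1 / 2 ^ Fintype.card ι * x / Real.log x) =O[atTop] (fun x : ℝ => x / Real.log x ^ 2) := by
  classical
  have ha0 : ∀ i, 2 * a i ≠ 0 := fun i h => by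
    have h0 : a i = 0 := by simpa using h
    refine ha {i} (Finset.singleton_nonempty i) 0 ?_
    rw [Finset.prod_singleton, h0]
    simp
  set B : Finset (HeightOneSpectrum (𝓞 K)) :=
    Finset.univ.biUnion fun i => (finite_prime_mem (ha0 i)).toFinset with hB
  let f : HeightOneSpectrum (𝓞 K) → ℝ := fun v => (if p v then 1 else 0) -
    1 / 2 ^ Fintype.card ι * ∏ i, (1 + -(residueSymbol v (a i) : ℝ))
  have hf : ∀ v ∉ B, f v = 0 := by
    intro v hv
    have hv' : ∀ i, 2 * a i ∉ v.asIdeal := by simpa [hB] using hv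
    have hsym : ∀ i, residueSymbol v (a i) = 1 ∨ residueSymbol v (a i) = -1 := fun i =>
      (residueSymbol_eq v fun h => hv' i (v.asIdeal.mul_mem_left _ h)).imp And.right And.right
    simp only [f]
    by_cases hpv : p v
    · have h1 : ∀ i, residueSymbol v (a i) = -1 := fun i =>
        (hsym i).resolve_left ((hp v hv').1 hpv i)
      have h2 : ∏ i, (1 + -(residueSymbol v (a i) : ℝ)) = 2 ^ Fintype.card ι := by
        rw [Finset.prod_congr rfl fun i _ => show (1 + -(residueSymbol v (a i) : ℝ)) = 2 by
          rw [h1 i]; norm_num, Finset.prod_const, Finset.card_univ]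
      rw [if_pos hpv, h2, one_div_mul_cancel (by positivity), sub_self]
    · have h1 : ∃ i, residueSymbol v (a i) = 1 := by
        by_contra! h
        exact hpv ((hp v hv').2 h)
      obtain ⟨i, hi⟩ := h1
      rw [if_neg hpv, Finset.prod_eq_zero (Finset.mem_univ i) (by rw [hi]; norm_num), mul_zero,
        sub_zero]
  have h4 : (fun x : ℝ => ∑ v ∈ primesLE K x, f v) =O[atTop] (fun x : ℝ => x / Real.log x ^ 2) :=
    Asymptotics.IsBigO.trans (Asymptotics.IsBigO.of_bound (∑ i ∈ B, |f i|)
      (Eventually.of_forall fun x => by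
        rw [norm_one, mul_one]
        exact abs_sum_le_of_support f B hf _)) one_isBigO
  refine (((sum_prod_residueSymbol_isBigO a ha).const_mul_left
    (1 / 2 ^ Fintype.card ι)).add h4).congr_left fun x => ?_
  simp only [f, Finset.sum_sub_distrib, ← Finset.mul_sum, Finset.card_filter, Nat.cast_sum,
    Nat.cast_ite, Nat.cast_one, Nat.cast_zero]
  ring

end PrimeIdealCount

namespace PrimeIdealCount
open IntermediateField

theorem finrank_finset_sup_le {k Ω : Type*} [Field k] [Field Ω] [Algebra k Ω] {ι : Type*}
    (F : ι → IntermediateField k Ω) (h2 : ∀ i, Module.finrank k (F i) = 2) (s : Finset ι) :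
    Module.finrank k (s.sup F : IntermediateField k Ω) ≤ 2 ^ s.card := by
  classical
  induction s using Finset.induction_on with
  | empty =>
    rw [Finset.sup_empty, IntermediateField.finrank_bot, Finset.card_empty, pow_zero]
  | insert i s hi ih =>
    rw [Finset.sup_insert, Finset.card_insert_of_notMem hi, pow_succ']
    refine (finrank_sup_le _ _).trans ?_
    rw [h2]
    exact Nat.mul_le_mul_left 2 ih

theorem finiteDimensional_finset_sup {k Ω : Type*} [Field k] [Field Ω] [Algebra k Ω] {ι : Type*}
    (F : ι → IntermediateField k Ω) (h2 : ∀ i, Module.finrank k (F i) = 2) (s : Finset ι) :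
    FiniteDimensional k (s.sup F : IntermediateField k Ω) := by
  classical
  induction s using Finset.induction_on with
  | empty =>
    rw [Finset.sup_empty]
    infer_instance
  | insert i s hi ih =>
    rw [Finset.sup_insert]
    have : FiniteDimensional k (F i) :=
      Module.finite_of_finrank_pos (by rw [h2]; norm_num)
    infer_instance

/-- If square roots of `a i` generate an extension of the largest possible degree, then no
nonempty product of the `a i` is a square. -/
theorem sq_ne_prod_of_finrank_iSup {k : IntermediateField ℚ ℂ} [NumberField k] {ι : Type*}
    [Fintype ι] (E : ι → IntermediateField ℚ ℂ) (hk : ∀ i, k ≤ E i)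
    (h2 : ∀ i, Module.finrank ℚ (E i) = 2 * Module.finrank ℚ k)
    (hsup : Module.finrank ℚ (⨆ i, E i : IntermediateField ℚ ℂ) =
      2 ^ Fintype.card ι * Module.finrank ℚ k)
    (α : ι → ℂ) (a : ι → k) (hα : ∀ i, α i ∈ E i) (hαk : ∀ i, α i ∉ k)
    (hsq : ∀ i, α i ^ 2 = a i) (s : Finset ι) (hs : s.Nonempty) (c : k) :
    c ^ 2 ≠ ∏ i ∈ s, a i := by
  classical
  intro hc
  obtain ⟨j, hj⟩ := hs
  have hd : 0 < Module.finrank ℚ k := Module.finrank_pos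
  let F : ι → IntermediateField k ℂ := fun i => extendScalars (hk i)
  have hFmem : ∀ i x, x ∈ F i ↔ x ∈ E i := fun i x => mem_extendScalars (hk i)
  have hF2 : ∀ i, Module.finrank k (F i) = 2 := by
    intro i
    have h3 : Module.finrank ℚ k * Module.finrank k (F i) = Module.finrank ℚ (E i) :=
      Module.finrank_mul_finrank ℚ k (F i)
    rw [h2, mul_comm] at h3
    exact Nat.eq_of_mul_eq_mul_right hd h3
  let G : IntermediateField k ℂ := (Finset.univ.erase j).sup F
  have hFG : ∀ i, i ≠ j → F i ≤ G := fun i hi =>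
    Finset.le_sup (f := F) (Finset.mem_erase.2 ⟨hi, Finset.mem_univ i⟩)
  have hα0 : ∀ i, α i ≠ 0 := fun i h => hαk i (h ▸ zero_mem k)
  have hjG : α j ∈ G := by
    have h4 : (∏ i ∈ s, α i) ^ 2 = (c : ℂ) ^ 2 := by
      rw [← Finset.prod_pow, Finset.prod_congr rfl fun i _ => hsq i]
      have := congrArg (fun x : k => (x : ℂ)) hc
      push_cast at this
      exact this.symm
    have h5 : ∏ i ∈ s, α i ∈ G := by
      rcases sq_eq_sq_iff_eq_or_eq_neg.1 h4 with h | h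
      · rw [h]
        exact G.algebraMap_mem c
      · rw [h]
        exact neg_mem (G.algebraMap_mem c)
    have h6 : ∏ i ∈ s.erase j, α i ∈ G :=
      prod_mem fun i hi => hFG i (Finset.ne_of_mem_erase hi) ((hFmem i _).2 (hα i))
    have h7 : ∏ i ∈ s.erase j, α i ≠ 0 := Finset.prod_ne_zero_iff.2 fun i _ => hα0 i
    rw [← Finset.mul_prod_erase s α hj] at h5
    have h8 := div_mem h5 h6
    rwa [mul_div_cancel_right₀ _ h7] at h8
  have hFj : F j ≤ G := by
    have hfin : FiniteDimensional k (F j) :=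
      Module.finite_of_finrank_pos (by rw [hF2]; norm_num)
    have h9 : k⟮α j⟯ ≤ F j := adjoin_simple_le_iff.2 ((hFmem j _).2 (hα j))
    have h10 : k⟮α j⟯ = F j := by
      refine eq_of_le_of_finrank_le h9 ?_
      rw [hF2]
      have hfin' : FiniteDimensional k k⟮α j⟯ :=
        FiniteDimensional.of_injective (inclusion h9).toLinearMap (inclusion h9).injective
      have h11 : 0 < Module.finrank k k⟮α j⟯ := Module.finrank_pos
      have h12 : Module.finrank k k⟮α j⟯ ≠ 1 := by
        intro h
        rw [finrank_adjoin_simple_eq_one_iff, IntermediateField.mem_bot] at h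
        obtain ⟨d, hd⟩ := h
        exact hαk j (hd ▸ d.2)
      omega
    rw [← h10]
    exact adjoin_simple_le_iff.2 hjG
  have hle : (⨆ i, E i) ≤ G.restrictScalars ℚ := by
    refine iSup_le fun i x hx => ?_
    rw [mem_restrictScalars]
    by_cases hi : i = j
    · subst hi
      exact hFj ((hFmem i x).2 hx)
    · exact hFG i hi ((hFmem i x).2 hx)
  have hGfin : FiniteDimensional k G := finiteDimensional_finset_sup F hF2 _
  have hGQ : FiniteDimensional ℚ G := Module.Finite.trans k G
  have hGQ' : FiniteDimensional ℚ (G.restrictScalars ℚ) := hGQ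
  have h13 : Module.finrank ℚ (⨆ i, E i : IntermediateField ℚ ℂ) ≤
      Module.finrank ℚ (G.restrictScalars ℚ) :=
    LinearMap.finrank_le_finrank_of_injective (f := (inclusion hle).toLinearMap)
      (inclusion hle).injective
  have h14 : Module.finrank ℚ k * Module.finrank k G = Module.finrank ℚ (G.restrictScalars ℚ) :=
    Module.finrank_mul_finrank ℚ k G
  have h15 := finrank_finset_sup_le F hF2 (Finset.univ.erase j)
  have h16 : (Finset.univ.erase j).card < Fintype.card ι :=
    Finset.card_lt_univ_of_notMem (Finset.notMem_erase j _)
  have h17 : 2 ^ (Finset.univ.erase j).card < 2 ^ Fintype.card ι :=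
    Nat.pow_lt_pow_right (by norm_num) h16
  rw [hsup, ← h14, mul_comm] at h13
  have h18 := Nat.le_of_mul_le_mul_left h13 hd
  exact absurd (h18.trans h15) (not_le.2 h17)

end PrimeIdealCount

namespace PrimeIdealCount
open IsDedekindDomain

theorem finrank_conjField (L : IntermediateField ℚ ℂ) :
    Module.finrank ℚ (conjField L) = Module.finrank ℚ L :=
  (IntermediateField.equivMap L (RingHom.toRatAlgHom (starRingEnd ℂ))).toLinearEquiv.finrank_eq.symm

theorem numberField_of_finrank_eq {k : IntermediateField ℚ ℂ} [NumberField k]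
    {L : IntermediateField ℚ ℂ} (h : Module.finrank ℚ L = 2 * Module.finrank ℚ k) :
    NumberField L where
  to_finiteDimensional := Module.finite_of_finrank_pos (by
    rw [h]
    exact Nat.mul_pos (by norm_num) Module.finrank_pos)

/-- Splitting in a quadratic extension is detected by a residue symbol. -/
theorem exists_splitsIn_iff {k : IntermediateField ℚ ℂ} [NumberField k]
    (L : IntermediateField ℚ ℂ) (h : k ≤ L)
    (h2 : Module.finrank ℚ L = 2 * Module.finrank ℚ k) :
    ∃ (α : ℂ) (a : 𝓞 k), α ∈ L ∧ α ∉ k ∧ α ^ 2 = ((a : k) : ℂ) ∧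
      ∀ v : HeightOneSpectrum (𝓞 k), 2 * a ∉ v.asIdeal →
        (SplitsIn k L h v.asIdeal ↔ residueSymbol v a = 1) := by
  have := numberField_of_finrank_eq h2
  letI : Algebra k L := (IntermediateField.inclusion h).toRingHom.toAlgebra
  have hfin : Module.finrank k L = 2 := by
    have h3 := Module.finrank_mul_finrank ℚ k L
    rw [h2, mul_comm] at h3
    exact Nat.eq_of_mul_eq_mul_right Module.finrank_pos h3
  obtain ⟨α, a, hα, hne⟩ := exists_sq_eq_of_finrank_eq_two hfin
  refine ⟨((α : L) : ℂ), a, (α : L).2, fun hm => hne ⟨_, hm⟩ (Subtype.ext rfl), ?_, fun v hv => ?_⟩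
  · have h4 := congrArg (fun x : 𝓞 L => ((x : L) : ℂ)) hα
    exact h4
  · exact exists_mul_iff_residueSymbol_eq_one hfin hα hne v hv

end PrimeIdealCount

/-- Let `k ⊂ ℂ` be an imaginary quadratic field, `L₁, …, Lₙ` quadratic extensions of `k`
in `ℂ`, with conjugate fields `L₁', …, Lₙ'`, such that the compositum of all of them has
degree `2^(2n)` over `k`.  Then the number of nonzero prime ideals `𝔭` of `O_k` of norm
at most `X` which are nonsplit in every `L_i/k` and every `L_i'/k` equals
`(1/2^(2n))·X/log X + O(X/(log X)²)`. -/
theorem count_primes_nonsplit_in_all_quadratic_extensions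
    (k : IntermediateField ℚ ℂ) [NumberField ↥k]
    (hquad : Module.finrank ℚ ↥k = 2)
    (himag : ¬ (k : Set ℂ) ⊆ Set.range (Complex.ofReal))
    (n : ℕ) (hn : 1 ≤ n)
    (L : Fin n → IntermediateField ℚ ℂ)
    (hkL : ∀ i, k ≤ L i)
    (hLquad : ∀ i, Module.finrank ℚ ↥(L i) = 2 * Module.finrank ℚ ↥k)
    (hkL' : ∀ i, k ≤ conjField (L i))
    (hcompositum :
      Module.finrank ℚ ↥(⨆ i, L i ⊔ conjField (L i)) =
        2 ^ (2 * n) * Module.finrank ℚ ↥k) :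
    (fun X : ℝ =>
        (({𝔭 : Ideal (𝓞 ↥k) | 𝔭.IsPrime ∧ 𝔭 ≠ ⊥ ∧
            (∀ i, ¬ SplitsIn k (L i) (hkL i) 𝔭 ∧
              ¬ SplitsIn k (conjField (L i)) (hkL' i) 𝔭) ∧
            (Ideal.absNorm 𝔭 : ℝ) ≤ X}.ncard : ℝ)) -
          (1 / 2 ^ (2 * n)) * X / Real.log X)
      =O[atTop] (fun X : ℝ => X / Real.log X ^ 2) := by
  classical
  let E : Fin n × Bool → IntermediateField ℚ ℂ := fun i => bif i.2 then L i.1 else conjField (L i.1)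
  have hkE : ∀ i, k ≤ E i := by
    rintro ⟨i, _ | _⟩
    · exact hkL' i
    · exact hkL i
  have hE2 : ∀ i, Module.finrank ℚ (E i) = 2 * Module.finrank ℚ k := by
    rintro ⟨i, _ | _⟩
    · exact (PrimeIdealCount.finrank_conjField (L i)).trans (hLquad i)
    · exact hLquad i
  have hcard : Fintype.card (Fin n × Bool) = 2 * n := by
    rw [Fintype.card_prod, Fintype.card_fin, Fintype.card_bool, mul_comm]
  have hsup : (⨆ i, E i) = ⨆ i, L i ⊔ conjField (L i) := by
    rw [iSup_prod]
    exact iSup_congr fun i => iSup_bool_eq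
  choose α a hα hαk hsq hsplit using
    fun i => PrimeIdealCount.exists_splitsIn_iff (E i) (hkE i) (hE2 i)
  have ha : ∀ s : Finset (Fin n × Bool), s.Nonempty → ∀ c : k, c ^ 2 ≠ (∏ i ∈ s, a i : 𝓞 k) := by
    intro s hs c
    have h := PrimeIdealCount.sq_ne_prod_of_finrank_iSup E hkE hE2
      (by rw [hsup, hcompositum, hcard]) α (fun i => (a i : k)) hα hαk hsq s hs c
    have hprod : ((∏ i ∈ s, a i : 𝓞 k) : k) = ∏ i ∈ s, (a i : k) :=
      map_prod (algebraMap (𝓞 k) k) a s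
    rwa [hprod]
  let p : IsDedekindDomain.HeightOneSpectrum (𝓞 k) → Prop :=
    fun v => ∀ i, ¬ SplitsIn k (E i) (hkE i) v.asIdeal
  have hp : ∀ v, (∀ i, 2 * a i ∉ v.asIdeal) →
      (p v ↔ ∀ i, PrimeIdealCount.residueSymbol v (a i) ≠ 1) := fun v hv =>
    forall_congr' fun i => not_congr (hsplit i v (hv i))
  have hmain := PrimeIdealCount.card_nonsplit_sub_isBigO a ha p hp
  rw [hcard] at hmain
  refine hmain.congr_left fun X => ?_
  congr 2
  rw [← Set.ncard_coe_finset, ← Set.ncard_image_of_injective _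
    (fun v w h => IsDedekindDomain.HeightOneSpectrum.ext h :
      Function.Injective fun v : IsDedekindDomain.HeightOneSpectrum (𝓞 k) => v.asIdeal)]
  congr 1
  ext 𝔭
  constructor
  · rintro ⟨v, hv, rfl⟩
    rw [Finset.mem_coe, Finset.mem_filter, PrimeIdealCount.mem_primesLE] at hv
    exact ⟨v.isPrime, v.ne_bot, fun i => ⟨hv.2 (i, true), hv.2 (i, false)⟩, hv.1⟩
  · rintro ⟨h1, h2, h3, h4⟩
    refine ⟨⟨𝔭, h1, h2⟩, ?_, rfl⟩
    rw [Finset.mem_coe, Finset.mem_filter, PrimeIdealCount.mem_primesLE]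
    refine ⟨h4, ?_⟩
    rintro ⟨i, _ | _⟩
    · exact (h3 i).2
    · exact (h3 i).1
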